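/- arXiv:1603.01697 — 4 statements merged into one kernel-verified Lean document; each statement's English description precedes it below -/
import Mathlib

section
/- For every integer k ≥ 3, R(P^k_4, P^k_4) = R(C^k_4, P^k_4) = R(C^k_4, C^k_4) + 1 = 4k − 2. -/
/-- A copy of the `k`-uniform loose path with `n` edges, all of color `b`
(`true` = red, `false` = blue), in the coloring `col` of the `k`-subsets of `V`.
The path is given by an injective listing `f 0, f 1, …, f (n*(k-1))` of its
vertices, with `i`-th edge `{f (i*(k-1)), …, f (i*(k-1)+k-1)}`. -/
def HasLoosePath {V : Type*} [DecidableEq V] (k n : ℕ) (col : Finset V → Bool)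
    (b : Bool) : Prop :=
  ∃ f : ℕ → V, Set.InjOn f (Set.Iio (n * (k - 1) + 1)) ∧
    ∀ i < n, col ((Finset.range k).image fun j => f (i * (k - 1) + j)) = b

/-- A copy of the `k`-uniform loose cycle with `n` edges, all of color `b`
(`true` = red, `false` = blue), in the coloring `col` of the `k`-subsets of `V`.
The cycle is given by an injective listing `f 0, …, f (n*(k-1) - 1)` of its
vertices, with `i`-th edge `{f (i*(k-1) % (n*(k-1))), …, f ((i*(k-1)+k-1) % (n*(k-1)))}`. -/
def HasLooseCycle {V : Type*} [DecidableEq V] (k n : ℕ) (col : Finset V → Bool)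
    (b : Bool) : Prop :=
  ∃ f : ℕ → V, Set.InjOn f (Set.Iio (n * (k - 1))) ∧
    ∀ i < n, col ((Finset.range k).image fun j => f ((i * (k - 1) + j) % (n * (k - 1)))) = b

/-- `R(P^k_n, P^k_m)`: the least positive `N` such that every red-blue coloring of the
`k`-subsets of an `N`-set contains a red `P^k_n` or a blue `P^k_m`. -/
noncomputable def RamseyPP (k n m : ℕ) : ℕ :=
  sInf {N | 0 < N ∧ ∀ col : Finset (Fin N) → Bool,
    HasLoosePath k n col true ∨ HasLoosePath k m col false}

/-- `R(P^k_n, C^k_m)`. -/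
noncomputable def RamseyPC (k n m : ℕ) : ℕ :=
  sInf {N | 0 < N ∧ ∀ col : Finset (Fin N) → Bool,
    HasLoosePath k n col true ∨ HasLooseCycle k m col false}

/-- `R(C^k_n, P^k_m)`. -/
noncomputable def RamseyCP (k n m : ℕ) : ℕ :=
  sInf {N | 0 < N ∧ ∀ col : Finset (Fin N) → Bool,
    HasLooseCycle k n col true ∨ HasLoosePath k m col false}

/-- `R(C^k_n, C^k_m)`. -/
noncomputable def RamseyCC (k n m : ℕ) : ℕ :=
  sInf {N | 0 < N ∧ ∀ col : Finset (Fin N) → Bool,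
    HasLooseCycle k n col true ∨ HasLooseCycle k m col false}


lemma enum_aux {V : Type*} [DecidableEq V] (s : Finset V) (a : V) (ha : a ∈ s) :
    ∃ h : ℕ → V, h 0 = a ∧ Set.InjOn h (Set.Iio s.card) ∧ (Finset.range s.card).image h = s := by
  obtain ⟨l, hl, hls⟩ : ∃ l : List V, l.Nodup ∧ l.toFinset = s.erase a :=
    ⟨(s.erase a).toList, Finset.nodup_toList _, Finset.toList_toFinset _⟩
  have hal : a ∉ l := by
    intro h
    have : a ∈ s.erase a := by rw [← hls]; simpa using h
    simp at this
  have hnd : (a :: l).Nodup := List.nodup_cons.2 ⟨hal, hl⟩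
  have htf : (a :: l).toFinset = s := by
    rw [List.toFinset_cons, hls, Finset.insert_erase ha]
  have hlen : (a :: l).length = s.card := by
    rw [← htf, List.toFinset_card_of_nodup hnd]
  refine ⟨fun i => (a :: l).getD i a, by simp, ?_, ?_⟩
  · intro i hi j hj hij
    simp only [Set.mem_Iio, ← hlen] at hi hj
    simp only [List.getD_eq_getElem _ _ hi, List.getD_eq_getElem _ _ hj] at hij
    exact (List.Nodup.getElem_inj_iff hnd).1 hij
  · ext v
    rw [← htf]
    simp only [Finset.mem_image, Finset.mem_range, List.mem_toFinset]
    rw [htf, ← hlen]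
    constructor
    · rintro ⟨i, hi, rfl⟩
      rw [List.getD_eq_getElem _ _ hi]
      exact List.getElem_mem hi
    · intro hv
      obtain ⟨i, hi, rfl⟩ := List.getElem_of_mem hv
      exact ⟨i, hi, List.getD_eq_getElem _ _ hi⟩

/-- gluing enumerations -/
lemma glue_aux {V : Type*} [DecidableEq V] (m n : ℕ) (hm : 1 ≤ m) (H : ℕ → Finset V) (j : ℕ → V)
    (hH : ∀ i < n, (H i).card = m) (hj : ∀ i < n, j i ∈ H i)
    (hdis : ∀ i < n, ∀ i' < n, ∀ v, v ∈ H i → v ∈ H i' → i = i')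
    (hlast : ∀ i < n, j n ∉ H i) :
    ∃ f : ℕ → V, Set.InjOn f (Set.Iio (n * m + 1)) ∧ (∀ i ≤ n, f (i * m) = j i) ∧
      ∀ i < n, (Finset.range m).image (fun t => f (i * m + t)) = H i := by
  have : ∀ i, ∃ h : ℕ → V, i < n → (h 0 = j i ∧ Set.InjOn h (Set.Iio m) ∧
      (Finset.range m).image h = H i) := by
    intro i
    by_cases hi : i < n
    · obtain ⟨h, h1, h2, h3⟩ := enum_aux (H i) (j i) (hj i hi)
      rw [hH i hi] at h2 h3
      exact ⟨h, fun _ => ⟨h1, h2, h3⟩⟩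
    · exact ⟨fun _ => j i, fun h => absurd h hi⟩
  choose h hh using this
  have hmem : ∀ i < n, ∀ t < m, h i t ∈ H i := by
    intro i hi t ht
    rw [← (hh i hi).2.2]
    exact Finset.mem_image_of_mem _ (Finset.mem_range.2 ht)
  have hdiv : ∀ i t, t < m → (i * m + t) / m = i := by
    intro i t ht
    rw [mul_comm, Nat.mul_add_div (by omega), Nat.div_eq_of_lt ht, add_zero]
  have hmod : ∀ i t, t < m → (i * m + t) % m = t := by
    intro i t ht
    rw [mul_comm, Nat.mul_add_mod, Nat.mod_eq_of_lt ht]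
  have hf : ∀ i < n, ∀ t < m, (fun x => if x < n * m then h (x / m) (x % m) else j n) (i * m + t)
      = h i t := by
    intro i hi t ht
    have : i * m + t < n * m := by nlinarith
    simp only [this, if_true, hdiv i t ht, hmod i t ht]
  refine ⟨fun x => if x < n * m then h (x / m) (x % m) else j n, ?_, ?_, ?_⟩
  · intro x hx y hy hxy
    simp only [Set.mem_Iio] at hx hy
    have hdl : ∀ x, x < n * m → x / m < n ∧ x % m < m := fun x hx =>
      ⟨(Nat.div_lt_iff_lt_mul (by omega)).2 hx, Nat.mod_lt _ (by omega)⟩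
    by_cases hx' : x < n * m <;> by_cases hy' : y < n * m
    · simp only [hx', hy', if_true] at hxy
      obtain ⟨a1, a2⟩ := hdl x hx'
      obtain ⟨b1, b2⟩ := hdl y hy'
      have e := hdis _ a1 _ b1 _ (hmem _ a1 _ a2) (hxy ▸ hmem _ b1 _ b2)
      rw [e] at hxy
      have e2 := (hh _ b1).2.1 a2 b2 hxy
      rw [← Nat.div_add_mod x m, ← Nat.div_add_mod y m, e, e2]
    · simp only [hx', hy', if_true, if_false] at hxy
      obtain ⟨a1, a2⟩ := hdl x hx'
      exact absurd (hxy ▸ hmem _ a1 _ a2) (hlast _ a1)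
    · simp only [hx', hy', if_true, if_false] at hxy
      obtain ⟨a1, a2⟩ := hdl y hy'
      exact absurd (hxy ▸ hmem _ a1 _ a2) (hlast _ a1)
    · omega
  · intro i hi
    rcases hi.lt_or_eq with hi | rfl
    · have := hf i hi 0 (by omega)
      rw [add_zero] at this
      rw [this, (hh i hi).1]
    · simp
  · intro i hi
    rw [← (hh i hi).2.2]
    apply Finset.image_congr
    intro t ht
    exact hf i hi t (by simpa using ht)

lemma mkP4 {V : Type*} [DecidableEq V] {k : ℕ} (hk : 3 ≤ k) {col : Finset V → Bool} {c : Bool}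
    (e0 e1 e2 e3 : Finset V) (j0 j1 j2 j3 j4 : V)
    (k0 : e0.card = k) (k1 : e1.card = k) (k2 : e2.card = k) (k3 : e3.card = k)
    (c0 : col e0 = c) (c1 : col e1 = c) (c2 : col e2 = c) (c3 : col e3 = c)
    (a0 : j0 ∈ e0) (a1 : j1 ∈ e0) (a1' : j1 ∈ e1) (a2 : j2 ∈ e1) (a2' : j2 ∈ e2) (a3 : j3 ∈ e2)
    (a3' : j3 ∈ e3) (a4 : j4 ∈ e3) (n0 : j0 ≠ j1) (n4 : j4 ≠ j3)
    (h01 : ∀ v ∈ e0, v ∈ e1 → v = j1) (h12 : ∀ v ∈ e1, v ∈ e2 → v = j2)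
    (h23 : ∀ v ∈ e2, v ∈ e3 → v = j3)
    (h02 : ∀ v ∈ e0, v ∉ e2) (h13 : ∀ v ∈ e1, v ∉ e3) (h03 : ∀ v ∈ e0, v ∉ e3) :
    HasLoosePath k 4 col c := by
  obtain ⟨m, rfl⟩ : ∃ m, k = m + 1 := ⟨k - 1, by omega⟩
  obtain ⟨f, f1, f2, f3⟩ := glue_aux m 4 (by omega)
    (fun i => if i = 0 then e0.erase j1 else if i = 1 then e1.erase j2 else if i = 2 then
      e2.erase j3 else e3.erase j4)
    (fun i => if i = 0 then j0 else if i = 1 then j1 else if i = 2 then j2 else if i = 3 then j3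
      else j4)
    (by intro i hi; interval_cases i <;> simp [Finset.card_erase_of_mem, *])
    (by intro i hi; interval_cases i <;> simp <;> grind)
    (by intro i hi i' hi' v; interval_cases i <;> interval_cases i' <;> simp <;> grind)
    (by intro i hi; interval_cases i <;> simp <;> grind)
  refine ⟨f, by simpa using f1, ?_⟩
  intro i hi
  have key : (Finset.range (m + 1)).image (fun j => f (i * (m + 1 - 1) + j)) =
      insert (f ((i + 1) * m)) ((Finset.range m).image (fun t => f (i * m + t))) := by
    rw [Finset.range_add_one, Finset.image_insert]
    simp [add_mul]
  rw [key, f2 (i+1) (by omega), f3 i hi]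
  interval_cases i <;> simp [Finset.insert_erase, *]

lemma mkC4 {V : Type*} [DecidableEq V] {k : ℕ} (hk : 3 ≤ k) {col : Finset V → Bool} {c : Bool}
    (e0 e1 e2 e3 : Finset V) (j0 j1 j2 j3 : V)
    (k0 : e0.card = k) (k1 : e1.card = k) (k2 : e2.card = k) (k3 : e3.card = k)
    (c0 : col e0 = c) (c1 : col e1 = c) (c2 : col e2 = c) (c3 : col e3 = c)
    (a0 : j0 ∈ e0) (a1 : j1 ∈ e0) (a1' : j1 ∈ e1) (a2 : j2 ∈ e1) (a2' : j2 ∈ e2) (a3 : j3 ∈ e2)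
    (a3' : j3 ∈ e3) (a4 : j0 ∈ e3)
    (h01 : ∀ v ∈ e0, v ∈ e1 → v = j1) (h12 : ∀ v ∈ e1, v ∈ e2 → v = j2)
    (h23 : ∀ v ∈ e2, v ∈ e3 → v = j3) (h30 : ∀ v ∈ e3, v ∈ e0 → v = j0)
    (h02 : ∀ v ∈ e0, v ∉ e2) (h13 : ∀ v ∈ e1, v ∉ e3) :
    HasLooseCycle k 4 col c := by
  obtain ⟨m, rfl⟩ : ∃ m, k = m + 1 := ⟨k - 1, by omega⟩
  -- only the first three blocks carry the closing vertex freely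
  obtain ⟨h, h0, hinj, him⟩ := enum_aux (e3.erase j0) j3 (by grind)
  obtain ⟨f, f1, f2, f3⟩ := glue_aux m 3 (by omega)
    (fun i => if i = 0 then e0.erase j1 else if i = 1 then e1.erase j2 else e2.erase j3)
    (fun i => if i = 0 then j0 else if i = 1 then j1 else if i = 2 then j2 else j3)
    (by intro i hi; interval_cases i <;> simp [Finset.card_erase_of_mem, *])
    (by intro i hi; interval_cases i <;> simp <;> grind)
    (by intro i hi i' hi' v; interval_cases i <;> interval_cases i' <;> simp <;> grind)
    (by intro i hi; interval_cases i <;> simp <;> grind)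
  have hcard : (e3.erase j0).card = m := by simp [Finset.card_erase_of_mem, *]
  rw [hcard] at hinj him
  have hfmem : ∀ x < 3 * m, f x ∈ e0.erase j1 ∪ e1.erase j2 ∪ e2.erase j3 := by
    intro x hx
    have hi : x / m < 3 := (Nat.div_lt_iff_lt_mul (by omega)).2 hx
    have hx' : f x ∈ (Finset.range m).image (fun t => f (x / m * m + t)) := by
      refine Finset.mem_image.2 ⟨x % m, Finset.mem_range.2 (Nat.mod_lt _ (by omega)), ?_⟩
      rw [mul_comm, Nat.div_add_mod]
    rw [f3 _ hi] at hx'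
    generalize x / m = i at hi hx'
    interval_cases i <;> simp at hx' ⊢ <;> tauto
  have hhmem : ∀ t < m, h t ∈ e3.erase j0 := by
    intro t ht
    rw [← him]
    exact Finset.mem_image_of_mem _ (Finset.mem_range.2 ht)
  refine ⟨fun x => if x < 3 * m then f x else h (x - 3 * m), ?_, ?_⟩
  · intro x hx y hy hxy
    simp only [Set.mem_Iio, Nat.add_sub_cancel] at hx hy
    by_cases hx' : x < 3 * m <;> by_cases hy' : y < 3 * m <;> simp only [hx', hy', if_true, if_false] at hxy
    · exact f1 (by simp; omega) (by simp; omega) hxy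
    · exfalso
      have q1 := hfmem x hx'
      have q2 := hhmem (y - 3 * m) (by omega)
      grind
    · exfalso
      have q1 := hfmem y hy'
      have q2 := hhmem (x - 3 * m) (by omega)
      grind
    · have := hinj (show x - 3 * m ∈ Set.Iio m by simp; omega)
        (show y - 3 * m ∈ Set.Iio m by simp; omega) hxy
      omega
  · intro i hi
    have e3eq : insert j0 ((Finset.range m).image h) = e3 := by rw [him, Finset.insert_erase a4]
    by_cases hi3 : i = 3
    · subst hi3
      rw [Finset.range_add_one, Finset.image_insert]
      have q : (fun x => if x < 3 * m then f x else h (x - 3 * m)) ((3 * (m + 1 - 1) + m) % (4 * (m + 1 - 1))) = j0 := by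
        have : (3 * (m + 1 - 1) + m) % (4 * (m + 1 - 1)) = 0 := by
          have : 3 * (m + 1 - 1) + m = 4 * (m + 1 - 1) := by simp; omega
          rw [this, Nat.mod_self]
        rw [this]
        have h3 : 0 < 3 * m := by omega
        simp only [h3, if_true]
        simpa using f2 0 (by omega)
      rw [q]
      have q2 : (Finset.range m).image (fun j => (fun x => if x < 3 * m then f x else h (x - 3 * m)) ((3 * (m + 1 - 1) + j) % (4 * (m + 1 - 1)))) = (Finset.range m).image h := by
        apply Finset.image_congr
        intro t ht
        have ht : t < m := by simpa using ht
        have e : (3 * (m + 1 - 1) + t) % (4 * (m + 1 - 1)) = 3 * m + t := by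
          rw [Nat.mod_eq_of_lt] <;> simp <;> omega
        simp only [e]
        simp
      rw [q2, e3eq, c3]
    · have hi3 : i < 3 := by omega
      have q2 : (Finset.range (m + 1)).image (fun j => (fun x => if x < 3 * m then f x else h (x - 3 * m)) ((i * (m + 1 - 1) + j) % (4 * (m + 1 - 1)))) = (Finset.range (m + 1)).image (fun j => f (i * m + j)) := by
        apply Finset.image_congr
        intro t ht
        have ht : t < m + 1 := by simpa using ht
        have le : i * m + t ≤ 3 * m := by
          interval_cases i <;> omega
        have e : (i * (m + 1 - 1) + t) % (4 * (m + 1 - 1)) = i * m + t := by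
          rw [Nat.mod_eq_of_lt] <;> simp <;> omega
        simp only [e]
        split_ifs with hlt
        · rfl
        · have e2 : i * m + t = 3 * m := by omega
          rw [e2, Nat.sub_self, h0, f2 3 le_rfl]
          simp
      rw [q2, Finset.range_add_one, Finset.image_insert, f3 i hi3]
      have e : i * m + m = (i + 1) * m := by ring
      rw [e, f2 (i + 1) (by omega)]
      interval_cases i <;> simp [Finset.insert_erase, *]

lemma johnson_aux {V : Type*} [DecidableEq V] (n : ℕ) (φ : Finset V → Bool) (D : Finset V) (t : ℕ) :
    ∀ e f : Finset V, (f \ e).card = t → e ⊆ D → f ⊆ D → e.card = n → f.card = n →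
    φ e = true → φ f = false →
    ∃ S a b, a ∉ S ∧ b ∉ S ∧ a ≠ b ∧ insert a S ⊆ D ∧ insert b S ⊆ D ∧ S.card + 1 = n ∧
      φ (insert a S) = true ∧ φ (insert b S) = false := by
  induction t with
  | zero =>
    intro e f h0 he hf ce cf pe pf
    have : f ⊆ e := by
      rw [Finset.card_eq_zero] at h0
      exact Finset.sdiff_eq_empty_iff_subset.1 h0
    have : f = e := Finset.eq_of_subset_of_card_le this (by omega)
    subst this
    simp [pe] at pf
  | succ t ih =>
    intro e f h0 he hf ce cf pe pf
    obtain ⟨b, hb⟩ : (f \ e).Nonempty := Finset.card_pos.1 (by omega)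
    obtain ⟨a, ha⟩ : (e \ f).Nonempty := by
      apply Finset.card_pos.1
      have := Finset.card_sdiff_add_card_inter e f
      have h2 := Finset.card_sdiff_add_card_inter f e
      rw [Finset.inter_comm] at h2
      omega
    simp only [Finset.mem_sdiff] at ha hb
    have hab : a ≠ b := by rintro rfl; exact ha.2 hb.1
    have hS : (e.erase a).card + 1 = n := by
      rw [Finset.card_erase_of_mem ha.1]
      have := Finset.card_pos.2 ⟨a, ha.1⟩
      omega
    have hsub : insert b (e.erase a) ⊆ D := by
      intro x hx
      simp only [Finset.mem_insert, Finset.mem_erase] at hx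
      rcases hx with rfl | hx
      · exact hf hb.1
      · exact he hx.2
    by_cases hc : φ (insert b (e.erase a)) = true
    · refine ih (insert b (e.erase a)) f ?_ hsub hf ?_ cf hc pf
      · have : f \ insert b (e.erase a) = (f \ e).erase b := by
          ext x
          simp only [Finset.mem_sdiff, Finset.mem_insert, Finset.mem_erase]
          grind
        rw [this, Finset.card_erase_of_mem (by simp [hb])]
        omega
      · rw [Finset.card_insert_of_notMem (by simp [hb.2])]
        exact hS
    · refine ⟨e.erase a, a, b, by simp, by simp [hb.2], hab, ?_, hsub, hS, ?_, by simpa using hc⟩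
      · rwa [Finset.insert_erase ha.1]
      · rwa [Finset.insert_erase ha.1]

lemma johnson {V : Type*} [DecidableEq V] (n : ℕ) (φ : Finset V → Bool) (D : Finset V)
    (e f : Finset V) (he : e ⊆ D) (hf : f ⊆ D) (ce : e.card = n) (cf : f.card = n)
    (hne : φ e ≠ φ f) :
    ∃ S a b, a ∉ S ∧ b ∉ S ∧ a ≠ b ∧ insert a S ⊆ D ∧ insert b S ⊆ D ∧ S.card + 1 = n ∧
      φ (insert a S) = true ∧ φ (insert b S) = false := by
  cases h : φ e
  · exact johnson_aux n φ D _ f e rfl hf he cf ce (by grind) h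
  · exact johnson_aux n φ D _ e f rfl he hf ce cf h (by grind)

set_option maxHeartbeats 4000000 in
/-- The basic contradiction. -/
lemma L0 {V : Type*} [DecidableEq V] {k : ℕ} (hk : 3 ≤ k) {col : Finset V → Bool}
    (hno : ∀ c, ¬ HasLooseCycle k 4 col c) (c : Bool)
    (S S' X Y : Finset V) (a b A B z p P : V)
    (kS : S.card + 1 = k) (kS' : S'.card + 1 = k) (kX : X.card + 3 = k) (kY : Y.card + 3 = k)
    (hl : [a, b, A, B, z].Nodup)
    (dSS : ∀ v ∈ S, v ∉ S') (dSX : ∀ v ∈ S, v ∉ X) (dSY : ∀ v ∈ S, v ∉ Y)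
    (dSX' : ∀ v ∈ S', v ∉ X) (dSY' : ∀ v ∈ S', v ∉ Y) (dXY : ∀ v ∈ X, v ∉ Y)
    (hn : ∀ v ∈ [a, b, A, B, z], v ∉ S ∧ v ∉ S' ∧ v ∉ X ∧ v ∉ Y)
    (hp : p ∈ S) (hP : P ∈ S')
    (r1 : col (insert a S) = c) (r2 : col (insert b S) = !c)
    (r3 : col (insert A S') = c) (r4 : col (insert B S') = !c)
    (r5 : col (insert p (insert P (insert z X))) = c)
    (r6 : col (insert p (insert P (insert z Y))) = c) : False := by
  obtain ⟨q, hq⟩ : (S.erase p).Nonempty := by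
    apply Finset.card_pos.1; rw [Finset.card_erase_of_mem hp]; omega
  obtain ⟨Q, hQ⟩ : (S'.erase P).Nonempty := by
    apply Finset.card_pos.1; rw [Finset.card_erase_of_mem hP]; omega
  simp only [Finset.mem_erase] at hq hQ
  obtain ⟨hqp, hq⟩ := hq
  obtain ⟨hQP, hQ⟩ := hQ
  simp only [List.mem_cons, List.not_mem_nil, or_false, forall_eq_or_imp, forall_eq] at hn
  obtain ⟨na, nb, nA, nB, nz⟩ := hn
  simp only [List.nodup_cons, List.mem_cons, List.not_mem_nil, or_false, not_or] at hl
  have c2 : ∀ (s : Finset V) (u : V), s.card + 1 = k → u ∉ s → (insert u s).card = k := by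
    intro s u h1 h2; rw [Finset.card_insert_of_notMem h2]; exact h1
  have c4 : ∀ (s : Finset V) (u v w : V), s.card + 3 = k → u ≠ v → u ≠ w → v ≠ w →
      u ∉ s → v ∉ s → w ∉ s → (insert u (insert v (insert w s))).card = k := by
    intro s u v w h1 h2 h3 h4 h5 h6 h7
    rw [Finset.card_insert_of_notMem (by simp [*]), Finset.card_insert_of_notMem (by simp [*]),
      Finset.card_insert_of_notMem h7]
    exact h1
  have b1 : col (insert a (insert b (insert Q Y))) = !c := by
    by_contra hcon
    have hcon : col (insert a (insert b (insert Q Y))) = c := by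
      cases c <;> simpa using hcon
    refine hno c (mkC4 hk (insert a S) (insert p (insert P (insert z X))) (insert A S')
      (insert a (insert b (insert Q Y))) a p P Q (c2 _ _ kS (by grind)) (c4 _ _ _ _ kX ?_ ?_ ?_ ?_ ?_ ?_)
      (c2 _ _ kS' (by grind)) (c4 _ _ _ _ kY ?_ ?_ ?_ ?_ ?_ ?_) r1 r5 r3 hcon ?_ ?_ ?_ ?_ ?_ ?_ ?_ ?_ ?_ ?_ ?_ ?_ ?_ ?_)
    all_goals clear hcon c2 c4 hno r1 r2 r3 r4 r5 r6 kS kS' kX kY hk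
    all_goals try simp only [Finset.mem_insert]
    all_goals grind
  have b2 : col (insert q (insert B (insert A X))) = !c := by
    by_contra hcon
    have hcon : col (insert q (insert B (insert A X))) = c := by
      cases c <;> simpa using hcon
    refine hno c (mkC4 hk (insert a S) (insert p (insert P (insert z Y))) (insert A S')
      (insert q (insert B (insert A X))) q p P A (c2 _ _ kS (by grind)) (c4 _ _ _ _ kY ?_ ?_ ?_ ?_ ?_ ?_)
      (c2 _ _ kS' (by grind)) (c4 _ _ _ _ kX ?_ ?_ ?_ ?_ ?_ ?_) r1 r6 r3 hcon ?_ ?_ ?_ ?_ ?_ ?_ ?_ ?_ ?_ ?_ ?_ ?_ ?_ ?_)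
    all_goals clear hcon c2 c4 hno r1 r2 r3 r4 r5 r6 kS kS' kX kY hk
    all_goals try simp only [Finset.mem_insert]
    all_goals grind
  refine hno (!c) (mkC4 hk (insert b S) (insert q (insert B (insert A X))) (insert B S')
      (insert a (insert b (insert Q Y))) b q B Q (c2 _ _ kS (by grind)) (c4 _ _ _ _ kX ?_ ?_ ?_ ?_ ?_ ?_)
      (c2 _ _ kS' (by grind)) (c4 _ _ _ _ kY ?_ ?_ ?_ ?_ ?_ ?_) r2 b2 r4 b1 ?_ ?_ ?_ ?_ ?_ ?_ ?_ ?_ ?_ ?_ ?_ ?_ ?_ ?_)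
  all_goals clear b1 b2 c2 c4 hno r1 r2 r3 r4 r5 r6 kS kS' kX kY hk
  all_goals try simp only [Finset.mem_insert]
  all_goals grind

lemma L0' {V : Type*} [DecidableEq V] {k : ℕ} (hk : 3 ≤ k) {col : Finset V → Bool}
    (hno : ∀ c, ¬ HasLooseCycle k 4 col c)
    (S S' X Y : Finset V) (a b A B z p P : V)
    (kS : S.card + 1 = k) (kS' : S'.card + 1 = k) (kX : X.card + 3 = k) (kY : Y.card + 3 = k)
    (hl : [a, b, A, B, z].Nodup)
    (dSS : ∀ v ∈ S, v ∉ S') (dSX : ∀ v ∈ S, v ∉ X) (dSY : ∀ v ∈ S, v ∉ Y)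
    (dSX' : ∀ v ∈ S', v ∉ X) (dSY' : ∀ v ∈ S', v ∉ Y) (dXY : ∀ v ∈ X, v ∉ Y)
    (hn : ∀ v ∈ [a, b, A, B, z], v ∉ S ∧ v ∉ S' ∧ v ∉ X ∧ v ∉ Y)
    (hp : p ∈ S) (hP : P ∈ S')
    (r1 : col (insert a S) = true) (r2 : col (insert b S) = false)
    (r3 : col (insert A S') = true) (r4 : col (insert B S') = false) :
    col (insert p (insert P (insert z X))) ≠ col (insert p (insert P (insert z Y))) := by
  intro h
  cases h2 : col (insert p (insert P (insert z Y)))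
  · refine L0 hk hno false S S' X Y b a B A z p P kS kS' kX kY ?_ dSS dSX dSY dSX' dSY' dXY ?_ hp hP
      r2 r1 r4 r3 (h.trans h2) h2
    · simp at hl ⊢; grind
    · simp at hn ⊢; grind
  · exact L0 hk hno true S S' X Y a b A B z p P kS kS' kX kY hl dSS dSX dSY dSX' dSY' dXY hn hp hP
      r1 r2 r3 r4 (h.trans h2) h2

lemma L1 {V : Type*} [DecidableEq V] [Fintype V] {k : ℕ} (hk : 3 ≤ k)
    (hV : Fintype.card V = 4 * k - 3) {col : Finset V → Bool}
    (hno : ∀ c, ¬ HasLooseCycle k 4 col c)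
    (S S' : Finset V) (a b A B : V)
    (kS : S.card + 1 = k) (kS' : S'.card + 1 = k)
    (hl : [a, b, A, B].Nodup)
    (dSS : ∀ v ∈ S, v ∉ S')
    (hn : ∀ v ∈ [a, b, A, B], v ∉ S ∧ v ∉ S')
    (r1 : col (insert a S) = true) (r2 : col (insert b S) = false)
    (r3 : col (insert A S') = true) (r4 : col (insert B S') = false) : False := by
  obtain ⟨p, hp⟩ : S.Nonempty := Finset.card_pos.1 (by omega)
  obtain ⟨P, hP⟩ : S'.Nonempty := Finset.card_pos.1 (by omega)
  obtain ⟨n, rfl⟩ : ∃ n, k = n + 3 := ⟨k - 3, by omega⟩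
  simp only [List.mem_cons, List.not_mem_nil, or_false, forall_eq_or_imp, forall_eq] at hn
  simp only [List.nodup_cons, List.mem_cons, List.not_mem_nil, or_false, not_or] at hl
  obtain ⟨na, nb, nA, nB⟩ := hn
  let U : Finset V := insert a (insert b (insert A (insert B (S ∪ S'))))
  have hU : U.card = 2 * n + 8 := by
    have h1 : (S ∪ S').card = S.card + S'.card :=
      Finset.card_union_of_disjoint (Finset.disjoint_left.2 dSS)
    simp only [U]
    rw [Finset.card_insert_of_notMem (by simp; grind), Finset.card_insert_of_notMem (by simp; grind),
      Finset.card_insert_of_notMem (by simp; grind), Finset.card_insert_of_notMem (by simp; grind), h1]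
    omega
  let R : Finset V := Uᶜ
  have hR : R.card = 2 * n + 1 := by
    simp only [R]; rw [Finset.card_compl, hU, hV]; omega
  have hRm : ∀ v ∈ R, v ≠ a ∧ v ≠ b ∧ v ≠ A ∧ v ≠ B ∧ v ∉ S ∧ v ∉ S' := by
    intro v hv
    simp only [R, U, Finset.mem_compl, Finset.mem_insert, Finset.mem_union] at hv
    tauto
  have key : ∀ X Y z, insert z X ⊆ R → Y ⊆ R → X.card = n → Y.card = n → z ∉ X → z ∉ Y →
      (∀ v ∈ X, v ∉ Y) →
      col (insert p (insert P (insert z X))) ≠ col (insert p (insert P (insert z Y))) := by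
    intro X Y z hX hY cX cY hzX hzY hXY
    have hzR : z ∈ R := hX (Finset.mem_insert_self _ _)
    have hXR : ∀ v ∈ X, v ∈ R := fun v hv => hX (Finset.mem_insert_of_mem hv)
    have hYR : ∀ v ∈ Y, v ∈ R := fun v hv => hY hv
    apply L0' hk hno S S' X Y a b A B z p P kS kS' (by omega) (by omega)
    · have := hRm z hzR
      simp; grind
    · exact dSS
    all_goals try simp only [List.mem_cons, List.not_mem_nil, or_false, forall_eq_or_imp, forall_eq]
    all_goals grind
  let φ : Finset V → Bool := fun X => col (insert p (insert P X))
  by_cases hc : ∀ e f, e ⊆ R → f ⊆ R → e.card = n + 1 → f.card = n + 1 → φ e = φ f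
  · obtain ⟨X, hX, cX⟩ := Finset.exists_subset_card_eq (s := R) (n := n) (by omega)
    obtain ⟨z, hz⟩ : (R \ X).Nonempty := by
      apply Finset.card_pos.1; rw [Finset.card_sdiff_of_subset hX]; omega
    have hz' := Finset.mem_sdiff.1 hz
    have cY : ((R \ X).erase z).card = n := by
      rw [Finset.card_erase_of_mem hz, Finset.card_sdiff_of_subset hX]; omega
    have hY : (R \ X).erase z ⊆ R := (Finset.erase_subset _ _).trans Finset.sdiff_subset
    refine key X ((R \ X).erase z) z ?_ hY cX cY hz'.2 (by simp) (by intro v; simp; tauto)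
      (hc _ _ ?_ ?_ ?_ ?_)
    · exact Finset.insert_subset hz'.1 hX
    · exact Finset.insert_subset hz'.1 hX
    · exact Finset.insert_subset hz'.1 hY
    · rw [Finset.card_insert_of_notMem hz'.2, cX]
    · rw [Finset.card_insert_of_notMem (by simp), cY]
  · push Not at hc
    obtain ⟨e, f, he, hf, ce, cf, hne⟩ := hc
    obtain ⟨Z, x, y, hx, hy, hxy, hxR, hyR, cZ, fx, fy⟩ := johnson (n + 1) φ R e f he hf ce cf hne
    have hZ : Z ⊆ R := (Finset.subset_insert _ _).trans hxR
    have hx' : x ∈ R := hxR (Finset.mem_insert_self _ _)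
    have hy' : y ∈ R := hyR (Finset.mem_insert_self _ _)
    have gen : ∀ u ∈ R, u ∉ Z → φ (insert u Z) ≠ φ (R \ Z) := by
      intro u hu huZ
      have h := key Z ((R \ Z).erase u) u (Finset.insert_subset hu hZ)
        ((Finset.erase_subset _ _).trans Finset.sdiff_subset) (by omega)
        (by rw [Finset.card_erase_of_mem (by simp [*]), Finset.card_sdiff_of_subset hZ]; omega)
        huZ (by simp) (by intro v; simp; tauto)
      rwa [Finset.insert_erase (by simp [*])] at h
    have g1 := gen x hx' hx
    have g2 := gen y hy' hy
    rw [fx] at g1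
    rw [fy] at g2
    cases h : φ (R \ Z) <;> simp_all

lemma L2 {V : Type*} [DecidableEq V] [Fintype V] {k : ℕ} (hk : 3 ≤ k)
    (hV : Fintype.card V = 4 * k - 3) {col : Finset V → Bool}
    (hno : ∀ c, ¬ HasLooseCycle k 4 col c)
    (S : Finset V) (a b : V) (kS : S.card + 1 = k) (ha : a ∉ S) (hb : b ∉ S)
    (hne : col (insert a S) ≠ col (insert b S)) (D D' : Finset V)
    (hD : D.card = k) (hD' : D'.card = k)
    (h1 : ∀ v ∈ D, v ≠ a ∧ v ≠ b ∧ v ∉ S) (h2 : ∀ v ∈ D', v ≠ a ∧ v ≠ b ∧ v ∉ S) :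
    col D = col D' := by
  by_contra hcon
  have hab : a ≠ b := by rintro rfl; exact hne rfl
  obtain ⟨S', A, B, hA, hB, hAB, sA, sB, kS', rA, rB⟩ := johnson k col (D ∪ D') D D'
    Finset.subset_union_left Finset.subset_union_right hD hD' hcon
  have hm : ∀ v ∈ D ∪ D', v ≠ a ∧ v ≠ b ∧ v ∉ S := by
    intro v hv
    rcases Finset.mem_union.1 hv with h | h
    · exact h1 v h
    · exact h2 v h
  have hA' := hm A (sA (Finset.mem_insert_self _ _))
  have hB' := hm B (sB (Finset.mem_insert_self _ _))
  have hS' : ∀ v ∈ S', v ≠ a ∧ v ≠ b ∧ v ∉ S := fun v hv => hm v (sA (Finset.mem_insert_of_mem hv))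
  cases h : col (insert a S)
  · have hb2 : col (insert b S) = true := by
      cases h3 : col (insert b S) <;> simp_all
    refine L1 hk hV hno S S' b a A B kS kS' ?_ (by grind) ?_ hb2 h rA rB
    · simp; grind
    · simp; grind
  · have hb2 : col (insert b S) = false := by
      cases h3 : col (insert b S) <;> simp_all
    refine L1 hk hV hno S S' a b A B kS kS' ?_ (by grind) ?_ h hb2 rA rB
    · simp; grind
    · simp; grind

lemma L3 {V : Type*} [DecidableEq V] [Fintype V] {k : ℕ} (hk : 3 ≤ k)
    (hV : Fintype.card V = 4 * k - 3) {col : Finset V → Bool}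
    (hno : ∀ c, ¬ HasLooseCycle k 4 col c) (c : Bool)
    (S : Finset V) (v m : V) (kS : S.card + 1 = k) (hv : v ∉ S) (hm : m ∉ S) (hvm : v ≠ m)
    (rv : col (insert v S) ≠ c) (rm : col (insert m S) = c)
    (hW : ∀ D : Finset V, D.card = k → (∀ x ∈ D, x ≠ v ∧ x ≠ m ∧ x ∉ S) → col D = c) :
    ∀ D : Finset V, D.card = k → (∀ x ∈ D, x ≠ v ∧ x ∉ S) → col D = c := by
  intro D hD hDx
  by_contra hcon
  have hmD : m ∈ D := by
    by_contra hmD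
    exact hcon (hW D hD (fun x hx => ⟨(hDx x hx).1, by rintro rfl; exact hmD hx, (hDx x hx).2⟩))
  obtain ⟨T, hmT, rfl⟩ : ∃ T, m ∉ T ∧ insert m T = D :=
    ⟨D.erase m, by simp, Finset.insert_erase hmD⟩
  have kT : T.card + 1 = k := by rwa [Finset.card_insert_of_notMem hmT] at hD
  have hTx : ∀ x ∈ T, x ≠ v ∧ x ∉ S := fun x hx => hDx x (Finset.mem_insert_of_mem hx)
  let U : Finset V := insert v (insert m (S ∪ T))
  have hU : U.card = 2 * k := by
    have h1 : (S ∪ T).card = S.card + T.card :=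
      Finset.card_union_of_disjoint (Finset.disjoint_right.2 (fun x hx => (hTx x hx).2))
    simp only [U]
    rw [Finset.card_insert_of_notMem (by simp; grind), Finset.card_insert_of_notMem (by simp; grind), h1]
    omega
  have hUc : Uᶜ.card = 2 * k - 3 := by rw [Finset.card_compl, hU, hV]; omega
  have hUm : ∀ x ∈ Uᶜ, x ≠ v ∧ x ≠ m ∧ x ∉ S ∧ x ∉ T := by
    intro x hx
    simp only [U, Finset.mem_compl, Finset.mem_insert, Finset.mem_union] at hx
    tauto
  obtain ⟨w0, hw0⟩ : (Uᶜ).Nonempty := Finset.card_pos.1 (by omega)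
  obtain ⟨T', hT', kT'⟩ := Finset.exists_subset_card_eq (s := Uᶜ.erase w0) (n := k - 1)
    (by rw [Finset.card_erase_of_mem hw0]; omega)
  obtain ⟨w1, hw1⟩ : T'.Nonempty := Finset.card_pos.1 (by omega)
  have hT'm : ∀ x ∈ T', x ≠ w0 ∧ x ≠ v ∧ x ≠ m ∧ x ∉ S ∧ x ∉ T := by
    intro x hx
    have := Finset.mem_erase.1 (hT' hx)
    exact ⟨this.1, hUm x this.2⟩
  have hw0m := hUm w0 hw0
  have hw1m := hT'm w1 hw1
  have cI : ∀ (s : Finset V) (u : V), s.card + 1 = k → u ∉ s → (insert u s).card = k := by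
    intro s u h1 h2; rw [Finset.card_insert_of_notMem h2]; exact h1
  have cT : ∀ w, w ∉ T → w ≠ v → w ≠ m → w ∉ S → col (insert w T) = c := by
    intro w h1 h2 h3 h4
    apply hW _ (cI _ _ kT h1)
    intro x hx
    rcases Finset.mem_insert.1 hx with rfl | hx
    · exact ⟨h2, h3, h4⟩
    · exact ⟨(hTx x hx).1, by rintro rfl; exact hmT hx, (hTx x hx).2⟩
  have cw0 := cT w0 (by tauto) (by tauto) (by tauto) (by tauto)
  have cw1 := cT w1 (by tauto) (by tauto) (by tauto) (by tauto)
  have q1 : col (insert w0 S) = col (insert v S) := by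
    apply L2 hk hV hno T w1 m kT (by tauto) hmT (by rw [cw1]; exact fun h => hcon h.symm)
      _ _ (cI _ _ kS (by tauto)) (cI _ _ kS hv)
    · simp only [Finset.mem_insert]; grind
    · simp only [Finset.mem_insert]; grind
  have q2 : col (insert v T') = col (insert w1 T) := by
    apply L2 hk hV hno S m w0 kS hm (by tauto) (by rw [rm, q1]; exact fun h => rv h.symm)
      _ _ (cI _ _ (by omega) (by grind)) (cI _ _ kT (by tauto))
    · simp only [Finset.mem_insert]; grind
    · simp only [Finset.mem_insert]; grind
  have q3 : col (insert v T') = col (insert v S) := by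
    apply L2 hk hV hno T w0 m kT (by tauto) hmT (by rw [cw0]; exact fun h => hcon h.symm)
      _ _ (cI _ _ (by omega) (by grind)) (cI _ _ kS hv)
    · simp only [Finset.mem_insert]; grind
    · simp only [Finset.mem_insert]; grind
  exact rv (by rw [← q3, q2, cw1])

/-- two edges inside a set of `2k-1` points with prescribed endpoints -/
lemma split_aux {V : Type*} [DecidableEq V] {k : ℕ} (hk : 3 ≤ k) (A : Finset V) (x y : V)
    (hx : x ∈ A) (hy : y ∈ A) (hxy : x ≠ y) (hA : A.card = 2 * k - 1) :
    ∃ e f j, e ⊆ A ∧ f ⊆ A ∧ e.card = k ∧ f.card = k ∧ x ∈ e ∧ y ∈ f ∧ j ∈ e ∧ j ∈ f ∧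
      j ≠ x ∧ j ≠ y ∧ x ∉ f ∧ y ∉ e ∧ ∀ v ∈ e, v ∈ f → v = j := by
  have h1 : ((A.erase x).erase y).card = 2 * k - 3 := by
    rw [Finset.card_erase_of_mem (by simp [*, hxy.symm]), Finset.card_erase_of_mem hx]; omega
  obtain ⟨I, hI, cI⟩ := Finset.exists_subset_card_eq (s := (A.erase x).erase y) (n := k - 2) (by omega)
  obtain ⟨j, hj⟩ : (((A.erase x).erase y) \ I).Nonempty := by
    apply Finset.card_pos.1; rw [Finset.card_sdiff_of_subset hI]; omega
  have hIm : ∀ v ∈ I, v ≠ y ∧ v ≠ x ∧ v ∈ A := by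
    intro v hv; simpa using hI hv
  have hjm : (j ≠ y ∧ j ≠ x ∧ j ∈ A) ∧ j ∉ I := by simpa using hj
  refine ⟨insert x (insert j I), insert y (((A.erase x).erase y) \ I), j, ?_, ?_, ?_, ?_, by simp,
    by simp, by simp, Finset.mem_insert_of_mem hj, by tauto, by tauto, by simp [hxy], ?_, ?_⟩
  · intro v; simp only [Finset.mem_insert]; grind
  · intro v; simp only [Finset.mem_insert, Finset.mem_sdiff, Finset.mem_erase]; grind
  · rw [Finset.card_insert_of_notMem (by simp; grind), Finset.card_insert_of_notMem (by tauto)]; omega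
  · rw [Finset.card_insert_of_notMem (by simp), Finset.card_sdiff_of_subset hI]; omega
  · simp; grind
  · intro v; simp only [Finset.mem_insert, Finset.mem_sdiff, Finset.mem_erase]; grind

lemma C4_of_sets {V : Type*} [DecidableEq V] {k : ℕ} (hk : 3 ≤ k) {col : Finset V → Bool} {c : Bool}
    (A B : Finset V) (x y : V) (hxA : x ∈ A) (hyA : y ∈ A) (hxB : x ∈ B) (hyB : y ∈ B) (hxy : x ≠ y)
    (hA : A.card = 2 * k - 1) (hB : B.card = 2 * k - 1) (hAB : ∀ v ∈ A, v ∈ B → v = x ∨ v = y)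
    (rA : ∀ D ⊆ A, D.card = k → col D = c) (rB : ∀ D ⊆ B, D.card = k → col D = c) :
    HasLooseCycle k 4 col c := by
  obtain ⟨e, f, j, h1, h2, h3, h4, h5, h6, h7, h8, h9, h10, h11, h12, h13⟩ :=
    split_aux hk A x y hxA hyA hxy hA
  obtain ⟨e', f', j', i1, i2, i3, i4, i5, i6, i7, i8, i9, i10, i11, i12, i13⟩ :=
    split_aux hk B y x hyB hxB hxy.symm hB
  have g1 : ∀ v ∈ e, v ∈ A := fun v hv => h1 hv
  have g2 : ∀ v ∈ f, v ∈ A := fun v hv => h2 hv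
  have g3 : ∀ v ∈ e', v ∈ B := fun v hv => i1 hv
  have g4 : ∀ v ∈ f', v ∈ B := fun v hv => i2 hv
  refine mkC4 hk e f e' f' x j y j' h3 h4 i3 i4 (rA _ h1 h3) (rA _ h2 h4) (rB _ i1 i3) (rB _ i2 i4)
    h5 h7 h8 h6 i5 i7 i8 i6 h13 ?_ i13 ?_ ?_ ?_
  all_goals grind

lemma CC_upper {V : Type*} [DecidableEq V] [Fintype V] {k : ℕ} (hk : 3 ≤ k)
    (hV : Fintype.card V = 4 * k - 3) (col : Finset V → Bool) :
    ∃ c, HasLooseCycle k 4 col c := by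
  by_contra hcon
  have hno : ∀ c, ¬ HasLooseCycle k 4 col c := fun c h => hcon ⟨c, h⟩
  -- a monochromatic-complement pair
  have full : ∀ c, ∃ D : Finset V, D.card = k ∧ col D ≠ c := by
    intro c
    by_contra hall
    push Not at hall
    obtain ⟨A, -, hA⟩ := Finset.exists_subset_card_eq (s := (Finset.univ : Finset V)) (n := 2 * k - 1)
      (by rw [Finset.card_univ]; omega)
    obtain ⟨x, hx, y, hy, hxy⟩ := Finset.one_lt_card.1 (show 1 < A.card by omega)
    obtain ⟨B, hB, cB⟩ := Finset.exists_subset_card_eq (s := Aᶜ) (n := 2 * k - 3)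
      (by rw [Finset.card_compl]; omega)
    have hBm : ∀ v ∈ B, v ∉ A := fun v hv => by simpa using hB hv
    refine hno c (C4_of_sets hk A (insert x (insert y B)) x y hx hy (by simp) (by simp) hxy hA ?_ ?_
      (fun D _ h => hall D h) (fun D _ h => hall D h))
    · rw [Finset.card_insert_of_notMem (by simp; grind), Finset.card_insert_of_notMem (by grind)]; omega
    · intro v; simp only [Finset.mem_insert]; grind
  obtain ⟨D1, k1, n1⟩ := full false
  obtain ⟨D2, k2, n2⟩ := full true
  obtain ⟨S, a, b, ha, hb, hab, -, -, kS, ra, rb⟩ := johnson k col Finset.univ D1 D2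
    (Finset.subset_univ _) (Finset.subset_univ _) k1 k2 (by cases h : col D1 <;> simp_all)
  -- the colour of the complement
  obtain ⟨c, S, v, m, kS, hv, hm, hvm, rv, rm, hW⟩ : ∃ (c : Bool) (S : Finset V) (v m : V),
      S.card + 1 = k ∧ v ∉ S ∧ m ∉ S ∧ v ≠ m ∧ col (insert v S) ≠ c ∧ col (insert m S) = c ∧
      ∀ D : Finset V, D.card = k → (∀ x ∈ D, x ≠ v ∧ x ≠ m ∧ x ∉ S) → col D = c := by
    have hU : (insert a (insert b S)).card = k + 1 := by
      rw [Finset.card_insert_of_notMem (by simp [*]), Finset.card_insert_of_notMem hb]; omega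
    obtain ⟨D0, hD0, kD0⟩ := Finset.exists_subset_card_eq (s := (insert a (insert b S))ᶜ) (n := k)
      (by rw [Finset.card_compl, hU, hV]; omega)
    have hD0m : ∀ x ∈ D0, x ≠ a ∧ x ≠ b ∧ x ∉ S := by
      intro x hx; simpa using hD0 hx
    have hall : ∀ D : Finset V, D.card = k → (∀ x ∈ D, x ≠ a ∧ x ≠ b ∧ x ∉ S) → col D = col D0 :=
      fun D hD hx => L2 hk hV hno S a b kS ha hb (by rw [ra, rb]; simp) D D0 hD kD0 hx hD0m
    cases h : col D0
    · exact ⟨false, S, a, b, kS, ha, hb, hab, by simp [ra], rb, fun D h1 h2 => h ▸ hall D h1 h2⟩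
    · exact ⟨true, S, b, a, kS, hb, ha, hab.symm, by simp [rb], ra,
        fun D h1 h2 => h ▸ hall D h1 (fun x hx => by have := h2 x hx; tauto)⟩
  have hM0 := L3 hk hV hno c S v m kS hv hm hvm rv rm hW
  -- a maximal monochromatic set
  classical
  let F : Finset (Finset V) := Finset.univ.filter (fun M => ∀ D ⊆ M, D.card = k → col D = c)
  have hF0 : (insert v S)ᶜ ∈ F := by
    simp only [F, Finset.mem_filter, Finset.mem_univ, true_and]
    intro D hD kD
    apply hM0 D kD
    intro x hx
    simpa using hD hx
  obtain ⟨M, hMF, hMmax⟩ := Finset.exists_max_image F Finset.card ⟨_, hF0⟩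
  have hMc : 3 * k - 3 ≤ M.card := by
    have := hMmax _ hF0
    rw [Finset.card_compl, Finset.card_insert_of_notMem hv, hV] at this
    omega
  have hMr : ∀ D ⊆ M, D.card = k → col D = c := by
    simpa only [F, Finset.mem_filter, Finset.mem_univ, true_and] using hMF
  clear hW hM0 hF0 rv rm hvm hm hv kS
  clear v m S
  obtain ⟨v, hv⟩ : ∃ v, v ∉ M := by
    by_contra hall
    push Not at hall
    obtain ⟨D, hD, hD'⟩ := full c
    exact hD' (hMr D (fun x _ => hall x) hD)
  obtain ⟨D, hDM, kD, hD⟩ : ∃ D ⊆ insert v M, D.card = k ∧ col D ≠ c := by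
    by_contra hall
    push Not at hall
    have : insert v M ∈ F := by
      simp only [F, Finset.mem_filter, Finset.mem_univ, true_and]
      exact hall
    have := hMmax _ this
    rw [Finset.card_insert_of_notMem hv] at this
    omega
  have hvD : v ∈ D := by
    by_contra hvD
    exact hD (hMr D ((Finset.subset_insert_iff_of_notMem hvD).1 hDM) kD)
  obtain ⟨S, hvS, rfl⟩ : ∃ S, v ∉ S ∧ insert v S = D :=
    ⟨D.erase v, by simp, Finset.insert_erase hvD⟩
  have kS : S.card + 1 = k := by rwa [Finset.card_insert_of_notMem hvS] at kD
  have hSM : S ⊆ M := by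
    intro x hx
    rcases Finset.mem_insert.1 (hDM (Finset.mem_insert_of_mem hx)) with rfl | h
    · exact absurd hx hvS
    · exact h
  have hMS : (M \ S).card = M.card - S.card := Finset.card_sdiff_of_subset hSM
  obtain ⟨m, hm⟩ : (M \ S).Nonempty := Finset.card_pos.1 (by omega)
  have hm' := Finset.mem_sdiff.1 hm
  have rm : col (insert m S) = c := hMr _ (Finset.insert_subset hm'.1 hSM)
    (by rw [Finset.card_insert_of_notMem hm'.2]; exact kS)
  have hvm : v ≠ m := by rintro rfl; exact hv hm'.1
  obtain ⟨D0, hD0, kD0⟩ := Finset.exists_subset_card_eq (s := (M \ S).erase m) (n := k)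
    (by rw [Finset.card_erase_of_mem hm]; omega)
  have hD0m : ∀ x ∈ D0, x ≠ m ∧ x ∈ M ∧ x ∉ S := by
    intro x hx; simpa using hD0 hx
  have rD0 : col D0 = c := hMr D0 (fun x hx => (hD0m x hx).2.1) kD0
  have hN := L3 hk hV hno c S v m kS hvS hm'.2 hvm hD rm (by
    intro D' hD' hx
    rw [← rD0]
    refine L2 hk hV hno S v m kS hvS hm'.2 (by rw [rm]; exact hD) D' D0 hD' kD0 hx ?_
    intro x hx
    have := hD0m x hx
    exact ⟨by rintro rfl; exact hv this.2.1, this.1, this.2.2⟩)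
  -- build the final cycle
  have hMv : (insert v M).card = M.card + 1 := Finset.card_insert_of_notMem hv
  have hcard1 : ((insert v M)ᶜ).card ≤ k - 1 := by
    rw [Finset.card_compl, hMv, hV]; omega
  have hsub : (insert v M)ᶜ ⊆ (insert v S)ᶜ := by
    intro x; simp only [Finset.mem_compl, Finset.mem_insert]
    intro h h2; apply h; rcases h2 with h2 | h2
    · exact Or.inl h2
    · exact Or.inr (hSM h2)
  obtain ⟨A, hA1, hA2, cA⟩ := Finset.exists_subsuperset_card_eq hsub (n := 2 * k - 1) (by omega)
    (by rw [Finset.card_compl, kD, hV]; omega)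
  have hAM : 1 < (A ∩ M).card := by
    have h1 := Finset.card_sdiff_add_card_inter A M
    have h2 : A \ M ⊆ (insert v M)ᶜ := by
      intro x hx
      have hx' := Finset.mem_sdiff.1 hx
      have hx2 : x ≠ v ∧ x ∉ S := by simpa using hA2 hx'.1
      simp only [Finset.mem_compl, Finset.mem_insert]
      tauto
    have := Finset.card_le_card h2
    omega
  obtain ⟨x, hx, y, hy, hxy⟩ := Finset.one_lt_card.1 hAM
  have hx' := Finset.mem_inter.1 hx
  have hy' := Finset.mem_inter.1 hy
  have hvA : v ∉ A := by
    intro h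
    have := hA2 h
    simp at this
  have hBm : ∀ z ∈ (insert v A)ᶜ, z ∈ M ∧ z ∉ A := by
    intro z hz
    have hz' : z ≠ v ∧ z ∉ A := by simpa using hz
    refine ⟨?_, hz'.2⟩
    by_contra hzM
    exact hz'.2 (hA1 (by simp [hz'.1, hzM]))
  refine hno c (C4_of_sets hk A (insert x (insert y (insert v A)ᶜ)) x y hx'.1 hy'.1 (by simp) (by simp)
    hxy cA ?_ ?_ ?_ ?_)
  · rw [Finset.card_insert_of_notMem (by simp; grind), Finset.card_insert_of_notMem (by grind),
      Finset.card_compl, Finset.card_insert_of_notMem hvA, hV]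
    omega
  · intro z hz hz2
    simp only [Finset.mem_insert] at hz2
    grind
  · intro D hD kD'
    apply hN D kD'
    intro z hz
    simpa using hA2 (hD hz)
  · intro D hD kD'
    apply hMr D _ kD'
    intro z hz
    have := hD hz
    simp only [Finset.mem_insert] at this
    grind

/-- data of a monochromatic loose quadrangle -/
structure Quad {V : Type*} [DecidableEq V] (k : ℕ) (col : Finset V → Bool) (c : Bool)
    (E0 E1 E2 E3 : Finset V) (v0 v1 v2 v3 : V) : Prop where
  k0 : E0.card + 2 = k
  k1 : E1.card + 2 = k
  k2 : E2.card + 2 = k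
  k3 : E3.card + 2 = k
  d01 : ∀ v ∈ E0, v ∉ E1
  d02 : ∀ v ∈ E0, v ∉ E2
  d03 : ∀ v ∈ E0, v ∉ E3
  d12 : ∀ v ∈ E1, v ∉ E2
  d13 : ∀ v ∈ E1, v ∉ E3
  d23 : ∀ v ∈ E2, v ∉ E3
  n01 : v0 ≠ v1
  n02 : v0 ≠ v2
  n03 : v0 ≠ v3
  n12 : v1 ≠ v2
  n13 : v1 ≠ v3
  n23 : v2 ≠ v3
  m0 : v0 ∉ E0 ∧ v0 ∉ E1 ∧ v0 ∉ E2 ∧ v0 ∉ E3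
  m1 : v1 ∉ E0 ∧ v1 ∉ E1 ∧ v1 ∉ E2 ∧ v1 ∉ E3
  m2 : v2 ∉ E0 ∧ v2 ∉ E1 ∧ v2 ∉ E2 ∧ v2 ∉ E3
  m3 : v3 ∉ E0 ∧ v3 ∉ E1 ∧ v3 ∉ E2 ∧ v3 ∉ E3
  c0 : col (insert v0 (insert v1 E0)) = c
  c1 : col (insert v1 (insert v2 E1)) = c
  c2 : col (insert v2 (insert v3 E2)) = c
  c3 : col (insert v3 (insert v0 E3)) = c

lemma Quad.rot {V : Type*} [DecidableEq V] {k : ℕ} {col : Finset V → Bool} {c : Bool}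
    {E0 E1 E2 E3 : Finset V} {v0 v1 v2 v3 : V} (h : Quad k col c E0 E1 E2 E3 v0 v1 v2 v3) :
    Quad k col c E1 E2 E3 E0 v1 v2 v3 v0 := by
  obtain ⟨k0, k1, k2, k3, d01, d02, d03, d12, d13, d23, n01, n02, n03, n12, n13, n23, m0, m1, m2, m3, c0, c1, c2, c3⟩ := h
  constructor <;> first | assumption | grind

lemma Quad.refl' {V : Type*} [DecidableEq V] {k : ℕ} {col : Finset V → Bool} {c : Bool}
    {E0 E1 E2 E3 : Finset V} {v0 v1 v2 v3 : V} (h : Quad k col c E0 E1 E2 E3 v0 v1 v2 v3) :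
    Quad k col c E0 E3 E2 E1 v1 v0 v3 v2 := by
  obtain ⟨k0, k1, k2, k3, d01, d02, d03, d12, d13, d23, n01, n02, n03, n12, n13, n23, m0, m1, m2, m3, c0, c1, c2, c3⟩ := h
  constructor <;> first | assumption | (rw [Finset.insert_comm]; assumption) | grind

lemma card_ii {V : Type*} [DecidableEq V] {k : ℕ} {E : Finset V} {u v : V} (hE : E.card + 2 = k)
    (huv : u ≠ v) (hu : u ∉ E) (hv : v ∉ E) : (insert u (insert v E)).card = k := by
  rw [Finset.card_insert_of_notMem (by simp [*]), Finset.card_insert_of_notMem hv]; exact hE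

lemma Quad.link {V : Type*} [DecidableEq V] {k : ℕ} (hk : 3 ≤ k) {col : Finset V → Bool} {c : Bool}
    {E0 E1 E2 E3 : Finset V} {v0 v1 v2 v3 : V} (h : Quad k col c E0 E1 E2 E3 v0 v1 v2 v3)
    (hno : ¬ HasLoosePath k 4 col c) (w : V)
    (hw : w ∉ E0 ∧ w ∉ E1 ∧ w ∉ E2 ∧ w ∉ E3 ∧ w ≠ v0 ∧ w ≠ v1 ∧ w ≠ v2 ∧ w ≠ v3) :
    col (insert v0 (insert w E0)) = !c := by
  obtain ⟨k0, k1, k2, k3, d01, d02, d03, d12, d13, d23, n01, n02, n03, n12, n13, n23, m0, m1, m2, m3, c0, c1, c2, c3⟩ := h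
  by_contra hcon
  have hcon : col (insert v0 (insert w E0)) = c := by cases c <;> simpa using hcon
  refine hno (mkP4 hk (insert v1 (insert v2 E1)) (insert v2 (insert v3 E2)) (insert v3 (insert v0 E3))
    (insert v0 (insert w E0)) v1 v2 v3 v0 w (card_ii k1 n12 (by tauto) (by tauto))
    (card_ii k2 n23 (by tauto) (by tauto)) (card_ii k3 n03.symm (by tauto) (by tauto))
    (card_ii k0 (by tauto) (by tauto) (by tauto)) c1 c2 c3 hcon (by simp) (by simp) (by simp) (by simp)
    (by simp) (by simp) (by simp) (by simp) n12 (by tauto) ?_ ?_ ?_ ?_ ?_ ?_)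
  all_goals simp only [Finset.mem_insert]
  all_goals grind

lemma Quad.of_cycle {V : Type*} [DecidableEq V] {k : ℕ} (hk : 3 ≤ k) {col : Finset V → Bool} {c : Bool}
    (h : HasLooseCycle k 4 col c) : ∃ E0 E1 E2 E3 v0 v1 v2 v3,
      Quad k col c E0 E1 E2 E3 v0 v1 v2 v3 := by
  obtain ⟨m, rfl⟩ : ∃ m, k = m + 2 := ⟨k - 2, by omega⟩
  obtain ⟨f, hf, hc⟩ := h
  have e1 : m + 2 - 1 = m + 1 := rfl
  rw [e1] at hf hc
  let E : ℕ → Finset V := fun i => (Finset.range m).image (fun t => f (i * (m + 1) + 1 + t))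
  have hmem : ∀ i v, v ∈ E i ↔ ∃ t < m, f (i * (m + 1) + 1 + t) = v := by
    intro i v; simp [E]
  have hinj : ∀ x y, x < 4 * (m + 1) → y < 4 * (m + 1) → f x = f y → x = y := fun x y hx hy h => hf hx hy h
  have hcard : ∀ i < 4, (E i).card + 2 = m + 2 := by
    intro i hi
    simp only [E]
    rw [Finset.card_image_of_injOn, Finset.card_range]
    intro s hs t ht hst
    have hs : s < m := by simpa using hs
    have ht : t < m := by simpa using ht
    have := hinj _ _ (by interval_cases i <;> omega) (by interval_cases i <;> omega) hst
    omega
  have hdis : ∀ i < 4, ∀ i' < 4, i ≠ i' → ∀ v ∈ E i, v ∉ E i' := by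
    intro i hi i' hi' hne v hv hv'
    obtain ⟨s, hs, rfl⟩ := (hmem _ _).1 hv
    obtain ⟨t, ht, hst⟩ := (hmem _ _).1 hv'
    have := hinj _ _ (by interval_cases i' <;> omega) (by interval_cases i <;> omega) hst
    interval_cases i <;> interval_cases i' <;> omega
  have hvE : ∀ i < 4, ∀ i' < 4, f (i * (m + 1)) ∉ E i' := by
    intro i hi i' hi' hv'
    obtain ⟨t, ht, hst⟩ := (hmem _ _).1 hv'
    have := hinj _ _ (by interval_cases i' <;> omega) (by interval_cases i <;> omega) hst
    interval_cases i <;> interval_cases i' <;> omega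
  have hvv : ∀ i < 4, ∀ i' < 4, i ≠ i' → f (i * (m + 1)) ≠ f (i' * (m + 1)) := by
    intro i hi i' hi' hne hst
    have := hinj _ _ (by interval_cases i <;> omega) (by interval_cases i' <;> omega) hst
    interval_cases i <;> interval_cases i' <;> omega
  have hedge : ∀ i < 4, col (insert (f (i * (m + 1))) (insert (f ((i + 1) * (m + 1) % (4 * (m + 1)))) (E i))) = c := by
    intro i hi
    rw [← hc i hi]
    congr 1
    rw [Finset.range_add_one, Finset.image_insert, Finset.insert_comm]
    have e2 : (i + 1) * (m + 1) = i * (m + 1) + (m + 1) := by ring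
    rw [e2]
    congr 1
    rw [Finset.range_eq_Ico, ← Finset.insert_Ico_add_one_left_eq_Ico (by omega : 0 < m + 1), Finset.image_insert]
    have hlt : ∀ t ≤ m, (i * (m + 1) + t) % (4 * (m + 1)) = i * (m + 1) + t := by
      intro t ht
      apply Nat.mod_eq_of_lt
      interval_cases i <;> omega
    rw [hlt 0 (by omega)]
    congr 1
    ext v
    rw [hmem]
    simp only [Finset.mem_image, Finset.mem_Ico]
    constructor
    · rintro ⟨t, ht, rfl⟩
      refine ⟨t + 1, by omega, ?_⟩
      rw [hlt _ (by omega)]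
      congr 1; omega
    · rintro ⟨t, ht, rfl⟩
      refine ⟨t - 1, by omega, ?_⟩
      rw [hlt _ (by omega)]
      congr 1; omega
  have md : ∀ i < 4, i * (m + 1) % (4 * (m + 1)) = i * (m + 1) := by
    intro i hi
    apply Nat.mod_eq_of_lt
    interval_cases i <;> omega
  refine ⟨E 0, E 1, E 2, E 3, f (0 * (m + 1)), f (1 * (m + 1)), f (2 * (m + 1)), f (3 * (m + 1)),
    ⟨hcard 0 (by omega), hcard 1 (by omega), hcard 2 (by omega), hcard 3 (by omega),
    hdis 0 (by omega) 1 (by omega) (by omega), hdis 0 (by omega) 2 (by omega) (by omega),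
    hdis 0 (by omega) 3 (by omega) (by omega), hdis 1 (by omega) 2 (by omega) (by omega),
    hdis 1 (by omega) 3 (by omega) (by omega), hdis 2 (by omega) 3 (by omega) (by omega),
    hvv 0 (by omega) 1 (by omega) (by omega), hvv 0 (by omega) 2 (by omega) (by omega),
    hvv 0 (by omega) 3 (by omega) (by omega), hvv 1 (by omega) 2 (by omega) (by omega),
    hvv 1 (by omega) 3 (by omega) (by omega), hvv 2 (by omega) 3 (by omega) (by omega),
    ⟨hvE 0 (by omega) 0 (by omega), hvE 0 (by omega) 1 (by omega), hvE 0 (by omega) 2 (by omega), hvE 0 (by omega) 3 (by omega)⟩,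
    ⟨hvE 1 (by omega) 0 (by omega), hvE 1 (by omega) 1 (by omega), hvE 1 (by omega) 2 (by omega), hvE 1 (by omega) 3 (by omega)⟩,
    ⟨hvE 2 (by omega) 0 (by omega), hvE 2 (by omega) 1 (by omega), hvE 2 (by omega) 2 (by omega), hvE 2 (by omega) 3 (by omega)⟩,
    ⟨hvE 3 (by omega) 0 (by omega), hvE 3 (by omega) 1 (by omega), hvE 3 (by omega) 2 (by omega), hvE 3 (by omega) 3 (by omega)⟩,
    ?_, ?_, ?_, ?_⟩⟩
  · have := hedge 0 (by omega); rwa [md _ (by omega)] at this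
  · have := hedge 1 (by omega); rwa [md _ (by omega)] at this
  · have := hedge 2 (by omega); rwa [md _ (by omega)] at this
  · have := hedge 3 (by omega)
    rw [show (3 + 1) * (m + 1) % (4 * (m + 1)) = 0 * (m + 1) by simp] at this
    exact this

set_option maxHeartbeats 4000000 in
lemma extend {V : Type*} [DecidableEq V] [Fintype V] {k : ℕ} (hk : 3 ≤ k)
    (hV : Fintype.card V = 4 * k - 2) {col : Finset V → Bool} {c : Bool}
    (h : HasLooseCycle k 4 col c) (hno : ¬ HasLoosePath k 4 col c) :
    HasLooseCycle k 4 col (!c) ∧ HasLoosePath k 4 col (!c) := by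
  obtain ⟨E0, E1, E2, E3, v0, v1, v2, v3, h⟩ := Quad.of_cycle hk h
  let U : Finset V := (E0 ∪ E1 ∪ (E2 ∪ E3)) ∪ {v0, v1, v2, v3}
  have hU : U.card ≤ 4 * k - 4 := by
    have q1 := Finset.card_union_le (E0 ∪ E1 ∪ (E2 ∪ E3)) {v0, v1, v2, v3}
    have q2 := Finset.card_union_le (E0 ∪ E1) (E2 ∪ E3)
    have q3 := Finset.card_union_le E0 E1
    have q4 := Finset.card_union_le E2 E3
    have q5 : ({v0, v1, v2, v3} : Finset V).card ≤ 4 := Finset.card_le_four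
    have := h.k0; have := h.k1; have := h.k2; have := h.k3
    simp only [U]
    omega
  have hUc : 1 < Uᶜ.card := by rw [Finset.card_compl, hV]; omega
  obtain ⟨x, hx, y, hy, hxy⟩ := Finset.one_lt_card.1 hUc
  have hm : ∀ w ∈ Uᶜ, w ∉ E0 ∧ w ∉ E1 ∧ w ∉ E2 ∧ w ∉ E3 ∧ w ≠ v0 ∧ w ≠ v1 ∧ w ≠ v2 ∧ w ≠ v3 := by
    intro w hw
    simp only [U, Finset.mem_compl, Finset.mem_union, Finset.mem_insert, Finset.mem_singleton] at hw
    tauto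
  have hx' := hm x hx
  have hy' := hm y hy
  have g0 := h.link hk hno x hx'
  have g1 := h.rot.refl'.link hk hno x (by tauto)
  have g2 := h.rot.rot.link hk hno y (by tauto)
  have g3 := h.rot.rot.rot.link hk hno y (by tauto)
  have g3' := h.rot.rot.rot.refl'.link hk hno y (by tauto)
  obtain ⟨k0, k1, k2, k3, d01, d02, d03, d12, d13, d23, n01, n02, n03, n12, n13, n23, m0, m1, m2, m3, -, -, -, -⟩ := h
  clear hU hUc hm hx hy hno
  constructor
  · refine mkC4 hk _ _ _ _ v0 x v2 y (card_ii k0 (by tauto) (by tauto) (by tauto))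
      (card_ii k1 (by tauto) (by tauto) (by tauto)) (card_ii k2 (by tauto) (by tauto) (by tauto))
      (card_ii k3 (by tauto) (by tauto) (by tauto)) g0 g1 g2 g3' (by simp) (by simp) (by simp) (by simp)
      (by simp) (by simp) (by simp) (by simp) ?_ ?_ ?_ ?_ ?_ ?_
    all_goals simp only [Finset.mem_insert]
    all_goals grind
  · refine mkP4 hk _ _ _ _ v0 x v2 y v3 (card_ii k0 (by tauto) (by tauto) (by tauto))
      (card_ii k1 (by tauto) (by tauto) (by tauto)) (card_ii k2 (by tauto) (by tauto) (by tauto))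
      (card_ii k3 (by tauto) (by tauto) (by tauto)) g0 g1 g2 g3 (by simp) (by simp) (by simp) (by simp)
      (by simp) (by simp) (by simp) (by simp) (by tauto) (by tauto) ?_ ?_ ?_ ?_ ?_ ?_
    all_goals simp only [Finset.mem_insert]
    all_goals grind

lemma cycle_map {V W : Type*} [DecidableEq V] [DecidableEq W] {k : ℕ} (g : V → W)
    (hg : Function.Injective g) {col : Finset W → Bool} {c : Bool}
    (h : HasLooseCycle k 4 (fun s : Finset V => col (s.image g)) c) : HasLooseCycle k 4 col c := by
  obtain ⟨f, hf, hc⟩ := h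
  refine ⟨g ∘ f, fun x hx y hy hxy => hf hx hy (hg hxy), fun i hi => ?_⟩
  rw [← hc i hi]
  simp only [Finset.image_image]
  rfl

lemma lower_Pt {V : Type*} [DecidableEq V] {k : ℕ} (hk : 3 ≤ k) (o : V) :
    ¬ HasLoosePath k 4 (fun s : Finset V => decide (o ∈ s)) true := by
  rintro ⟨f, hf, hc⟩
  have h0 := hc 0 (by omega)
  have h2 := hc 2 (by omega)
  simp only [decide_eq_true_eq, Finset.mem_image, Finset.mem_range] at h0 h2
  obtain ⟨s, hs, hs'⟩ := h0
  obtain ⟨t, ht, ht'⟩ := h2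
  have := hf (Set.mem_Iio.2 (by omega)) (Set.mem_Iio.2 (by omega)) (hs'.trans ht'.symm)
  omega

lemma lower_Ct {V : Type*} [DecidableEq V] {k : ℕ} (hk : 3 ≤ k) (o : V) :
    ¬ HasLooseCycle k 4 (fun s : Finset V => decide (o ∈ s)) true := by
  rintro ⟨f, hf, hc⟩
  have h0 := hc 0 (by omega)
  have h2 := hc 2 (by omega)
  simp only [decide_eq_true_eq, Finset.mem_image, Finset.mem_range] at h0 h2
  obtain ⟨s, hs, hs'⟩ := h0
  obtain ⟨t, ht, ht'⟩ := h2
  rw [Nat.mod_eq_of_lt (by omega)] at hs' ht'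
  have := hf (Set.mem_Iio.2 (by omega)) (Set.mem_Iio.2 (by omega)) (hs'.trans ht'.symm)
  omega

lemma lower_count {V : Type*} [DecidableEq V] [Fintype V] (o : V) (L : ℕ) (f : ℕ → V)
    (hf : Set.InjOn f (Set.Iio L)) (h : ∀ x < L, f x ≠ o) : L < Fintype.card V := by
  have h1 : ((Finset.range L).image f).card = L := by
    rw [Finset.card_image_of_injOn (by simpa using hf), Finset.card_range]
  rw [← h1]
  apply Finset.card_lt_univ_of_notMem (x := o)
  simp only [Finset.mem_image, Finset.mem_range, not_exists, not_and]
  exact h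

lemma lower_Pf {V : Type*} [DecidableEq V] [Fintype V] {k : ℕ} (hk : 3 ≤ k) (o : V)
    (h : HasLoosePath k 4 (fun s : Finset V => decide (o ∈ s)) false) : 4 * k - 2 ≤ Fintype.card V := by
  obtain ⟨f, hf, hc⟩ := h
  have := lower_count o _ f hf (by
    intro x hx hxo
    obtain ⟨i, hi, t, ht, rfl⟩ : ∃ i < 4, ∃ t < k, x = i * (k - 1) + t := by
      by_cases h1 : x < k
      · exact ⟨0, by omega, x, h1, by omega⟩
      by_cases h2 : x < 2 * k - 1
      · exact ⟨1, by omega, x - (k - 1), by omega, by omega⟩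
      by_cases h3 : x < 3 * k - 2
      · exact ⟨2, by omega, x - 2 * (k - 1), by omega, by omega⟩
      · exact ⟨3, by omega, x - 3 * (k - 1), by omega, by omega⟩
    have := hc i hi
    simp only [decide_eq_false_iff_not, Finset.mem_image, Finset.mem_range] at this
    exact this ⟨t, ht, hxo⟩)
  omega

lemma lower_Cf {V : Type*} [DecidableEq V] [Fintype V] {k : ℕ} (hk : 3 ≤ k) (o : V)
    (h : HasLooseCycle k 4 (fun s : Finset V => decide (o ∈ s)) false) : 4 * k - 3 ≤ Fintype.card V := by
  obtain ⟨f, hf, hc⟩ := h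
  have := lower_count o _ f hf (by
    intro x hx hxo
    obtain ⟨i, hi, t, ht, rfl⟩ : ∃ i < 4, ∃ t < k, x = i * (k - 1) + t := by
      by_cases h1 : x < k
      · exact ⟨0, by omega, x, h1, by omega⟩
      by_cases h2 : x < 2 * k - 1
      · exact ⟨1, by omega, x - (k - 1), by omega, by omega⟩
      by_cases h3 : x < 3 * k - 2
      · exact ⟨2, by omega, x - 2 * (k - 1), by omega, by omega⟩
      · exact ⟨3, by omega, x - 3 * (k - 1), by omega, by omega⟩
    have := hc i hi
    simp only [decide_eq_false_iff_not, Finset.mem_image, Finset.mem_range] at this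
    refine this ⟨t, ht, ?_⟩
    rw [Nat.mod_eq_of_lt hx]
    exact hxo)
  omega

lemma sInf_eq_of {s : Set ℕ} {n : ℕ} (h : n ∈ s) (h2 : ∀ N ∈ s, n ≤ N) : sInf s = n :=
  le_antisymm (Nat.sInf_le h) (le_csInf ⟨n, h⟩ h2)

lemma cycle_big {k : ℕ} (hk : 3 ≤ k) (col : Finset (Fin (4 * k - 2)) → Bool) :
    ∃ c, HasLooseCycle k 4 col c := by
  obtain ⟨c, hc⟩ := CC_upper (V := Fin (4 * k - 3)) hk (by simp)
    (fun s => col (s.image (Fin.castLE (by omega))))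
  exact ⟨c, cycle_map _ (Fin.castLE_injective _) hc⟩

/-- For every k ≥ 3, R(Pᵏ₄, Pᵏ₄) = R(Cᵏ₄, Pᵏ₄) = R(Cᵏ₄, Cᵏ₄) + 1 = 4k - 2. -/
theorem ramsey_quadrangle (k : ℕ) (hk : 3 ≤ k) :
    RamseyPP k 4 4 = 4 * k - 2 ∧
    RamseyCP k 4 4 = 4 * k - 2 ∧
    RamseyCC k 4 4 + 1 = 4 * k - 2 := by
  refine ⟨?_, ?_, ?_⟩
  · refine sInf_eq_of ⟨by omega, fun col => ?_⟩ ?_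
    · obtain ⟨c, hc⟩ := cycle_big hk col
      by_cases hp : HasLoosePath k 4 col c
      · cases c
        · exact Or.inr hp
        · exact Or.inl hp
      · have := (extend hk (by simp) hc hp).2
        cases c
        · exact Or.inl this
        · exact Or.inr this
    · rintro N ⟨hN, h⟩
      rcases h (fun s => decide ((⟨0, hN⟩ : Fin N) ∈ s)) with h | h
      · exact absurd h (lower_Pt hk _)
      · simpa using lower_Pf hk _ h
  · refine sInf_eq_of ⟨by omega, fun col => ?_⟩ ?_
    · obtain ⟨c, hc⟩ := cycle_big hk col
      cases c
      · by_cases hp : HasLoosePath k 4 col false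
        · exact Or.inr hp
        · exact Or.inl (extend hk (by simp) hc hp).1
      · exact Or.inl hc
    · rintro N ⟨hN, h⟩
      rcases h (fun s => decide ((⟨0, hN⟩ : Fin N) ∈ s)) with h | h
      · exact absurd h (lower_Ct hk _)
      · simpa using lower_Pf hk _ h
  · have : RamseyCC k 4 4 = 4 * k - 3 := by
      refine sInf_eq_of ⟨by omega, fun col => ?_⟩ ?_
      · obtain ⟨c, hc⟩ := CC_upper hk (by simp) col
        cases c
        · exact Or.inr hc
        · exact Or.inl hc
      · rintro N ⟨hN, h⟩
        rcases h (fun s => decide ((⟨0, hN⟩ : Fin N) ∈ s)) with h | h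
        · exact absurd h (lower_Ct hk _)
        · simpa using lower_Cf hk _ h
    omega
end

section
/- For all integers n, k ≥ 3, R(C^k_3, C^k_n) = (k−1)n + 1. -/
namespace RC

/-- Edge `i` of the loose cycle with corners `c` and interiors `I`. -/
def E {V : Type*} [DecidableEq V] {n : ℕ} (c : ZMod n → V) (I : ZMod n → Finset V)
    (i : ZMod n) : Finset V := insert (c i) (insert (c (i + 1)) (I i))

structure IsCy {V : Type*} [DecidableEq V] (X : Finset V) (r n : ℕ)
    (c : ZMod n → V) (I : ZMod n → Finset V) : Prop where
  inj : Function.Injective c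
  cX : ∀ i, c i ∈ X
  IX : ∀ i, I i ⊆ X
  card : ∀ i, (I i).card = r
  cI : ∀ i j, c i ∉ I j
  dis : ∀ i j, i ≠ j → ∀ x, x ∈ I i → x ∉ I j

def HasC {V : Type*} [DecidableEq V] (X : Finset V) (r n : ℕ) (col : Finset V → Bool)
    (b : Bool) : Prop :=
  ∃ (c : ZMod n → V) (I : ZMod n → Finset V), IsCy X r n c I ∧ ∀ i, col (E c I i) = b

section
variable {V : Type*} [DecidableEq V]

theorem ne_of_lt (n a : ℕ) (ha : 0 < a) (h : a < n) : (a : ZMod n) ≠ 0 := by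
  intro h0
  rw [ZMod.natCast_eq_zero_iff] at h0
  exact absurd (Nat.le_of_dvd ha h0) (by omega)

theorem mem_E {n : ℕ} {c : ZMod n → V} {I : ZMod n → Finset V} {i : ZMod n} {x : V} :
    x ∈ E c I i ↔ x = c i ∨ x = c (i + 1) ∨ x ∈ I i := by
  simp [E]

/-- triangle constructor -/
theorem tri {X : Finset V} {r : ℕ} {col : Finset V → Bool} {b : Bool} (f g h : Finset V) (p q s : V)
    (hf : f.card = r + 2) (hg : g.card = r + 2) (hh : h.card = r + 2)
    (fX : f ⊆ X) (gX : g ⊆ X) (hX : h ⊆ X)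
    (pf : p ∈ f) (pg : p ∈ g) (qg : q ∈ g) (qh : q ∈ h) (sh : s ∈ h) (sf : s ∈ f)
    (hp : ∀ x ∈ f, x ∈ g → x = p) (hq : ∀ x ∈ g, x ∈ h → x = q) (hs : ∀ x ∈ f, x ∈ h → x = s)
    (pq : p ≠ q) (qs : q ≠ s) (ps : p ≠ s)
    (cf : col f = b) (cg : col g = b) (ch : col h = b) : HasC X r 3 col b := by
  have key : ∀ (f : Finset V) (a b : V), a ∈ f → b ∈ f → a ≠ b → f.card = r + 2 →
      ((f.erase a).erase b).card = r := by
    intro f a b ha hb hab hc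
    rw [Finset.card_erase_of_mem (by simp [hb, hab.symm]), Finset.card_erase_of_mem ha]; omega
  have e1 : (1 : Fin 3) + 1 = 2 := rfl
  have e2 : (2 : Fin 3) + 1 = 0 := rfl
  refine ⟨(![s, p, q] : Fin 3 → V), (![(f.erase s).erase p, (g.erase p).erase q, (h.erase q).erase s] : Fin 3 → Finset V), ⟨?_, ?_, ?_, ?_, ?_, ?_⟩, ?_⟩
  · intro i j
    change Fin 3 at i j
    fin_cases i <;> fin_cases j <;> simp <;> grind
  · intro i
    change Fin 3 at i
    fin_cases i <;> simp <;> grind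
  · intro i
    change Fin 3 at i
    fin_cases i <;> simp <;> grind
  · intro i
    change Fin 3 at i
    fin_cases i
    · exact key f s p sf pf ps.symm hf
    · exact key g p q pg qg pq hg
    · exact key h q s qh sh qs hh
  · intro i j
    change Fin 3 at i j
    fin_cases i <;> fin_cases j <;> simp <;> grind
  · intro i j
    change Fin 3 at i j
    fin_cases i <;> fin_cases j <;> simp <;> grind
  · intro i
    change Fin 3 at i
    fin_cases i
    · rw [← cf]; congr 1
      change insert s (insert p ((f.erase s).erase p)) = f
      ext x; simp; grind
    · rw [← cg]; congr 1
      change insert p (insert q ((g.erase p).erase q)) = g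
      ext x; simp; grind
    · rw [← ch]; congr 1
      change insert q (insert s ((h.erase q).erase s)) = h
      ext x; simp; grind

theorem E_card {X : Finset V} {r n : ℕ} (hn : 2 ≤ n) {c : ZMod n → V} {I : ZMod n → Finset V}
    (C : IsCy X r n c I) (i : ZMod n) : (E c I i).card = r + 2 := by
  have h1 : c i ≠ c (i + 1) := by
    intro h
    have := C.inj h
    have h2 := ne_of_lt n 1 (by omega) (by omega)
    apply h2
    push_cast
    linear_combination -this
  unfold E
  rw [Finset.card_insert_of_notMem, Finset.card_insert_of_notMem, C.card]
  · exact C.cI _ _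
  · simp [h1, C.cI]

theorem E_sub {X : Finset V} {r n : ℕ} {c : ZMod n → V} {I : ZMod n → Finset V}
    (C : IsCy X r n c I) (i : ZMod n) : E c I i ⊆ X := by
  intro x hx
  rcases mem_E.1 hx with h | h | h
  · exact h ▸ C.cX _
  · exact h ▸ C.cX _
  · exact C.IX _ h

theorem E_adj {X : Finset V} {r n : ℕ} (hn : 3 ≤ n) {c : ZMod n → V} {I : ZMod n → Finset V}
    (C : IsCy X r n c I) (i : ZMod n) (x : V) (h1 : x ∈ E c I i) (h2 : x ∈ E c I (i + 1)) :
    x = c (i + 1) := by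
  have n1 := ne_of_lt n 1 (by omega) (by omega)
  have n2 := ne_of_lt n 2 (by omega) (by omega)
  have a1 : i ≠ i + 1 := fun h => n1 (by push_cast; linear_combination -h)
  have a2 : i ≠ i + 1 + 1 := fun h => n2 (by push_cast; linear_combination -h)
  rw [mem_E] at h1 h2
  have := C.cI
  have := C.dis
  have := C.inj
  rcases h1 with h | h | h
  · subst h
    rcases h2 with h | h | h
    · exact h
    · exact absurd (C.inj h) a2
    · exact absurd h (C.cI _ _)
  · exact h
  · rcases h2 with h' | h' | h'
    · exact h'
    · subst h'; exact absurd h (C.cI _ _)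
    · exact absurd h' (C.dis _ _ a1 _ h)

theorem E_far {X : Finset V} {r n : ℕ} {c : ZMod n → V} {I : ZMod n → Finset V}
    (C : IsCy X r n c I) (i j : ZMod n) (h0 : i ≠ j) (hi : i + 1 ≠ j) (hj : j + 1 ≠ i)
    (x : V) (h1 : x ∈ E c I i) (h2 : x ∈ E c I j) : False := by
  rw [mem_E] at h1 h2
  rcases h1 with h | h | h
  · subst h
    rcases h2 with h | h | h
    · exact h0 (C.inj h)
    · exact hj (C.inj h).symm
    · exact C.cI _ _ h
  · subst h
    rcases h2 with h | h | h
    · exact hi (C.inj h)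
    · exact h0 (add_right_cancel (C.inj h))
    · exact C.cI _ _ h
  · rcases h2 with h' | h' | h'
    · subst h'; exact C.cI _ _ h
    · subst h'; exact C.cI _ _ h
    · exact C.dis _ _ h0 _ h h'

/-- adding a private vertex to each edge -/
theorem augment {X Y : Finset V} {r n : ℕ} {col : Finset V → Bool} {b : Bool}
    {c : ZMod n → V} {I : ZMod n → Finset V} (C : IsCy Y r n c I) (hY : Y ⊆ X)
    (u : ZMod n → V) (hu : Function.Injective u) (uX : ∀ i, u i ∈ X)
    (uE : ∀ i j, u i ∉ E c I j) (hcol : ∀ i, col (insert (u i) (E c I i)) = b) :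
    HasC X (r + 1) n col b := by
  refine ⟨c, fun i => insert (u i) (I i), ⟨C.inj, fun i => hY (C.cX i), ?_, ?_, ?_, ?_⟩, ?_⟩
  · intro i x hx
    rcases Finset.mem_insert.1 hx with h | h
    · exact h ▸ uX i
    · exact hY (C.IX i h)
  · intro i
    rw [Finset.card_insert_of_notMem, C.card]
    intro h
    exact uE i i (mem_E.2 (Or.inr (Or.inr h)))
  · intro i j h
    rcases Finset.mem_insert.1 h with h | h
    · exact uE j i (mem_E.2 (Or.inl h.symm))
    · exact C.cI _ _ h
  · intro i j hij x hx hx'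
    rcases Finset.mem_insert.1 hx with h | h <;> rcases Finset.mem_insert.1 hx' with h' | h'
    · exact hij (hu (h.symm.trans h'))
    · subst h; exact uE i j (mem_E.2 (Or.inr (Or.inr h')))
    · subst h'; exact uE j i (mem_E.2 (Or.inr (Or.inr h)))
    · exact C.dis i j hij x h h'
  · intro i
    rw [← hcol i]; congr 1
    ext x; simp [E]; tauto

theorem supp {X : Finset V} {r n : ℕ} [NeZero n] {c : ZMod n → V} {I : ZMod n → Finset V}
    (C : IsCy X r n c I) (m : ℕ) (hX : (r + 1) * n + m ≤ X.card) :
    ∃ W ⊆ X, W.card = m ∧ ∀ x ∈ W, ∀ i, x ∉ E c I i := by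
  let S : Finset V := Finset.univ.image c ∪ Finset.univ.biUnion I
  have hS : S.card ≤ (r + 1) * n := by
    refine (Finset.card_union_le _ _).trans ?_
    have h1 : (Finset.univ.image c).card ≤ n := Finset.card_image_le.trans (by simp [ZMod.card])
    have h2 : (Finset.univ.biUnion I).card ≤ n * r := by
      refine Finset.card_biUnion_le.trans ?_
      simp [C.card, ZMod.card]
    nlinarith
  have h3 : m ≤ (X \ S).card := by
    have := Finset.le_card_sdiff S X
    omega
  obtain ⟨W, hW, hc⟩ := Finset.exists_subset_card_eq h3
  refine ⟨W, hW.trans Finset.sdiff_subset, hc, ?_⟩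
  intro x hx i hE
  have := hW hx
  simp only [S, Finset.mem_sdiff, Finset.mem_union, Finset.mem_image, Finset.mem_biUnion, Finset.mem_univ, true_and, not_or] at this
  rcases mem_E.1 hE with h | h | h
  · exact this.2.1 ⟨_, h.symm⟩
  · exact this.2.1 ⟨_, h.symm⟩
  · exact this.2.2 ⟨_, h⟩

/-- replace edge `i` by two edges -/
theorem extend {X : Finset V} {r m : ℕ} [NeZero m] (hm : 2 ≤ m) {col : Finset V → Bool} {b : Bool}
    {c : ZMod m → V} {I : ZMod m → Finset V} (C : IsCy X r m c I)
    (hcol : ∀ i, col (E c I i) = b) (i : ZMod m) (z : V) (F G : Finset V)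
    (zX : z ∈ X) (FX : F ⊆ X) (GX : G ⊆ X) (hF : F.card = r) (hG : G.card = r)
    (zc : ∀ j, z ≠ c j) (zI : ∀ j, j ≠ i → z ∉ I j) (zF : z ∉ F) (zG : z ∉ G)
    (Fc : ∀ j, c j ∉ F) (Gc : ∀ j, c j ∉ G)
    (FI : ∀ j, j ≠ i → ∀ x ∈ F, x ∉ I j) (GI : ∀ j, j ≠ i → ∀ x ∈ G, x ∉ I j)
    (FG : ∀ x ∈ F, x ∉ G)
    (c1 : col (insert (c i) (insert z F)) = b) (c2 : col (insert z (insert (c (i + 1)) G)) = b) :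
    HasC X r (m + 1) col b := by
  have lt : ∀ a : ZMod (m + 1), a.val < m + 1 := fun a => ZMod.val_lt a
  have succ : ∀ a : ZMod (m + 1), a.val ≠ m → (a + 1).val = a.val + 1 := by
    intro a ha
    have h1 : (1 : ZMod (m + 1)).val = 1 := by
      rw [ZMod.val_one_eq_one_mod]; exact Nat.mod_eq_of_lt (by omega)
    rw [ZMod.val_add_of_lt]
    · rw [h1]
    · rw [h1]; have := lt a; omega
  have ci : ∀ s t : ℕ, s < m → t < m → (i + 1 + (s : ZMod m)) = i + 1 + t → s = t := by
    intro s t hs ht h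
    have h := add_left_cancel h
    rw [ZMod.natCast_eq_natCast_iff'] at h
    rwa [Nat.mod_eq_of_lt hs, Nat.mod_eq_of_lt ht] at h
  have li : ∀ s : ℕ, s < m - 1 → (i + 1 + (s : ZMod m)) ≠ i := by
    intro s hs h
    have := ne_of_lt m (s + 1) (by omega) (by omega)
    apply this; push_cast; linear_combination h
  have lm : i + 1 + ((m - 1 : ℕ) : ZMod m) = i := by
    rw [Nat.cast_sub (by omega)]; simp
  let c' : ZMod (m + 1) → V := fun a => if a.val = m then z else c (i + 1 + (a.val : ZMod m))
  let I' : ZMod (m + 1) → Finset V := fun a =>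
    if a.val = m then G else if a.val = m - 1 then F else I (i + 1 + (a.val : ZMod m))
  have vi : ∀ a a' : ZMod (m + 1), a.val = a'.val → a = a' := fun a a' h => ZMod.val_injective _ h
  refine ⟨c', I', ⟨?_, ?_, ?_, ?_, ?_, ?_⟩, ?_⟩
  · intro a a' h
    have := lt a
    have := lt a'
    apply vi
    by_cases h1 : a.val = m <;> by_cases h2 : a'.val = m <;> simp only [c', h1, h2, if_true, if_false] at h
    · omega
    · exact absurd h (zc _)
    · exact absurd h.symm (zc _)
    · exact ci _ _ (by omega) (by omega) (C.inj h)
  · intro a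
    by_cases h1 : a.val = m <;> simp only [c', h1, if_true, if_false]
    · exact zX
    · exact C.cX _
  · intro a
    by_cases h1 : a.val = m <;> by_cases h2 : a.val = m - 1 <;> simp only [I', h1, h2, if_true, if_false]
    all_goals first | assumption | exact C.IX _ | (split_ifs <;> assumption)
  · intro a
    by_cases h1 : a.val = m <;> by_cases h2 : a.val = m - 1 <;> simp only [I', h1, h2, if_true, if_false]
    all_goals first | assumption | exact C.card _ | (split_ifs <;> assumption)
  · intro a a'
    have := lt a
    have := lt a'
    simp only [c', I']
    split_ifs
    · exact zG
    · exact Gc _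
    · exact zF
    · exact Fc _
    · exact zI _ (li _ (by omega))
    · exact C.cI _ _
  · intro a a' haa x hx hx'
    have := lt a
    have := lt a'
    have hv : a.val ≠ a'.val := fun h => haa (vi _ _ h)
    simp only [I'] at hx hx'
    split_ifs at hx hx'
    · omega
    · exact FG x hx' hx
    · exact GI _ (li _ (by omega)) x hx hx'
    · exact FG x hx hx'
    · omega
    · exact FI _ (li _ (by omega)) x hx hx'
    · exact GI _ (li _ (by omega)) x hx' hx
    · exact FI _ (li _ (by omega)) x hx' hx
    · exact C.dis _ _ (fun h => hv (ci _ _ (by omega) (by omega) h)) x hx hx'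
  · intro a
    have := lt a
    by_cases h1 : a.val = m
    · have h2 : (a + 1).val = 0 := by
        have : a + 1 = 0 := by
          have h3 : (a.val : ZMod (m + 1)) = a := by simp
          rw [← h3, h1]
          exact_mod_cast ZMod.natCast_self (m + 1)
        rw [this]; simp
      have h3 : ¬ (0 = m) := by omega
      simp only [E, c', I', h1, h2, h3, if_true, if_false]
      simpa using c2
    · have h2 := succ a h1
      by_cases h3 : a.val = m - 1
      · have h4 : (a + 1).val = m := by omega
        have h5 : ¬ (m - 1 = m) := by omega
        simp only [E, c', I', h4, h3, h5, if_true, if_false]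
        rw [lm]; exact c1
      · have h4 : ¬ (a.val + 1 = m) := by omega
        simp only [E, c', I', h1, h2, h3, h4, if_false]
        rw [← hcol (i + 1 + (a.val : ZMod m))]
        simp only [E]; push_cast; rw [add_assoc (i + 1)]

/-- triangle constructor, three-uniform case -/
theorem tri1 {X : Finset V} {col : Finset V → Bool} {b : Bool} (x y z p q s : V)
    (hd : List.Nodup [x, y, z, p, q, s]) (hX : ∀ v ∈ [x, y, z, p, q, s], v ∈ X)
    (h1 : col {x, y, p} = b) (h2 : col {y, z, q} = b) (h3 : col {z, x, s} = b) :
    HasC X 1 3 col b := by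
  simp only [List.nodup_cons, List.mem_cons, List.not_mem_nil, or_false, not_or, List.nodup_nil] at hd
  simp only [List.mem_cons, List.not_mem_nil, or_false, forall_eq_or_imp, forall_eq] at hX
  refine tri {x, y, p} {y, z, q} {z, x, s} y z x ?_ ?_ ?_ ?_ ?_ ?_ (by simp) (by simp) (by simp)
    (by simp) (by simp) (by simp) ?_ ?_ ?_ ?_ ?_ ?_ h1 h2 h3
  · rw [Finset.card_eq_three]; exact ⟨x, y, p, by grind, by grind, by grind, rfl⟩
  · rw [Finset.card_eq_three]; exact ⟨y, z, q, by grind, by grind, by grind, rfl⟩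
  · rw [Finset.card_eq_three]; exact ⟨z, x, s, by grind, by grind, by grind, rfl⟩
  all_goals grind

theorem col_tri (col : Finset V → Bool) (x y z : V) :
    col {x, y, z} = col {y, x, z} ∧ col {x, y, z} = col {x, z, y} := by
  constructor
  · congr 1; ext; simp; tauto
  · congr 1; ext; simp; tauto

theorem base_aux {X : Finset V} {col : Finset V → Bool} {b : Bool} (v a₁ a₂ b₁ b₂ o₁ o₂ : V)
    (hd : List.Nodup [v, a₁, a₂, b₁, b₂, o₁, o₂]) (hX : ∀ x ∈ [v, a₁, a₂, b₁, b₂, o₁, o₂], x ∈ X)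
    (h1 : col {v, a₁, a₂} = b) (h2 : col {v, b₁, b₂} = b) :
    HasC X 1 3 col b ∨ HasC X 1 3 col (!b) := by
  by_contra hcon
  push Not at hcon
  obtain ⟨n1, n2⟩ := hcon
  have T := col_tri col
  have key : ∀ a a' c c' o o', List.Nodup [v, a, a', c, c', o, o'] →
      (∀ x ∈ [v, a, a', c, c', o, o'], x ∈ X) → col {v, a, a'} = b → col {v, c, c'} = b →
      col {a, c, o} = !b := by
    intro a a' c c' o o' hd hX h1 h2
    by_contra h
    have h : col {a, c, o} = b := by revert h; cases b <;> simp
    exact n1 (tri1 v a c a' o c' (by simp at hd ⊢; grind) (by simp at hX ⊢; grind)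
      h1 h (by rw [← h2, (T c v c').1]))
  have k1 : col {a₁, b₁, o₂} = !b := key a₁ a₂ b₁ b₂ o₂ o₁ (by simp at hd ⊢; grind)
    (by simp at hX ⊢; grind) h1 h2
  have k2 : col {a₂, b₁, o₁} = !b := key a₂ a₁ b₁ b₂ o₁ o₂ (by simp at hd ⊢; grind)
    (by simp at hX ⊢; grind) (by rw [← h1, (T v a₁ a₂).2]) h2
  have k3 : col {a₁, b₂, o₁} = !b := key a₁ a₂ b₂ b₁ o₁ o₂ (by simp at hd ⊢; grind)
    (by simp at hX ⊢; grind) h1 (by rw [← h2, (T v b₁ b₂).2])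
  refine n2 (tri1 a₁ b₁ o₁ o₂ a₂ b₂ (by simp at hd ⊢; grind) (by simp at hX ⊢; grind) k1 ?_ ?_)
  · rw [← k2, (T a₂ b₁ o₁).1, (T b₁ a₂ o₁).2]
  · rw [← k3, (T a₁ b₂ o₁).2, (T a₁ o₁ b₂).1]

def P (V : Type*) [DecidableEq V] (r n : ℕ) : Prop :=
  ∀ (X : Finset V) (col : Finset V → Bool), (r + 1) * n + 1 ≤ X.card →
    HasC X r 3 col true ∨ HasC X r n col false

theorem base13 : P V 1 3 := by
  intro X col hX
  obtain ⟨Y, hY, hc⟩ := Finset.exists_subset_card_eq hX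
  obtain ⟨l, hl, hl'⟩ : ∃ l : List V, l.Nodup ∧ l.toFinset = Y := ⟨Y.toList, Y.nodup_toList, by simp⟩
  have hlen : l.length = 7 := by
    rw [← List.toFinset_card_of_nodup hl, hl', hc]
  match l, hlen with
  | [v, a, a', c, c', o, o'], _ =>
    have hm : ∀ x ∈ [v, a, a', c, c', o, o'], x ∈ X := by
      intro x hx; apply hY; rw [← hl']; simpa using hx
    have fin : ∀ b, HasC X 1 3 col b ∨ HasC X 1 3 col (!b) →
        HasC X 1 3 col true ∨ HasC X 1 3 col false := by
      intro b; cases b <;> simp <;> tauto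
    by_cases h1 : col {v, a, a'} = col {v, c, c'}
    · exact fin _ (base_aux v a a' c c' o o' hl hm h1 rfl)
    by_cases h2 : col {v, a, a'} = col {v, o, o'}
    · exact fin _ (base_aux v a a' o o' c c' (by simp at hl ⊢; grind) (by simp at hm ⊢; grind) h2 rfl)
    · have h3 : col {v, c, c'} = col {v, o, o'} := by
        revert h1 h2
        cases col {v, a, a'} <;> cases col {v, c, c'} <;> cases col {v, o, o'} <;> simp
      exact fin _ (base_aux v c c' o o' a a' (by simp at hl ⊢; grind) (by simp at hm ⊢; grind) h3 rfl)

theorem perm6 (x y a b c d : V) (hd : List.Nodup [x, y, a, b, c, d]) :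
    List.Nodup [x, a, d, c, y, b] := by
  simp at hd ⊢; grind

theorem perm4 (a b c d : V) (h : List.Nodup [a, b, c, d]) :
    List.Nodup [b, d, a, c] ∧ List.Nodup [a, c, b, d] := by
  simp at h ⊢; grind

theorem k3_aux {X : Finset V} {col : Finset V → Bool} (x y a b c d : V)
    (hd : List.Nodup [x, y, a, b, c, d]) (hX : ∀ v ∈ [x, y, a, b, c, d], v ∈ X)
    (nt : ¬ HasC X 1 3 col true)
    (H : ∀ z f g, z ∈ [a, b, c, d] → f ∈ [a, b, c, d] → g ∈ [a, b, c, d] → z ≠ f → z ≠ g → f ≠ g →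
      col {x, z, f} = false → col {y, z, g} = true) (h : col {x, a, b} = false) :
    ∀ f g, f ∈ [a, b, c, d] → g ∈ [a, b, c, d] → f ≠ g → col {y, f, g} = true := by
  have T := col_tri col
  have hd' := hd
  simp only [List.nodup_cons, List.mem_cons, List.not_mem_nil, or_false, not_or, List.nodup_nil,
    not_false_eq_true, and_true] at hd'
  obtain ⟨⟨xy, xa, xb, xc, xd⟩, ⟨ya, yb, yc, yd⟩, ⟨ab, ac, ad⟩, ⟨bc, bd⟩, cd⟩ := hd'
  have hba : col {x, b, a} = false := by rw [(T x b a).2, h]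
  have S : ∀ f g, f ∈ [a, b, c, d] → g ∈ [a, b, c, d] → f ≠ g → col {y, f, g} = false → False := by
    intro f g hf hg hfg hb
    have r1 : col {y, a, c} = true := H a b c (by simp) (by simp) (by simp) (by first | assumption | (symm; assumption)) (by first | assumption | (symm; assumption)) (by first | assumption | (symm; assumption)) h
    have r2 : col {y, a, d} = true := H a b d (by simp) (by simp) (by simp) (by first | assumption | (symm; assumption)) (by first | assumption | (symm; assumption)) (by first | assumption | (symm; assumption)) h
    have r3 : col {y, b, c} = true := H b a c (by simp) (by simp) (by simp) (by first | assumption | (symm; assumption)) (by first | assumption | (symm; assumption)) (by first | assumption | (symm; assumption)) hba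
    have r4 : col {y, b, d} = true := H b a d (by simp) (by simp) (by simp) (by first | assumption | (symm; assumption)) (by first | assumption | (symm; assumption)) (by first | assumption | (symm; assumption)) hba
    have hb' : col {y, g, f} = false := by rw [(T y g f).2, hb]
    -- every pair sharing exactly one point with the pair f g is red at x
    have Q : ∀ z e, z ∈ [a, b, c, d] → e ∈ [a, b, c, d] → z ≠ e → (z = f ∨ z = g) → e ≠ f → e ≠ g →
        col {x, z, e} = true := by
      intro z e hz he hze hzf hef heg
      by_contra hne
      have hne : col {x, z, e} = false := by simpa using hne
      rcases hzf with rfl | rfl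
      · have := H z e g hz he hg hze hfg heg hne
        rw [hb] at this; exact absurd this (by simp)
      · have := H z e f hz he hf hze hfg.symm hef hne
        rw [hb'] at this; exact absurd this (by simp)
    have Q' : ∀ z e, z ∈ [a, b, c, d] → e ∈ [a, b, c, d] → z ≠ e → (z = f ∨ z = g) → e ≠ f → e ≠ g →
        col {x, e, z} = true := by
      intro z e h1 h2 h3 h4 h5 h6
      rw [(T x e z).2]; exact Q z e h1 h2 h3 h4 h5 h6
    have fg : (f = a ∧ g = b) ∨ (f = b ∧ g = a) ∨ (f = c ∧ g = d) ∨ (f = d ∧ g = c) := by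
      have r1' : col {y, c, a} = true := by rw [(T y c a).2, r1]
      have r2' : col {y, d, a} = true := by rw [(T y d a).2, r2]
      have r3' : col {y, c, b} = true := by rw [(T y c b).2, r3]
      have r4' : col {y, d, b} = true := by rw [(T y d b).2, r4]
      simp only [List.mem_cons, List.not_mem_nil, or_false] at hf hg
      rcases hf with rfl | rfl | rfl | rfl <;> rcases hg with rfl | rfl | rfl | rfl <;> simp_all
    have q1 : col {x, a, c} = true := by
      rcases fg with ⟨rfl, rfl⟩ | ⟨rfl, rfl⟩ | ⟨rfl, rfl⟩ | ⟨rfl, rfl⟩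
      · exact Q _ _ (by simp) (by simp) (by first | assumption | (symm; assumption)) (by simp) (by first | assumption | (symm; assumption)) (by first | assumption | (symm; assumption))
      · exact Q _ _ (by simp) (by simp) (by first | assumption | (symm; assumption)) (by simp) (by first | assumption | (symm; assumption)) (by first | assumption | (symm; assumption))
      · exact Q' _ _ (by simp) (by simp) (by first | assumption | (symm; assumption)) (by simp) (by first | assumption | (symm; assumption)) (by first | assumption | (symm; assumption))
      · exact Q' _ _ (by simp) (by simp) (by first | assumption | (symm; assumption)) (by simp) (by first | assumption | (symm; assumption)) (by first | assumption | (symm; assumption))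
    have q2 : col {x, d, b} = true := by
      rcases fg with ⟨rfl, rfl⟩ | ⟨rfl, rfl⟩ | ⟨rfl, rfl⟩ | ⟨rfl, rfl⟩
      · exact Q' _ _ (by simp) (by simp) (by first | assumption | (symm; assumption)) (by simp) (by first | assumption | (symm; assumption)) (by first | assumption | (symm; assumption))
      · exact Q' _ _ (by simp) (by simp) (by first | assumption | (symm; assumption)) (by simp) (by first | assumption | (symm; assumption)) (by first | assumption | (symm; assumption))
      · exact Q _ _ (by simp) (by simp) (by first | assumption | (symm; assumption)) (by simp) (by first | assumption | (symm; assumption)) (by first | assumption | (symm; assumption))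
      · exact Q _ _ (by simp) (by simp) (by first | assumption | (symm; assumption)) (by simp) (by first | assumption | (symm; assumption)) (by first | assumption | (symm; assumption))
    refine nt (tri1 x a d c y b (perm6 _ _ _ _ _ _ hd) (by simp at hX ⊢; tauto) q1 ?_ ?_)
    · rw [← r2, (T y a d).1, (T a y d).2]
    · rw [← q2, (T x d b).1]
  intro f g hf hg hfg
  by_contra hne
  exact S f g hf hg hfg (by simpa using hne)

theorem k3_step (n : ℕ) (hn : 3 ≤ n) (ih : P V 1 n) : P V 1 (n + 1) := by
  intro X col hX
  haveI : NeZero n := ⟨by omega⟩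
  by_contra hcon
  push Not at hcon
  obtain ⟨nt, nb⟩ := hcon
  rcases ih X col (by omega) with h | ⟨c, I, C, hcol⟩
  · exact nt h
  have T := col_tri col
  obtain ⟨W, WX, hW, hWE⟩ := supp C 3 (by omega)
  obtain ⟨w₁, w₂, w₃, n12, n13, n23, rfl⟩ := Finset.card_eq_three.1 hW
  have o1 := hWE w₁ (by simp)
  have o2 := hWE w₂ (by simp)
  have o3 := hWE w₃ (by simp)
  have x1 : w₁ ∈ X := WX (by simp)
  have x2 : w₂ ∈ X := WX (by simp)
  have x3 : w₃ ∈ X := WX (by simp)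
  simp only [mem_E, not_or] at o1 o2 o3
  have one : ∀ i : ZMod n, i + 1 ≠ i := by
    intro i h
    exact ne_of_lt n 1 (by omega) (by omega) (by push_cast; linear_combination h)
  have key : ∀ i : ZMod n, ∃ z, (z = c i ∨ z = c (i + 1)) ∧ col {z, w₁, w₂} = true ∧
      ∀ j, c j ≠ z → col {c j, w₁, w₂} = false := by
    intro i
    obtain ⟨m, hm⟩ := Finset.card_eq_one.1 (C.card i)
    have mi : m ∈ I i := by rw [hm]; simp
    have mX : m ∈ X := C.IX i mi
    have mc : ∀ j, c j ≠ m := fun j h => C.cI j i (h ▸ mi)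
    have mw1 : m ≠ w₁ := fun h => (o1 i).2.2 (h ▸ mi)
    have mw2 : m ≠ w₂ := fun h => (o2 i).2.2 (h ▸ mi)
    have mw3 : m ≠ w₃ := fun h => (o3 i).2.2 (h ▸ mi)
    have cc : c i ≠ c (i + 1) := fun h => one i (C.inj h).symm
    have LX : ∀ z ∈ [w₁, w₂, w₃, m], z ∈ X := by simp [*]
    have Lc : ∀ z ∈ [w₁, w₂, w₃, m], ∀ j, z ≠ c j := by
      intro z hz j
      simp only [List.mem_cons, List.not_mem_nil, or_false] at hz
      rcases hz with rfl | rfl | rfl | rfl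
      · exact (o1 j).1
      · exact (o2 j).1
      · exact (o3 j).1
      · exact (mc j).symm
    have LI : ∀ z ∈ [w₁, w₂, w₃, m], ∀ j, j ≠ i → z ∉ I j := by
      intro z hz j hj
      simp only [List.mem_cons, List.not_mem_nil, or_false] at hz
      rcases hz with rfl | rfl | rfl | rfl
      · exact (o1 j).2.2
      · exact (o2 j).2.2
      · exact (o3 j).2.2
      · exact C.dis i j hj.symm _ mi
    have H : ∀ z f g, z ∈ [w₁, w₂, w₃, m] → f ∈ [w₁, w₂, w₃, m] → g ∈ [w₁, w₂, w₃, m] →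
        z ≠ f → z ≠ g → f ≠ g → col {c i, z, f} = false → col {c (i + 1), z, g} = true := by
      intro z f g hz hf hg hzf hzg hfg h1
      by_contra h2
      have h2 : col {c (i + 1), z, g} = false := by simpa using h2
      refine nb (extend (by omega) C hcol i z {f} {g} (LX z hz) (by simpa using LX f hf)
        (by simpa using LX g hg) (by simp) (by simp) (Lc z hz) (LI z hz) (by simpa using hzf)
        (by simpa using hzg) (fun j => by simpa using (Lc f hf j).symm)
        (fun j => by simpa using (Lc g hg j).symm) (fun j hj => by simpa using LI f hf j hj)
        (fun j hj => by simpa using LI g hg j hj) (by simpa using hfg) h1 ?_)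
      rw [← h2, (T (c (i + 1)) z g).1]
    have full : (∃ z, (z = c i ∨ z = c (i + 1)) ∧ col {z, w₁, w₂} = true ∧ col {z, w₁, w₃} = true ∧
        col {z, w₂, m} = true) := by
      have h4 : List.Nodup [w₁, w₂, w₃, m] := by
        simp [n12, n13, n23, mw1.symm, mw2.symm, mw3.symm]
      have A : ∀ a b c' d, (∀ z, z ∈ [a, b, c', d] ↔ z ∈ [w₁, w₂, w₃, m]) → List.Nodup [a, b, c', d] → col {c i, a, b} = false →
          (∃ z, (z = c i ∨ z = c (i + 1)) ∧ col {z, w₁, w₂} = true ∧ col {z, w₁, w₃} = true ∧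
        col {z, w₂, m} = true) := by
        intro a b c' d hme hnd h
        have := k3_aux (X := X) (col := col) (c i) (c (i + 1)) a b c' d (by
            rw [List.nodup_cons, List.nodup_cons]
            refine ⟨?_, ?_, hnd⟩
            · rw [List.mem_cons, hme]
              rintro (h | h)
              · exact cc h
              · exact Lc _ h _ rfl
            · rw [hme]; intro h; exact Lc _ h _ rfl)
          (by
            intro v hv
            rw [List.mem_cons, List.mem_cons, hme] at hv
            rcases hv with rfl | rfl | h
            · exact C.cX _
            · exact C.cX _
            · exact LX _ h) nt
          (by intro z f g hz hf hg; exact H z f g ((hme _).1 hz) ((hme _).1 hf) ((hme _).1 hg)) h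
        refine ⟨c (i + 1), Or.inr rfl, this _ _ ?_ ?_ n12, this _ _ ?_ ?_ n13, this _ _ ?_ ?_ mw2.symm⟩ <;>
        · rw [hme]; simp
      by_cases h1 : col {c i, w₁, w₂} = true
      · by_cases h2 : col {c i, w₁, w₃} = true
        · by_cases h3 : col {c i, w₂, m} = true
          · exact ⟨c i, Or.inl rfl, h1, h2, h3⟩
          · exact A w₂ m w₁ w₃ (by intro z; simp; tauto) (perm4 _ _ _ _ h4).1 (by simpa using h3)
        · exact A w₁ w₃ w₂ m (by intro z; simp; tauto) (perm4 _ _ _ _ h4).2 (by simpa using h2)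
      · exact A w₁ w₂ w₃ m (fun _ => Iff.rfl) h4 (by simpa using h1)
    obtain ⟨z, hz, r1, r2, r3⟩ := full
    refine ⟨z, hz, r1, ?_⟩
    intro j hj
    by_contra hne
    have hne : col {c j, w₁, w₂} = true := by simpa using hne
    have zX : z ∈ X := by rcases hz with h | h <;> rw [h] <;> exact C.cX _
    have zL : ∀ v ∈ [w₁, w₂, w₃, m], v ≠ z := by
      intro v hv; rcases hz with h | h <;> rw [h] <;> exact Lc v hv _
    have cL := fun v hv => Lc v hv j
    have cX := C.cX j
    have hnd : List.Nodup [z, w₁, w₂, w₃, c j, m] := by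
      simp only [List.mem_cons, List.not_mem_nil, or_false, forall_eq_or_imp, forall_eq] at zL cL
      clear * - zL cL hj n12 n13 n23 mw1 mw2 mw3
      simp; grind
    refine nt (tri1 z w₁ w₂ w₃ (c j) m hnd (by simp [*]) r2 ?_ ?_)
    · rw [← hne, (T (c j) w₁ w₂).1, (T w₁ (c j) w₂).2]
    · rw [← r3, (T z w₂ m).1]
  obtain ⟨z0, a0, b0, d0⟩ := key 0
  obtain ⟨z1, a1, b1, d1⟩ := key 1
  obtain ⟨z2, a2, b2, d2⟩ := key 2
  have eqz : ∀ z z' i, (z' = c i ∨ z' = c (i + 1)) → col {z', w₁, w₂} = true →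
      (∀ j, c j ≠ z → col {c j, w₁, w₂} = false) → z' = z := by
    intro z z' i h1 h2 h3
    by_contra hne
    rcases h1 with rfl | rfl
    · rw [h3 _ hne] at h2; simp at h2
    · rw [h3 _ hne] at h2; simp at h2
  have e1 := eqz z0 z1 1 a1 b1 d0
  have e2 := eqz z0 z2 2 a2 b2 d0
  subst e1 e2
  have m1 := ne_of_lt n 1 (by omega) (by omega)
  have m2 := ne_of_lt n 2 (by omega) (by omega)
  push_cast at m1 m2
  have N : ∀ i j : ZMod n, (i - j = 1 ∨ i - j = 2 ∨ j - i = 1) → c i ≠ c j := by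
    intro i j h e
    have := C.inj e
    subst this
    simp at h
    rcases h with h | h | h
    · exact m1 h.symm
    · exact m2 h.symm
    · exact m1 h.symm
  have t01 : c (0+1) ≠ c 2 := N _ _ (by right; right; ring)
  have t02 : c (2+1) ≠ c (0+1) := N _ _ (by right; left; ring)
  have t03 : c 1 ≠ c 0 := N _ _ (by left; ring)
  have t04 : c (1+1) ≠ c 0 := N _ _ (by right; left; ring)
  have t05 : c (0+1) = c 1 := by simp
  have t06 : c (1+1) = c 2 := by rw [show (1:ZMod n)+1 = 2 by ring]
  clear * - t01 t02 t03 t04 t05 t06 a0 a1 a2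
  grind

theorem P1 (n : ℕ) (hn : 3 ≤ n) : P V 1 n := by
  induction n, hn using Nat.le_induction with
  | base => exact base13
  | succ n hn ih => exact k3_step n hn ih

theorem sdr {n : ℕ} [NeZero n] (t : ZMod n → Finset V) (ht : ∀ i, n ≤ (t i).card) :
    ∃ f : ZMod n → V, Function.Injective f ∧ ∀ i, f i ∈ t i := by
  rw [← Finset.all_card_le_biUnion_card_iff_exists_injective]
  intro s
  rcases s.eq_empty_or_nonempty with rfl | ⟨i, hi⟩
  · simp
  · have h1 : s.card ≤ n := by simpa [ZMod.card] using Finset.card_le_univ s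
    exact h1.trans ((ht i).trans (Finset.card_le_card (Finset.subset_biUnion_of_mem t hi)))

theorem step4 (r n : ℕ) (hn : 4 ≤ n) (ih : P V r n) : P V (r + 1) n := by
  intro X col hX
  haveI : NeZero n := ⟨by omega⟩
  by_contra hcon
  push Not at hcon
  obtain ⟨nt, nb⟩ := hcon
  have hXn : n ≤ X.card := by nlinarith
  obtain ⟨U, UX, hU⟩ := Finset.exists_subset_card_eq hXn
  have hX' : (r + 1) * n + 1 ≤ (X \ U).card := by
    rw [Finset.card_sdiff_of_subset UX, hU]
    have : (r + 1 + 1) * n + 1 = (r + 1) * n + 1 + n := by ring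
    omega
  have hYX : X \ U ⊆ X := Finset.sdiff_subset
  rcases ih (X \ U) (fun S => decide (3 ≤ (U.filter fun u => col (insert u S) = true).card)) hX' with
    ⟨c, I, C, hc⟩ | ⟨c, I, C, hc⟩
  · obtain ⟨f, fi, hf⟩ := sdr (n := 3) (fun i => U.filter fun u => col (insert u (E c I i)) = true)
      (fun i => by simpa using hc i)
    simp only [Finset.mem_filter] at hf
    refine nt (augment C hYX f fi (fun i => UX (hf i).1) ?_ (fun i => (hf i).2))
    intro i j h
    exact (Finset.mem_sdiff.1 (E_sub C j h)).2 (hf i).1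
  have UE : ∀ u ∈ U, ∀ i, u ∉ E c I i := by
    intro u hu i h
    exact (Finset.mem_sdiff.1 (E_sub C i h)).2 hu
  obtain ⟨W, WX, hW, hWE⟩ := supp C 1 hX'
  obtain ⟨w, rfl⟩ := Finset.card_eq_one.1 hW
  have wX' : w ∈ X \ U := WX (by simp)
  have wX : w ∈ X := hYX wX'
  have wU : w ∉ U := (Finset.mem_sdiff.1 wX').2
  have wE := hWE w (by simp)
  have ESX : ∀ i, E c I i ⊆ X := fun i => (E_sub C i).trans hYX
  have Ec : ∀ i, (E c I i).card = r + 2 := E_card (by omega) C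
  have m1 := ne_of_lt n 1 (by omega) (by omega)
  have m2 := ne_of_lt n 2 (by omega) (by omega)
  have m3 := ne_of_lt n 3 (by omega) (by omega)
  push_cast at m1 m2 m3
  have key : ∀ i u v, u ≠ v → u ∈ X → v ∈ X → (∀ i, u ∉ E c I i) → (∀ i, v ∉ E c I i) →
      col (insert u (E c I i)) = true → col (insert u (E c I (i + 1 + 1))) = true →
      col (insert v (E c I (i + 1))) = false := by
    intro i u v huv uX vX hu hv h1 h2
    by_contra h3
    have h3 : col (insert v (E c I (i + 1))) = true := by simpa using h3
    have k1 : c (i + 1) ∈ E c I i := mem_E.2 (by simp)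
    have k2 : c (i + 1) ∈ E c I (i + 1) := mem_E.2 (by simp)
    have k3 : c (i + 1 + 1) ∈ E c I (i + 1) := mem_E.2 (by simp)
    have k4 : c (i + 1 + 1) ∈ E c I (i + 1 + 1) := mem_E.2 (by simp)
    have A1 := E_adj (by omega) C i
    have A2 := E_adj (by omega) C (i + 1)
    have A3 := E_far C i (i + 1 + 1) (fun h => m2 (by linear_combination -h))
      (fun h => m1 (by linear_combination -h)) (fun h => m3 (by linear_combination h))
    refine nt (tri _ _ _ (c (i + 1)) (c (i + 1 + 1)) u ?_ ?_ ?_ ?_ ?_ ?_ ?_ ?_ ?_ ?_ ?_ ?_ ?_ ?_ ?_ ?_ ?_ ?_ h1 h3 h2)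
    · rw [Finset.card_insert_of_notMem (hu _), Ec]
    · rw [Finset.card_insert_of_notMem (hv _), Ec]
    · rw [Finset.card_insert_of_notMem (hu _), Ec]
    · exact Finset.insert_subset uX (ESX _)
    · exact Finset.insert_subset vX (ESX _)
    · exact Finset.insert_subset uX (ESX _)
    · simp [k1]
    · simp [k2]
    · simp [k3]
    · simp [k4]
    · simp
    · simp
    · intro x hx hx'
      rcases Finset.mem_insert.1 hx with rfl | hx <;> rcases Finset.mem_insert.1 hx' with rfl | hx'
      · exact absurd rfl huv
      · exact absurd hx' (hu _)
      · exact absurd hx (hv _)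
      · exact A1 _ hx hx'
    · intro x hx hx'
      rcases Finset.mem_insert.1 hx with rfl | hx <;> rcases Finset.mem_insert.1 hx' with rfl | hx'
      · exact absurd rfl huv
      · exact absurd hx' (hv _)
      · exact absurd hx (hu _)
      · exact A2 _ hx hx'
    · intro x hx hx'
      by_cases hxu : x = u
      · exact hxu
      · exact (A3 x (by simpa [hxu] using hx) (by simpa [hxu] using hx')).elim
    · intro h; exact m1 (by linear_combination -(C.inj h))
    · intro h; exact hu _ (h ▸ k4)
    · intro h; exact hu _ (h ▸ k1)
  let t : ZMod n → Finset V := fun i => U.filter fun u => col (insert u (E c I i)) = false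
  have ht : ∀ i, n ≤ (t i).card + 2 := by
    intro i
    have h1 := hc i
    simp only [decide_eq_false_iff_not, not_le] at h1
    have h2 := Finset.card_filter_add_card_filter_not (s := U) (fun u => col (insert u (E c I i)) = true)
    simp only [Bool.not_eq_true] at h2
    change n ≤ (U.filter fun u => col (insert u (E c I i)) = false).card + 2
    omega
  by_cases hall : ∀ s : Finset (ZMod n), s.card ≤ (s.biUnion t).card
  · rw [Finset.all_card_le_biUnion_card_iff_exists_injective] at hall
    obtain ⟨f, fi, hf⟩ := hall
    simp only [t, Finset.mem_filter] at hf
    exact nb (augment C hYX f fi (fun i => UX (hf i).1) (fun i j => UE _ (hf i).1 j) (fun i => (hf i).2))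
  push Not at hall
  obtain ⟨s, hs⟩ := hall
  have hsn : s.card ≤ n := by simpa [ZMod.card] using Finset.card_le_univ s
  obtain ⟨i, hi⟩ : s.Nonempty := by
    rw [← Finset.card_pos]; omega
  have hb1 : (t i).card ≤ (s.biUnion t).card := Finset.card_le_card (Finset.subset_biUnion_of_mem t hi)
  have hb2 := ht i
  have hsub : s.biUnion t ⊆ U := by
    intro x hx
    obtain ⟨j, _, hj⟩ := Finset.mem_biUnion.1 hx
    exact (Finset.mem_filter.1 hj).1
  have hB : (U \ s.biUnion t).card = n - (s.biUnion t).card := by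
    rw [Finset.card_sdiff_of_subset hsub, hU]
  have bad : ∀ u ∈ U \ s.biUnion t, u ∈ U ∧ ∀ j ∈ s, col (insert u (E c I j)) = true := by
    intro u hu
    obtain ⟨h1, h2⟩ := Finset.mem_sdiff.1 hu
    refine ⟨h1, fun j hj => ?_⟩
    by_contra hne
    exact h2 (Finset.mem_biUnion.2 ⟨j, hj, Finset.mem_filter.2 ⟨h1, by simpa using hne⟩⟩)
  by_cases hsu : s = Finset.univ
  · obtain ⟨u, hu⟩ : (U \ s.biUnion t).Nonempty := by
      rw [← Finset.card_pos]; omega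
    obtain ⟨uU, hu⟩ := bad u hu
    have hcard : (insert w (U.erase u)).card = n := by
      rw [Finset.card_insert_of_notMem (by simp [wU]), Finset.card_erase_of_mem uU]; omega
    obtain ⟨f, fi, hf⟩ := sdr (n := n) (fun _ => insert w (U.erase u)) (fun _ => hcard.ge)
    have hf' : ∀ i, f i ≠ u ∧ f i ∈ X ∧ ∀ j, f i ∉ E c I j := by
      intro i
      rcases Finset.mem_insert.1 (hf i) with h | h
      · rw [h]; exact ⟨fun h => wU (h ▸ uU), wX, wE⟩
      · rw [Finset.mem_erase] at h
        exact ⟨h.1, UX h.2, UE _ h.2⟩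
    refine nb (augment C hYX f fi (fun i => (hf' i).2.1) (fun i => (hf' i).2.2) ?_)
    intro i
    have := key (i - 1) u (f i) (hf' i).1.symm (UX uU) (hf' i).2.1 (UE u uU) (hf' i).2.2
      (hu _ (by simp [hsu])) (hu _ (by simp [hsu]))
    rwa [sub_add_cancel] at this
  · obtain ⟨i0, hi0⟩ : ∃ i0, i0 ∉ s := by
      by_contra h
      push Not at h
      exact hsu (Finset.eq_univ_iff_forall.2 h)
    have hin : ∀ j, j ≠ i0 → j ∈ s := by
      intro j hj
      by_contra hjs
      have h1 : (insert j (insert i0 s)).card = s.card + 2 := by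
        rw [Finset.card_insert_of_notMem (by simp [hj, hjs]), Finset.card_insert_of_notMem hi0]
      have h2 : (insert j (insert i0 s)).card ≤ n := by
        simpa [ZMod.card] using Finset.card_le_univ (insert j (insert i0 s))
      omega
    have hs2 : s.card < n := by
      have h1 : (insert i0 s).card = s.card + 1 := Finset.card_insert_of_notMem hi0
      have h2 : (insert i0 s).card ≤ n := by
        simpa [ZMod.card] using Finset.card_le_univ (insert i0 s)
      omega
    obtain ⟨u, hu, v, hv, huv⟩ : ∃ u ∈ U \ s.biUnion t, ∃ v ∈ U \ s.biUnion t, u ≠ v := by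
      rw [← Finset.one_lt_card]; omega
    obtain ⟨uU, hu⟩ := bad u hu
    obtain ⟨vU, hv⟩ := bad v hv
    have := key (i0 + 1) u v huv (UX uU) (UX vU) (UE u uU) (UE v vU)
      (hu _ (hin _ (fun h => m1 (by linear_combination h))))
      (hu _ (hin _ (fun h => m3 (by linear_combination h))))
    rw [hv _ (hin _ (fun h => m2 (by linear_combination h)))] at this
    simp at this

/-- three sets of size `m+1` in triangle position -/
structure Cfg (X : Finset V) (m : ℕ) (S₁ S₂ S₃ : Finset V) (p q s : V) : Prop where
  c1 : S₁.card = m + 1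
  c2 : S₂.card = m + 1
  c3 : S₃.card = m + 1
  x1 : S₁ ⊆ X
  x2 : S₂ ⊆ X
  x3 : S₃ ⊆ X
  p1 : p ∈ S₁
  p2 : p ∈ S₂
  q2 : q ∈ S₂
  q3 : q ∈ S₃
  s1 : s ∈ S₁
  s3 : s ∈ S₃
  hp : ∀ x ∈ S₁, x ∈ S₂ → x = p
  hq : ∀ x ∈ S₂, x ∈ S₃ → x = q
  hs : ∀ x ∈ S₁, x ∈ S₃ → x = s
  pq : p ≠ q
  qs : q ≠ s
  ps : p ≠ s

theorem Cfg.rot {X : Finset V} {m : ℕ} {S₁ S₂ S₃ : Finset V} {p q s : V}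
    (h : Cfg X m S₁ S₂ S₃ p q s) : Cfg X m S₂ S₃ S₁ q s p :=
  ⟨h.c2, h.c3, h.c1, h.x2, h.x3, h.x1, h.q2, h.q3, h.s3, h.s1, h.p2, h.p1, h.hq,
    fun x a b => h.hs x b a, fun x a b => h.hp x b a, h.qs, h.ps.symm, h.pq.symm⟩

theorem Cfg.swap {X : Finset V} {m : ℕ} {S₁ S₂ S₃ : Finset V} {p q s : V}
    (h : Cfg X m S₁ S₂ S₃ p q s) : Cfg X m S₂ S₁ S₃ p s q :=
  ⟨h.c2, h.c1, h.c3, h.x2, h.x1, h.x3, h.p2, h.p1, h.s1, h.s3, h.q2, h.q3,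
    fun x a b => h.hp x b a, h.hs, h.hq, h.ps, h.qs.symm, h.pq⟩

theorem card_sw {S : Finset V} {m : ℕ} {a u v : V} (hS : S.card = m + 1) (ha : a ∈ S)
    (hu : u ∉ S) (hv : v ∉ S) (huv : u ≠ v) : (insert u (insert v (S.erase a))).card = m + 2 := by
  rw [Finset.card_insert_of_notMem (by simp [huv, hu]), Finset.card_insert_of_notMem (by simp [hv]),
    Finset.card_erase_of_mem ha]
  omega

theorem sub_sw {S X : Finset V} {a u v : V} (hS : S ⊆ X) (hu : u ∈ X) (hv : v ∈ X) :
    insert u (insert v (S.erase a)) ⊆ X :=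
  Finset.insert_subset hu (Finset.insert_subset hv ((Finset.erase_subset _ _).trans hS))

def Out (X S₁ S₂ S₃ : Finset V) (v : V) : Prop := v ∈ X ∧ v ∉ S₁ ∧ v ∉ S₂ ∧ v ∉ S₃

/-- `S₁` with `d ∈ S₁` traded for two outer vertices; `e` added to `S₂`, `v` added to `S₃`. -/
theorem tri_sw {X : Finset V} {m : ℕ} {S₁ S₂ S₃ : Finset V} {p q s : V}
    (h : Cfg X m S₁ S₂ S₃ p q s) {col : Finset V → Bool} {b : Bool} (t a a' v : V)
    (ht : t ∈ S₁) (t2 : t ∉ S₂) (t3 : t ∉ S₃) (ha : Out X S₁ S₂ S₃ a) (ha' : Out X S₁ S₂ S₃ a')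
    (hv : Out X S₁ S₂ S₃ v) (aa : a ≠ a') (av : a ≠ v) (av' : a' ≠ v)
    (h1 : col (insert a (insert a' (S₁.erase t))) = b) (h2 : col (insert t S₂) = b)
    (h3 : col (insert v S₃) = b) : HasC X m 3 col b := by
  obtain ⟨c1, c2, c3, x1, x2, x3, p1, p2, q2, q3, s1, s3, hp, hq, hs, pq, qs, ps⟩ := h
  obtain ⟨a0, a1, a2, a3⟩ := ha
  obtain ⟨b0, b1, b2, b3⟩ := ha'
  obtain ⟨v0, v1, v2, v3⟩ := hv
  refine tri _ _ _ p q s (card_sw c1 ht a1 b1 aa) (by rw [Finset.card_insert_of_notMem t2, c2])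
    (by rw [Finset.card_insert_of_notMem v3, c3]) (sub_sw x1 a0 b0)
    (Finset.insert_subset (x1 ht) x2) (Finset.insert_subset v0 x3) ?_ ?_ ?_ ?_ ?_ ?_ ?_ ?_ ?_ pq qs ps h1 h2 h3
  all_goals clear h1 h2 h3 c1 c2 c3 x1 x2 x3
  all_goals try simp only [Finset.mem_insert, Finset.mem_erase]
  all_goals grind

/-- `S₁` with the corner `p` traded for two outer vertices. -/
theorem tri_sw' {X : Finset V} {m : ℕ} {S₁ S₂ S₃ : Finset V} {p q s : V}
    (h : Cfg X m S₁ S₂ S₃ p q s) {col : Finset V → Bool} {b : Bool} (t a a' v : V)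
    (ht : t ∈ S₁) (t2 : t ∉ S₂) (t3 : t ∉ S₃) (ha : Out X S₁ S₂ S₃ a) (ha' : Out X S₁ S₂ S₃ a')
    (hv : Out X S₁ S₂ S₃ v) (aa : a ≠ a') (av : a ≠ v) (av' : a' ≠ v)
    (h1 : col (insert a (insert a' (S₁.erase p))) = b) (h2 : col (insert t S₂) = b)
    (h3 : col (insert v S₃) = b) : HasC X m 3 col b := by
  obtain ⟨c1, c2, c3, x1, x2, x3, p1, p2, q2, q3, s1, s3, hp, hq, hs, pq, qs, ps⟩ := h
  obtain ⟨a0, a1, a2, a3⟩ := ha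
  obtain ⟨b0, b1, b2, b3⟩ := ha'
  obtain ⟨v0, v1, v2, v3⟩ := hv
  refine tri _ _ _ t q s (card_sw c1 p1 a1 b1 aa) (by rw [Finset.card_insert_of_notMem t2, c2])
    (by rw [Finset.card_insert_of_notMem v3, c3]) (sub_sw x1 a0 b0)
    (Finset.insert_subset (x1 ht) x2) (Finset.insert_subset v0 x3) ?_ ?_ ?_ ?_ ?_ ?_ ?_ ?_ ?_ ?_ qs ?_ h1 h2 h3
  all_goals clear h1 h2 h3 c1 c2 c3 x1 x2 x3
  all_goals try simp only [Finset.mem_insert, Finset.mem_erase]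
  all_goals grind

theorem tri_sw'' {X : Finset V} {m : ℕ} {S₁ S₂ S₃ : Finset V} {p q s : V}
    (h : Cfg X m S₁ S₂ S₃ p q s) {col : Finset V → Bool} {b : Bool} (z a a' v : V)
    (hz : Out X S₁ S₂ S₃ z)
    (ha : Out X S₁ S₂ S₃ a) (ha' : Out X S₁ S₂ S₃ a')
    (hv : Out X S₁ S₂ S₃ v) (za : z ≠ a) (za' : z ≠ a') (zv : z ≠ v)
    (aa : a ≠ a') (av : a ≠ v) (av' : a' ≠ v)
    (h1 : col (insert z (insert a (S₁.erase p))) = b)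
    (h2 : col (insert z (insert a' (S₂.erase p))) = b)
    (h3 : col (insert v S₃) = b) : HasC X m 3 col b := by
  obtain ⟨c1, c2, c3, x1, x2, x3, p1, p2, q2, q3, s1, s3, hp, hq, hs, pq, qs, ps⟩ := h
  obtain ⟨z0, z1, z2, z3⟩ := hz
  obtain ⟨a0, a1, a2, a3⟩ := ha
  obtain ⟨b0, b1, b2, b3⟩ := ha'
  obtain ⟨v0, v1, v2, v3⟩ := hv
  refine tri _ _ _ z q s (card_sw c1 p1 z1 a1 za) (card_sw c2 p2 z2 b2 za')
    (by rw [Finset.card_insert_of_notMem v3, c3]) (sub_sw x1 z0 a0)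
    (sub_sw x2 z0 b0) (Finset.insert_subset v0 x3) ?_ ?_ ?_ ?_ ?_ ?_ ?_ ?_ ?_ ?_ qs ?_ h1 h2 h3
  all_goals clear h1 h2 h3 c1 c2 c3 x1 x2 x3
  all_goals try simp only [Finset.mem_insert, Finset.mem_erase]
  all_goals grind

theorem Out.swap {X S₁ S₂ S₃ : Finset V} {v : V} (h : Out X S₁ S₂ S₃ v) : Out X S₂ S₁ S₃ v :=
  ⟨h.1, h.2.2.1, h.2.1, h.2.2.2⟩

theorem Out.rot {X S₁ S₂ S₃ : Finset V} {v : V} (h : Out X S₁ S₂ S₃ v) : Out X S₂ S₃ S₁ v :=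
  ⟨h.1, h.2.2.1, h.2.2.2, h.2.1⟩

theorem core2 {X : Finset V} {m : ℕ} {S₁ S₂ S₃ : Finset V} {p q s : V}
    (h : Cfg X m S₁ S₂ S₃ p q s) {col : Finset V → Bool} {b : Bool}
    (n1 : ¬ HasC X m 3 col b) (n2 : ¬ HasC X m 3 col (!b)) (u w u' u'' t₁ t₂ : V)
    (hu : Out X S₁ S₂ S₃ u) (hw : Out X S₁ S₂ S₃ w) (hu' : Out X S₁ S₂ S₃ u')
    (hu'' : Out X S₁ S₂ S₃ u'') (d1 : u ≠ w) (d2 : u ≠ u') (d3 : u ≠ u'') (d4 : w ≠ u')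
    (d5 : w ≠ u'') (d6 : u' ≠ u'') (t11 : t₁ ∈ S₁) (t12 : t₁ ∉ S₂) (t13 : t₁ ∉ S₃)
    (t22 : t₂ ∈ S₂) (t21 : t₂ ∉ S₁) (t23 : t₂ ∉ S₃)
    (k1 : col (insert u S₃) = !b) (k2 : col (insert w S₃) = !b) (k3 : col (insert u'' S₃) = b)
    (k4 : col (insert t₁ S₂) = !b) (k5 : col (insert t₂ S₁) = !b) : False := by
  have r1 : col (insert u' (insert u (S₁.erase p))) = b := by
    by_contra hne
    have hne := Bool.eq_not_of_ne hne
    exact n2 (tri_sw' h t₁ u' u w t11 t12 t13 hu' hu hw d2.symm d4.symm d1 hne k4 k2)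
  have r2 : col (insert u' (insert w (S₂.erase p))) = b := by
    by_contra hne
    have hne := Bool.eq_not_of_ne hne
    exact n2 (tri_sw' h.swap t₂ u' w u t22 t21 t23 hu'.swap hw.swap hu.swap d4.symm d2.symm d1.symm hne k5 k1)
  exact n1 (tri_sw'' h u' u w u'' hu' hu hw hu'' d2.symm d4.symm d6 d1 d3 d5 r1 r2 k3)

theorem typ {X : Finset V} {m : ℕ} {S₁ S₂ S₃ : Finset V} {p q s : V}
    (h : Cfg X m S₁ S₂ S₃ p q s) {col : Finset V → Bool} {b : Bool}
    (n1 : ¬ HasC X m 3 col b) (n2 : ¬ HasC X m 3 col (!b)) (u w u' u'' t₁ : V)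
    (hu : Out X S₁ S₂ S₃ u) (hw : Out X S₁ S₂ S₃ w) (hu' : Out X S₁ S₂ S₃ u')
    (hu'' : Out X S₁ S₂ S₃ u'') (d1 : u ≠ w) (d2 : u ≠ u') (d3 : u ≠ u'') (d4 : w ≠ u')
    (d6 : u' ≠ u'') (t11 : t₁ ∈ S₁) (t12 : t₁ ∉ S₂) (t13 : t₁ ∉ S₃)
    (k2 : col (insert w S₃) = !b) (k3 : col (insert u'' S₃) = b) :
    col (insert t₁ S₂) = !(col (insert u (insert u' (S₁.erase t₁)))) := by
  by_contra hne
  have hne : col (insert t₁ S₂) = col (insert u (insert u' (S₁.erase t₁))) := by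
    revert hne
    cases col (insert t₁ S₂) <;> cases col (insert u (insert u' (S₁.erase t₁))) <;> simp
  by_cases hA : col (insert u (insert u' (S₁.erase t₁))) = b
  · exact n1 (tri_sw h t₁ u u' u'' t11 t12 t13 hu hu' hu'' d2 d3 d6 hA (hne.trans hA) k3)
  · have hA := Bool.eq_not_of_ne hA
    exact n2 (tri_sw h t₁ u u' w t11 t12 t13 hu hu' hw d2 d1 d4.symm hA (hne.trans hA) k2)

theorem pair {X : Finset V} {m : ℕ} {S₁ S₂ S₃ : Finset V} {p q s : V}
    (h : Cfg X m S₁ S₂ S₃ p q s) {col : Finset V → Bool} {b : Bool}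
    (n1 : ¬ HasC X m 3 col b) (n2 : ¬ HasC X m 3 col (!b)) (u w u' u'' t₁ t₂ : V)
    (hu : Out X S₁ S₂ S₃ u) (hw : Out X S₁ S₂ S₃ w) (hu' : Out X S₁ S₂ S₃ u')
    (hu'' : Out X S₁ S₂ S₃ u'') (d1 : u ≠ w) (d2 : u ≠ u') (d3 : u ≠ u'') (d4 : w ≠ u')
    (d5 : w ≠ u'') (d6 : u' ≠ u'') (t11 : t₁ ∈ S₁) (t12 : t₁ ∉ S₂) (t13 : t₁ ∉ S₃)
    (t22 : t₂ ∈ S₂) (t21 : t₂ ∉ S₁) (t23 : t₂ ∉ S₃)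
    (k1 : col (insert u S₃) = !b) (k2 : col (insert w S₃) = !b) (k3 : col (insert u'' S₃) = b)
    (k4 : col (insert u' S₃) = b)
    (hA : col (insert u (insert u' (S₁.erase t₁))) = col (insert u (insert u' (S₂.erase t₂)))) :
    False := by
  have y1 := typ h n1 n2 u w u' u'' t₁ hu hw hu' hu'' d1 d2 d3 d4 d6 t11 t12 t13 k2 k3
  have y2 := typ h.swap n1 n2 u w u' u'' t₂ hu.swap hw.swap hu'.swap hu''.swap d1 d2 d3 d4 d6
    t22 t21 t23 k2 k3
  rw [← hA] at y2
  by_cases hb : col (insert u (insert u' (S₁.erase t₁))) = b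
  · rw [hb] at y1 y2
    exact core2 h n1 n2 u w u' u'' t₁ t₂ hu hw hu' hu'' d1 d2 d3 d4 d5 d6 t11 t12 t13 t22 t21 t23
      k1 k2 k3 y1 y2
  · rw [Bool.eq_not_of_ne hb] at y1 y2
    exact core2 h (b := !b) n2 (by simpa using n1) u' u'' u w t₁ t₂ hu' hu'' hu hw d6 d2.symm d4.symm d3.symm
      d5.symm d1 t11 t12 t13 t22 t21 t23 (by simpa using k4) (by simpa using k3) k2 y1 y2

theorem step3_aux {X Y : Finset V} {r : ℕ} (hr : 1 ≤ r) {col : Finset V → Bool} {b : Bool}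
    (n1 : ¬ HasC X (r + 1) 3 col b) (n2 : ¬ HasC X (r + 1) 3 col (!b))
    {c : ZMod 3 → V} {I : ZMod 3 → Finset V} (C : IsCy Y r 3 c I) (hYX : Y ⊆ X)
    (U : Finset V) (UX : U ⊆ X) (hU : U.card = 3) (UE : ∀ u ∈ U, ∀ i, u ∉ E c I i)
    (w : V) (wX : w ∈ X) (wU : w ∉ U) (wE : ∀ i, w ∉ E c I i)
    (good : ∀ i, 2 ≤ (U.filter fun u => col (insert u (E c I i)) = b).card) : False := by
  let t : ZMod 3 → Finset V := fun i => U.filter fun u => col (insert u (E c I i)) = b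
  have ht : ∀ i, 2 ≤ (t i).card := good
  have tU : ∀ i, t i ⊆ U := fun i => Finset.filter_subset _ _
  obtain ⟨u, uU, hu⟩ : ∃ u ∈ U, ∀ i, u ∉ t i := by
    by_contra hno
    push Not at hno
    have hall : ∀ s : Finset (ZMod 3), s.card ≤ (s.biUnion t).card := by
      intro s
      have hs3 : s.card ≤ 3 := by simpa [ZMod.card] using Finset.card_le_univ s
      rcases s.eq_empty_or_nonempty with rfl | ⟨i, hi⟩
      · simp
      · have h1 := (ht i).trans (Finset.card_le_card (Finset.subset_biUnion_of_mem t hi))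
        by_cases hs : s = Finset.univ
        · have : U ⊆ s.biUnion t := by
            intro x hx
            obtain ⟨j, hj⟩ := hno x hx
            exact Finset.mem_biUnion.2 ⟨j, by simp [hs], hj⟩
          have := Finset.card_le_card this
          omega
        · have : s.card < 3 := by
            obtain ⟨x0, hx0⟩ : ∃ x, x ∉ s := by
              by_contra h
              push Not at h
              exact hs (Finset.eq_univ_iff_forall.2 h)
            have := Finset.card_lt_univ_of_notMem hx0
            simpa [ZMod.card] using this
          omega
    rw [Finset.all_card_le_biUnion_card_iff_exists_injective] at hall
    obtain ⟨f, fi, hf⟩ := hall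
    exact n1 (augment C hYX f fi (fun i => UX (tU i (hf i))) (fun i j => UE _ (tU i (hf i)) j)
      (fun i => (Finset.mem_filter.1 (hf i)).2))
  have teq : ∀ i, t i = U.erase u := by
    intro i
    apply Finset.eq_of_subset_of_card_le
    · intro x hx
      exact Finset.mem_erase.2 ⟨fun h => hu i (h ▸ hx), tU i hx⟩
    · rw [Finset.card_erase_of_mem uU, hU]; exact ht i
  have hUe : (U.erase u).card = 2 := by rw [Finset.card_erase_of_mem uU, hU]
  obtain ⟨v, v', vv, hvv⟩ := Finset.card_eq_two.1 hUe
  have hv : v ∈ U.erase u := by rw [hvv]; simp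
  have hv' : v' ∈ U.erase u := by rw [hvv]; simp
  have cu : ∀ i, col (insert u (E c I i)) = !b := by
    intro i
    apply Bool.eq_not_of_ne
    intro h
    exact hu i (Finset.mem_filter.2 ⟨uU, h⟩)
  have cv : ∀ i, col (insert v (E c I i)) = b := by
    intro i
    rw [← teq i] at hv
    exact (Finset.mem_filter.1 hv).2
  have cv' : ∀ i, col (insert v' (E c I i)) = b := by
    intro i
    rw [← teq i] at hv'
    exact (Finset.mem_filter.1 hv').2
  have vU := Finset.mem_of_mem_erase hv
  have vU' := Finset.mem_of_mem_erase hv'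
  have vu := Finset.ne_of_mem_erase hv
  have vu' := Finset.ne_of_mem_erase hv'
  have wv : w ≠ v := fun h => wU (h ▸ vU)
  have wv' : w ≠ v' := fun h => wU (h ▸ vU')
  have uw : u ≠ w := fun h => wU (h ▸ uU)
  have z3 : ∀ j i : ZMod 3, i = j ∨ i = j + 1 ∨ i = j + 2 := by decide
  have z1 : ∀ j : ZMod 3, j + 1 ≠ j ∧ j + 2 ≠ j ∧ j + 2 ≠ j + 1 := by decide
  have cw : ∀ i, col (insert w (E c I i)) = !b := by
    intro j
    apply Bool.eq_not_of_ne
    intro h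
    let f : ZMod 3 → V := fun i => if i = j then w else if i = j + 1 then v else v'
    have f0 : f j = w := by simp [f]
    have f1 : f (j + 1) = v := by simp [f, (z1 j).1]
    have f2 : f (j + 2) = v' := by
      simp only [f]; rw [if_neg (z1 j).2.1, if_neg (z1 j).2.2]
    refine n1 (augment C hYX f ?_ ?_ ?_ ?_)
    · intro a a' h
      rcases z3 j a with h1 | h1 | h1 <;> rcases z3 j a' with h2 | h2 | h2 <;> rw [h1, h2] at h ⊢ <;>
        simp only [f0, f1, f2] at h
      · exact absurd h wv
      · exact absurd h wv'
      · exact absurd h.symm wv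
      · exact absurd h vv
      · exact absurd h.symm wv'
      · exact absurd h.symm vv
    · intro a
      rcases z3 j a with rfl | rfl | rfl
      · rw [f0]; exact wX
      · rw [f1]; exact UX vU
      · rw [f2]; exact UX vU'
    · intro a
      rcases z3 j a with rfl | rfl | rfl
      · rw [f0]; exact wE
      · rw [f1]; exact UE _ vU
      · rw [f2]; exact UE _ vU'
    · intro a
      rcases z3 j a with rfl | rfl | rfl
      · rw [f0]; exact h
      · rw [f1]; exact cv _
      · rw [f2]; exact cv' _
  have ESX : ∀ i, E c I i ⊆ X := fun i => (E_sub C i).trans hYX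
  have Ec : ∀ i, (E c I i).card = r + 2 := E_card (by omega) C
  have e11 : (1 : ZMod 3) + 1 = 2 := by decide
  have e21 : (2 : ZMod 3) + 1 = 0 := by decide
  have e01 : (0 : ZMod 3) + 1 = 1 := by decide
  have A0 := E_adj (by omega) C 0
  have A1 := E_adj (by omega) C 1
  have A2 := E_adj (by omega) C 2
  rw [e01] at A0
  rw [e11] at A1
  rw [e21] at A2
  have cfg : Cfg X (r + 1) (E c I 0) (E c I 1) (E c I 2) (c 1) (c 2) (c 0) := by
    refine ⟨Ec _, Ec _, Ec _, ESX _, ESX _, ESX _, ?_, ?_, ?_, ?_, ?_, ?_, A0, A1,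
      fun x a b => A2 x b a, ?_, ?_, ?_⟩
    · rw [mem_E, e01]; simp
    · rw [mem_E]; simp
    · rw [mem_E, e11]; simp
    · rw [mem_E]; simp
    · rw [mem_E]; simp
    · rw [mem_E, e21]; simp
    · intro h; exact absurd (C.inj h) (by decide)
    · intro h; exact absurd (C.inj h) (by decide)
    · intro h; exact absurd (C.inj h) (by decide)
  have int : ∀ i, ∃ x, x ∈ E c I i ∧ ∀ j, j ≠ i → x ∉ E c I j := by
    intro i
    obtain ⟨x, hx⟩ : (I i).Nonempty := by rw [← Finset.card_pos, C.card]; omega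
    refine ⟨x, mem_E.2 (Or.inr (Or.inr hx)), ?_⟩
    intro j hj h
    rcases mem_E.1 h with h | h | h
    · exact C.cI _ _ (h ▸ hx)
    · exact C.cI _ _ (h ▸ hx)
    · exact C.dis i j hj.symm x hx h
  obtain ⟨t0, a0, b0⟩ := int 0
  obtain ⟨t1, a1, b1⟩ := int 1
  obtain ⟨t2, a2, b2⟩ := int 2
  have b01 := b0 1 (by decide)
  have b02 := b0 2 (by decide)
  have b10 := b1 0 (by decide)
  have b12 := b1 2 (by decide)
  have b20 := b2 0 (by decide)
  have b21 := b2 1 (by decide)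
  have ou : Out X (E c I 0) (E c I 1) (E c I 2) u := ⟨UX uU, UE u uU _, UE u uU _, UE u uU _⟩
  have ov : Out X (E c I 0) (E c I 1) (E c I 2) v := ⟨UX vU, UE v vU _, UE v vU _, UE v vU _⟩
  have ov' : Out X (E c I 0) (E c I 1) (E c I 2) v' := ⟨UX vU', UE v' vU' _, UE v' vU' _, UE v' vU' _⟩
  have ow : Out X (E c I 0) (E c I 1) (E c I 2) w := ⟨wX, wE _, wE _, wE _⟩
  by_cases g1 : col (insert u (insert v ((E c I 0).erase t0))) = col (insert u (insert v ((E c I 1).erase t1)))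
  · exact pair cfg n1 n2 u w v v' t0 t1 ou ow ov ov' uw vu.symm vu'.symm wv wv' vv a0 b01 b02 a1 b10 b12
      (cu _) (cw _) (cv' _) (cv _) g1
  by_cases g2 : col (insert u (insert v ((E c I 1).erase t1))) = col (insert u (insert v ((E c I 2).erase t2)))
  · exact pair cfg.rot n1 n2 u w v v' t1 t2 ou.rot ow.rot ov.rot ov'.rot uw vu.symm vu'.symm wv wv' vv a1 b12 b10 a2 b21 b20
      (cu _) (cw _) (cv' _) (cv _) g2
  have g3 : col (insert u (insert v ((E c I 2).erase t2))) = col (insert u (insert v ((E c I 0).erase t0))) := by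
    revert g1 g2
    cases col (insert u (insert v ((E c I 0).erase t0))) <;>
    cases col (insert u (insert v ((E c I 1).erase t1))) <;>
    cases col (insert u (insert v ((E c I 2).erase t2))) <;> simp
  exact pair cfg.rot.rot n1 n2 u w v v' t2 t0 ou.rot.rot ow.rot.rot ov.rot.rot ov'.rot.rot uw vu.symm vu'.symm wv wv' vv
    a2 b20 b21 a0 b02 b01 (cu _) (cw _) (cv' _) (cv _) g3

theorem step3 (r : ℕ) (hr : 1 ≤ r) (ih : P V r 3) : P V (r + 1) 3 := by
  intro X col hX
  by_contra hcon
  push Not at hcon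
  obtain ⟨nt, nb⟩ := hcon
  obtain ⟨U, UX, hU⟩ := Finset.exists_subset_card_eq (s := X) (n := 3) (by omega)
  have hX' : (r + 1) * 3 + 1 ≤ (X \ U).card := by
    rw [Finset.card_sdiff_of_subset UX, hU]; omega
  have hYX : X \ U ⊆ X := Finset.sdiff_subset
  have UE : ∀ (c : ZMod 3 → V) (I : ZMod 3 → Finset V), IsCy (X \ U) r 3 c I →
      ∀ u ∈ U, ∀ i, u ∉ E c I i := by
    intro c I C u hu i h
    exact (Finset.mem_sdiff.1 (E_sub C i h)).2 hu
  have Wx : ∀ (c : ZMod 3 → V) (I : ZMod 3 → Finset V), IsCy (X \ U) r 3 c I →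
      ∃ w ∈ X, w ∉ U ∧ ∀ i, w ∉ E c I i := by
    intro c I C
    obtain ⟨W, WX, hW, hWE⟩ := supp C 1 hX'
    obtain ⟨w, rfl⟩ := Finset.card_eq_one.1 hW
    have wX' : w ∈ X \ U := WX (by simp)
    exact ⟨w, hYX wX', (Finset.mem_sdiff.1 wX').2, hWE w (by simp)⟩
  rcases ih (X \ U) (fun S => decide (2 ≤ (U.filter fun u => col (insert u S) = true).card)) hX' with
    ⟨c, I, C, hc⟩ | ⟨c, I, C, hc⟩
  · obtain ⟨w, wX, wU, wE⟩ := Wx c I C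
    exact step3_aux hr (b := true) nt nb C hYX U UX hU (UE c I C) w wX wU wE
      (fun i => by simpa using hc i)
  · obtain ⟨w, wX, wU, wE⟩ := Wx c I C
    refine step3_aux hr (b := false) nb nt C hYX U UX hU (UE c I C) w wX wU wE (fun i => ?_)
    have h1 := hc i
    simp only [decide_eq_false_iff_not, not_le] at h1
    have h2 := Finset.card_filter_add_card_filter_not (s := U) (fun u => col (insert u (E c I i)) = true)
    simp only [Bool.not_eq_true] at h2
    omega

theorem Pall (r n : ℕ) (hr : 1 ≤ r) (hn : 3 ≤ n) : P V r n := by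
  induction r, hr using Nat.le_induction with
  | base => exact P1 n hn
  | succ r hr ih =>
    rcases Nat.lt_or_ge n 4 with h | h
    · obtain rfl : n = 3 := by omega
      exact step3 r hr ih
    · exact step4 r n h ih

theorem toLoose (r n : ℕ) (hn : 3 ≤ n) (X : Finset V) (col : Finset V → Bool) (b : Bool)
    (h : HasC X r n col b) : HasLooseCycle (r + 2) n col b := by
  haveI : NeZero n := ⟨by omega⟩
  obtain ⟨c, I, C, hcol⟩ := h
  have e : ∀ i : ZMod n, ∃ g : ℕ → V, Set.InjOn g (Set.Iio r) ∧ (Finset.range r).image g = I i := by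
    intro i
    let q := (I i).equivFinOfCardEq (C.card i)
    refine ⟨fun j => if hj : j < r then (q.symm ⟨j, hj⟩ : V) else c i, ?_, ?_⟩
    · intro a ha a' ha' h
      have ha : a < r := ha
      have ha' : a' < r := ha'
      simp only [ha, ha', dif_pos] at h
      have := q.symm.injective (Subtype.ext h)
      simpa using this
    · ext x
      simp only [Finset.mem_image, Finset.mem_range]
      constructor
      · rintro ⟨a, ha, rfl⟩
        simp only [ha, dif_pos]
        exact (q.symm ⟨a, ha⟩).2
      · intro hx
        refine ⟨(q ⟨x, hx⟩).1, (q ⟨x, hx⟩).2, ?_⟩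
        simp
  choose g gi gI using e
  let f : ℕ → V := fun a =>
    if a % (r + 1) = 0 then c ((a / (r + 1) : ℕ) : ZMod n) else g ((a / (r + 1) : ℕ) : ZMod n) (a % (r + 1) - 1)
  have gm : ∀ i j, j < r → g i j ∈ I i := by
    intro i j hj
    rw [← gI i]; exact Finset.mem_image_of_mem _ (by simpa using hj)
  have f0 : ∀ i, f (i * (r + 1)) = c (i : ZMod n) := by
    intro i; simp [f]
  have fs : ∀ i j, j < r → f (i * (r + 1) + (j + 1)) = g (i : ZMod n) j := by
    intro i j hj
    have h1 : (i * (r + 1) + (j + 1)) % (r + 1) = j + 1 := by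
      rw [mul_comm, Nat.mul_add_mod, Nat.mod_eq_of_lt (by omega)]
    have h2 : (i * (r + 1) + (j + 1)) / (r + 1) = i := by
      rw [mul_comm, Nat.mul_add_div (by omega), Nat.div_eq_of_lt (by omega)]; omega
    simp [f, h1, h2]
  have hk : r + 2 - 1 = r + 1 := by omega
  refine ⟨f, ?_, ?_⟩
  · rw [hk]
    intro a ha a' ha' h
    have ha : a < n * (r + 1) := ha
    have ha' : a' < n * (r + 1) := ha'
    have d1 : a / (r + 1) < n := Nat.div_lt_of_lt_mul (by rwa [mul_comm])
    have d2 : a' / (r + 1) < n := Nat.div_lt_of_lt_mul (by rwa [mul_comm])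
    have l1 := Nat.mod_lt a (show 0 < r + 1 by omega)
    have l2 := Nat.mod_lt a' (show 0 < r + 1 by omega)
    have ci : ((a / (r + 1) : ℕ) : ZMod n) = ((a' / (r + 1) : ℕ) : ZMod n) → a / (r + 1) = a' / (r + 1) := by
      intro h
      rw [ZMod.natCast_eq_natCast_iff'] at h
      rwa [Nat.mod_eq_of_lt d1, Nat.mod_eq_of_lt d2] at h
    have fin : a / (r + 1) = a' / (r + 1) → a % (r + 1) = a' % (r + 1) → a = a' := by
      intro h1 h2
      rw [← Nat.div_add_mod a (r + 1), ← Nat.div_add_mod a' (r + 1), h1, h2]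
    simp only [f] at h
    split_ifs at h with h1 h2 h2
    · exact fin (ci (C.inj h)) (h1.trans h2.symm)
    · have hm := gm ((a' / (r + 1) : ℕ) : ZMod n) (a' % (r + 1) - 1) (by omega)
      rw [← h] at hm
      exact absurd hm (C.cI _ _)
    · have hm := gm ((a / (r + 1) : ℕ) : ZMod n) (a % (r + 1) - 1) (by omega)
      rw [h] at hm
      exact absurd hm (C.cI _ _)
    · have hi : ((a / (r + 1) : ℕ) : ZMod n) = ((a' / (r + 1) : ℕ) : ZMod n) := by
        by_contra hne
        have hm1 := gm ((a / (r + 1) : ℕ) : ZMod n) (a % (r + 1) - 1) (by omega)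
        have hm2 := gm ((a' / (r + 1) : ℕ) : ZMod n) (a' % (r + 1) - 1) (by omega)
        rw [← h] at hm2
        exact C.dis _ _ hne _ hm1 hm2
      rw [hi] at h
      have := gi _ (show a % (r + 1) - 1 < r by omega) (show a' % (r + 1) - 1 < r by omega) h
      exact fin (ci hi) (by omega)
  · rw [hk]
    intro i hi
    rw [← hcol (i : ZMod n)]
    congr 1
    have m1 : ∀ j, j ≤ r → (i * (r + 1) + j) % (n * (r + 1)) = i * (r + 1) + j := by
      intro j hj
      apply Nat.mod_eq_of_lt
      nlinarith
    have m2 : f ((i * (r + 1) + (r + 1)) % (n * (r + 1))) = c ((i : ZMod n) + 1) := by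
      have : i * (r + 1) + (r + 1) = (i + 1) * (r + 1) := by ring
      rw [this]
      rcases Nat.lt_or_ge (i + 1) n with h | h
      · rw [Nat.mod_eq_of_lt (by nlinarith), f0]; push_cast; rfl
      · have hin : i + 1 = n := by omega
        rw [hin, Nat.mod_self]
        have h0 := f0 0
        rw [zero_mul] at h0
        rw [h0]
        congr 1
        have : ((i + 1 : ℕ) : ZMod n) = 0 := by rw [hin]; simp
        push_cast at this ⊢
        exact this.symm
    ext x
    rw [mem_E, ← gI]
    simp only [Finset.mem_image, Finset.mem_range]
    constructor
    · rintro ⟨j, hj, rfl⟩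
      rcases Nat.lt_or_ge r j with h | h
      · obtain rfl : j = r + 1 := by omega
        right; left; exact m2
      · rw [m1 j h]
        rcases j with _ | j
        · left; rw [add_zero, f0]
        · right; right; exact ⟨j, by omega, (fs i j (by omega)).symm⟩
    · rintro (rfl | rfl | ⟨j, hj, rfl⟩)
      · exact ⟨0, by omega, by rw [m1 0 (by omega), add_zero, f0]⟩
      · exact ⟨r + 1, by omega, m2⟩
      · exact ⟨j + 1, by omega, by rw [m1 _ (by omega), fs i j hj]⟩

end

theorem lower (r n N : ℕ) (hr : 1 ≤ r) (hn : 3 ≤ n) (hN : 0 < N) (hNn : N ≤ (r + 1) * n) :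
    ∃ col : Finset (Fin N) → Bool, ¬ HasLooseCycle (r + 2) 3 col true ∧
      ¬ HasLooseCycle (r + 2) n col false := by
  have hk : r + 2 - 1 = r + 1 := by omega
  refine ⟨fun S => decide ((⟨0, hN⟩ : Fin N) ∈ S), ?_, ?_⟩
  · rintro ⟨f, fi, hf⟩
    rw [hk] at fi hf
    simp only [decide_eq_true_eq, Finset.mem_image, Finset.mem_range] at hf
    obtain ⟨j0, h0, e0⟩ := hf 0 (by omega)
    obtain ⟨j1, h1, e1⟩ := hf 1 (by omega)
    obtain ⟨j2, h2, e2⟩ := hf 2 (by omega)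
    have L : ∀ x, x % (3 * (r + 1)) < 3 * (r + 1) := fun x => Nat.mod_lt _ (by omega)
    have q1 := fi (L _) (L _) (e0.trans e1.symm)
    have q2 := fi (L _) (L _) (e0.trans e2.symm)
    rw [Nat.mod_eq_of_lt (by omega), Nat.mod_eq_of_lt (by omega)] at q1
    rw [Nat.mod_eq_of_lt (by omega)] at q2
    rcases Nat.lt_or_ge j2 (r + 1) with h | h
    · rw [Nat.mod_eq_of_lt (by omega)] at q2; omega
    · obtain rfl : j2 = r + 1 := by omega
      rw [show 2 * (r + 1) + (r + 1) = 3 * (r + 1) by ring, Nat.mod_self] at q2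
      omega
  · rintro ⟨f, fi, hf⟩
    rw [hk] at fi hf
    simp only [decide_eq_false_iff_not, Finset.mem_image, Finset.mem_range, not_exists, not_and] at hf
    have h1 : (Finset.range (n * (r + 1))).image f ⊆ Finset.univ.erase (⟨0, hN⟩ : Fin N) := by
      intro x hx
      obtain ⟨a, ha, rfl⟩ := Finset.mem_image.1 hx
      rw [Finset.mem_range] at ha
      refine Finset.mem_erase.2 ⟨?_, Finset.mem_univ _⟩
      have := hf (a / (r + 1)) (Nat.div_lt_of_lt_mul (by rwa [mul_comm])) (a % (r + 1))
        ((Nat.mod_lt a (by omega)).trans (by omega))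
      rwa [mul_comm, Nat.div_add_mod, Nat.mod_eq_of_lt ha] at this
    have h2 := Finset.card_le_card h1
    rw [Finset.card_image_of_injOn (by
      intro a ha a' ha' h
      exact fi (by simpa using ha) (by simpa using ha') h), Finset.card_range,
      Finset.card_erase_of_mem (Finset.mem_univ _), Finset.card_univ, Fintype.card_fin] at h2
    rw [mul_comm] at hNn
    omega

end RC

/-- For all n, k ≥ 3, R(Cᵏ₃, Cᵏₙ) = (k-1)n + 1. -/
theorem ramsey_C3_Cn (n k : ℕ) (hn : 3 ≤ n) (hk : 3 ≤ k) :
    RamseyCC k 3 n = (k - 1) * n + 1 := by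
  obtain ⟨r, rfl⟩ : ∃ r, k = r + 2 := ⟨k - 2, by omega⟩
  have hr : 1 ≤ r := by omega
  have hk1 : r + 2 - 1 = r + 1 := by omega
  rw [hk1]
  have mem : (r + 1) * n + 1 ∈ {N | 0 < N ∧ ∀ col : Finset (Fin N) → Bool,
    HasLooseCycle (r + 2) 3 col true ∨ HasLooseCycle (r + 2) n col false} := by
    refine ⟨by omega, fun col => ?_⟩
    rcases RC.Pall (V := Fin ((r + 1) * n + 1)) r n hr hn Finset.univ col (by simp) with h | h
    · exact Or.inl (RC.toLoose r 3 le_rfl _ col true h)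
    · exact Or.inr (RC.toLoose r n hn _ col false h)
  unfold RamseyCC
  apply le_antisymm (Nat.sInf_le mem)
  apply le_csInf ⟨_, mem⟩
  rintro N ⟨hN, hcol⟩
  by_contra hlt
  obtain ⟨col, h1, h2⟩ := RC.lower r n N hr hn hN (by omega)
  rcases hcol col with h | h
  · exact h1 h
  · exact h2 h
end

section
/- For all integers k ≥ 3 and n ≥ m ≥ 3, the Ramsey number of k-uniform loose cycles satisfies the lower bound R(C^k_n, C^k_m) ≥ (k−1)n + ⌊(m−1)/2⌋; that is, there exists a red-blue coloring of the k-element subsets of a set of (k−1)n + ⌊(m−1)/2⌋ − 1 vertices with no red copy of C^k_n and no blue copy of C^k_m. -/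
theorem rlc_ramsey (r : ℕ) : ∀ a b : ℕ, ∃ N : ℕ, ∀ (α : Type) [DecidableEq α] (S : Finset α)
    (col : Finset α → Bool), N ≤ S.card →
    (∃ T ⊆ S, T.card = a ∧ ∀ A ⊆ T, A.card = r → col A = true) ∨
    (∃ T ⊆ S, T.card = b ∧ ∀ A ⊆ T, A.card = r → col A = false) := by
  induction r with
  | zero =>
    intro a b
    refine ⟨max a b, fun α _ S col hS => ?_⟩
    rcases hc : col ∅ with _ | _
    · right
      obtain ⟨T, hT, hTc⟩ := Finset.exists_subset_card_eq (le_trans (le_max_right a b) hS)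
      refine ⟨T, hT, hTc, fun A _ h => ?_⟩
      rw [Finset.card_eq_zero.mp h, hc]
    · left
      obtain ⟨T, hT, hTc⟩ := Finset.exists_subset_card_eq (le_trans (le_max_left a b) hS)
      refine ⟨T, hT, hTc, fun A _ h => ?_⟩
      rw [Finset.card_eq_zero.mp h, hc]
  | succ r ihr =>
    intro a
    induction a with
    | zero =>
      intro b
      refine ⟨0, fun α _ S col hS => Or.inl ⟨∅, by simp, by simp, fun A hA h => ?_⟩⟩
      rw [Finset.subset_empty.mp hA] at h
      simp at h
    | succ a iha =>
      intro b
      induction b with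
      | zero =>
        refine ⟨0, fun α _ S col hS => Or.inr ⟨∅, by simp, by simp, fun A hA h => ?_⟩⟩
        rw [Finset.subset_empty.mp hA] at h
        simp at h
      | succ b ihb =>
        obtain ⟨N1, h1⟩ := iha (b + 1)
        obtain ⟨N2, h2⟩ := ihb
        obtain ⟨N, hN⟩ := ihr N1 N2
        refine ⟨N + 1, fun α _ S col hS => ?_⟩
        obtain ⟨x, hx⟩ : S.Nonempty := Finset.card_pos.mp (by omega)
        have hc : N ≤ (S.erase x).card := by rw [Finset.card_erase_of_mem hx]; omega
        have key : ∀ (c : Bool) (S' T : Finset α), S' ⊆ S.erase x → T ⊆ S' →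
            (∀ A ⊆ S', A.card = r → col (insert x A) = c) →
            (∀ A ⊆ T, A.card = r + 1 → col A = c) →
            insert x T ⊆ S ∧ (insert x T).card = T.card + 1 ∧
              ∀ A ⊆ insert x T, A.card = r + 1 → col A = c := by
          intro c S' T hS' hT h h'
          have hxT : x ∉ T := fun hh => by simpa using hS' (hT hh)
          refine ⟨?_, Finset.card_insert_of_notMem hxT, ?_⟩
          · exact Finset.insert_subset hx ((hT.trans hS').trans (Finset.erase_subset _ _))
          · intro A hA hAc
            by_cases hxA : x ∈ A
            · rw [← Finset.insert_erase hxA]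
              refine h _ ?_ ?_
              · exact (Finset.subset_insert_iff.mp hA).trans hT
              · rw [Finset.card_erase_of_mem hxA]; omega
            · exact h' A ((Finset.subset_insert_iff_of_notMem hxA).mp hA) hAc
        rcases hN α (S.erase x) (fun A => col (insert x A)) hc with
          ⟨S', hS', hcd, h⟩ | ⟨S', hS', hcd, h⟩
        · have hSS := hS'.trans (Finset.erase_subset _ _)
          rcases h1 α S' col hcd.ge with ⟨T, hT, hTc, h'⟩ | ⟨T, hT, hTc, h'⟩
          · left
            obtain ⟨p, q, s⟩ := key true S' T hS' hT h h'
            exact ⟨_, p, by omega, s⟩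
          · exact Or.inr ⟨T, hT.trans hSS, hTc, h'⟩
        · have hSS := hS'.trans (Finset.erase_subset _ _)
          rcases h2 α S' col hcd.ge with ⟨T, hT, hTc, h'⟩ | ⟨T, hT, hTc, h'⟩
          · exact Or.inl ⟨T, hT.trans hSS, hTc, h'⟩
          · right
            obtain ⟨p, q, s⟩ := key false S' T hS' hT h h'
            exact ⟨_, p, by omega, s⟩

theorem rlc_cycle_of_mono {V : Type} [DecidableEq V] (k n : ℕ) (hk : 3 ≤ k) (hn : 3 ≤ n)
    (col : Finset V → Bool) (b : Bool) (T : Finset V) (hT : T.card = n * (k - 1))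
    (h : ∀ A ⊆ T, A.card = k → col A = b) : HasLooseCycle k n col b := by
  have hM : k ≤ n * (k - 1) := by
    have : 3 * (k - 1) ≤ n * (k - 1) := Nat.mul_le_mul_right _ hn
    omega
  set M := n * (k - 1) with hMd
  have hMpos : 0 < M := by omega
  let e : Fin M ≃ T := (T.equivFinOfCardEq hT).symm
  let f : ℕ → V := fun p => (e ⟨p % M, Nat.mod_lt _ hMpos⟩ : V)
  have hf : ∀ p q, f p = f q → p % M = q % M := by
    intro p q hpq
    have := e.injective (Subtype.ext hpq)
    simpa using this
  refine ⟨f, ?_, ?_⟩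
  · intro p hp q hq hpq
    have := hf p q hpq
    rwa [Nat.mod_eq_of_lt hp, Nat.mod_eq_of_lt hq] at this
  · intro i hi
    apply h
    · intro x hx
      obtain ⟨j, _, rfl⟩ := Finset.mem_image.mp hx
      exact (e _).2
    · rw [Finset.card_image_of_injOn, Finset.card_range]
      intro p hp q hq hpq
      have hp' : p < k := by simpa using hp
      have hq' : q < k := by simpa using hq
      have h3 := hf _ _ hpq
      rw [Nat.mod_mod, Nat.mod_mod] at h3
      have h4 : p ≡ q [MOD M] := Nat.ModEq.add_left_cancel' _ h3
      exact Nat.ModEq.eq_of_lt_of_lt h4 (by omega) (by omega)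

theorem rlc_coloring (k n m : ℕ) (hk : 3 ≤ k) (hm : 3 ≤ m) (hnm : m ≤ n) (N : ℕ)
    (hN : N ≤ (k - 1) * n + (m - 1) / 2 - 1) :
    ∃ col : Finset (Fin N) → Bool,
      ¬ HasLooseCycle k n col true ∧ ¬ HasLooseCycle k m col false := by
  have hkp : 0 < k - 1 := by omega
  have hMn : 0 < n * (k - 1) := Nat.mul_pos (by omega) hkp
  have hMm : 0 < m * (k - 1) := Nat.mul_pos (by omega) hkp
  rw [Nat.mul_comm (k - 1) n] at hN
  refine ⟨fun s => decide (∀ x ∈ s, x.val < n * (k - 1) - 1), ?_, ?_⟩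
  · rintro ⟨f, hf, h⟩
    have hA : ∀ p < n * (k - 1), (f p).val < n * (k - 1) - 1 := by
      intro p hp
      have h1 := h (p / (k - 1)) (Nat.div_lt_of_lt_mul (by rwa [Nat.mul_comm]))
      have h2 := of_decide_eq_true h1
      apply h2
      refine Finset.mem_image.mpr ⟨p % (k - 1), ?_, ?_⟩
      · have := Nat.mod_lt p hkp
        exact Finset.mem_range.mpr (by omega)
      · rw [Nat.div_add_mod' , Nat.mod_eq_of_lt hp]
    have := Finset.card_le_card_of_injOn (s := Finset.range (n * (k - 1)))
      (t := Finset.range (n * (k - 1) - 1)) (fun p => (f p).val)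
      (fun p hp => by simpa using hA p (by simpa using hp))
      (fun p hp q hq hpq => hf (by simpa using hp) (by simpa using hq) (Fin.ext hpq))
    simp only [Finset.card_range] at this
    omega
  · rintro ⟨f, hf, h⟩
    have hB : ∀ i, ∃ p, i < m → (p < m * (k - 1) ∧ n * (k - 1) - 1 ≤ (f p).val ∧
        ∃ j < k, p = (i * (k - 1) + j) % (m * (k - 1))) := by
      intro i
      by_cases hi : i < m
      · have h1 := of_decide_eq_false (h i hi)
        push Not at h1
        obtain ⟨x, hx, hx2⟩ := h1
        obtain ⟨j, hj, rfl⟩ := Finset.mem_image.mp hx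
        exact ⟨_, fun _ => ⟨Nat.mod_lt _ hMm, hx2, j, by simpa using hj, rfl⟩⟩
      · exact ⟨0, fun h => absurd h hi⟩
    choose g hg using hB
    have hfib := Finset.card_le_mul_card_image (f := g) (Finset.range m) 2 (by
      intro p _
      refine le_trans (Finset.card_le_card
        (t := {p / (k - 1), (p / (k - 1) + (m - 1)) % m}) ?_) Finset.card_le_two
      intro i hi
      obtain ⟨hi1, hi2⟩ := Finset.mem_filter.mp hi
      have him : i < m := by simpa using hi1
      obtain ⟨_, _, j, hj, hp⟩ := hg i him
      rw [hi2] at hp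
      simp only [Finset.mem_insert, Finset.mem_singleton]
      have hle : (i + 1) * (k - 1) ≤ m * (k - 1) := Nat.mul_le_mul_right _ him
      rw [Nat.add_mul, Nat.one_mul] at hle
      by_cases hjk : j < k - 1
      · left
        rw [hp, Nat.mod_eq_of_lt (by omega), Nat.add_comm, Nat.add_mul_div_right _ _ hkp,
          Nat.div_eq_of_lt hjk, Nat.zero_add]
      · right
        have hj' : i * (k - 1) + j = (i + 1) * (k - 1) := by
          rw [Nat.add_mul]; omega
        rw [hp, hj', Nat.mul_mod_mul_right, Nat.mul_div_cancel _ hkp, Nat.mod_add_mod,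
          show i + 1 + (m - 1) = i + m by omega, Nat.add_mod_right, Nat.mod_eq_of_lt him])
    have himg : ((Finset.range m).image g).card ≤ (Finset.Ico (n * (k - 1) - 1) N).card := by
      apply Finset.card_le_card_of_injOn (fun p => (f p).val)
      · intro p hp
        obtain ⟨i, hi, rfl⟩ := Finset.mem_image.mp hp
        obtain ⟨_, h2, _⟩ := hg i (by simpa using hi)
        exact Finset.mem_coe.mpr (Finset.mem_Ico.mpr ⟨h2, (f _).isLt⟩)
      · intro p hp q hq hpq
        obtain ⟨i, hi, rfl⟩ := Finset.mem_image.mp hp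
        obtain ⟨i', hi', rfl⟩ := Finset.mem_image.mp hq
        exact hf (hg i (by simpa using hi)).1 (hg i' (by simpa using hi')).1 (Fin.ext hpq)
    rw [Nat.card_Ico] at himg
    rw [Finset.card_range] at hfib
    omega

theorem ramsey_loose_cycle_lower_bound (k n m : ℕ) (hk : 3 ≤ k) (hm : 3 ≤ m)
    (hnm : m ≤ n) :
    (k - 1) * n + (m - 1) / 2 ≤ RamseyCC k n m ∧
    ∃ col : Finset (Fin ((k - 1) * n + (m - 1) / 2 - 1)) → Bool,
      ¬ HasLooseCycle k n col true ∧ ¬ HasLooseCycle k m col false := by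
  refine ⟨?_, rlc_coloring k n m hk hm hnm _ le_rfl⟩
  apply le_csInf
  · obtain ⟨N, hN⟩ := rlc_ramsey k (n * (k - 1)) (m * (k - 1))
    refine ⟨N + 1, Nat.succ_pos _, fun col => ?_⟩
    rcases hN (Fin (N + 1)) Finset.univ col (by simp) with ⟨T, _, hc, h⟩ | ⟨T, _, hc, h⟩
    · exact Or.inl (rlc_cycle_of_mono k n hk (by omega) col true T hc h)
    · exact Or.inr (rlc_cycle_of_mono k m hk hm col false T hc h)
  · rintro N ⟨_, hN⟩
    by_contra hlt
    obtain ⟨col, h1, h2⟩ := rlc_coloring k n m hk hm hnm N (by omega)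
    rcases hN col with h | h
    · exact h1 h
    · exact h2 h
end

section
/- Let the complete 4-uniform hypergraph K^4_N be 2-edge colored red and blue, and let P = e_1e_2…e_n be a red loose path that is maximal with respect to a set W ⊆ V(K^4_N) \ V(P) with |W| ≥ 4. Set A_1 = {f_{P,e_1}} and A_i = e_{i−1} \ {f_{P,e_{i−1}}} for i > 1, where f_{P,e_i} denotes the first vertex of e_i. Then for every two consecutive edges e_i and e_{i+1} of P and every u ∈ A_i there exist vertices x, y ∈ W, a vertex v ∈ A_{i+2}, and five distinct vertices a_1,…,a_5 ∈ ((e_i \ {f_{P,e_i}}) ∪ {u}) ∪ (e_{i+1} \ {v}) such that both 4-sets f = {x,a_1,a_2,a_3} and g = {a_3,a_4,a_5,y} are blue (so fg is a blue loose path of length 2 with end vertices x and y) and at least one vertex of e_{i+1} \ e_i is not among a_1,…,a_5. Moreover, there exist subsets W_1, W_2 ⊆ W with |W_1| ≥ |W| − 2 and |W_2| ≥ |W| − 3 such that for all distinct x' ∈ W_1 and y' ∈ W_2, the pair of 4-sets (f \ {x}) ∪ {x'} and (g \ {y}) ∪ {y'} is again such a blue configuration with end vertices x' and y'. -/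
/-- The `i`-th edge (0-indexed) of the 4-uniform loose path listed by `g`:
the 4-set `{g (3*i), g (3*i+1), g (3*i+2), g (3*i+3)}`. -/
def pathEdge {V : Type*} [DecidableEq V] (g : ℕ → V) (i : ℕ) : Finset V :=
  (Finset.range 4).image fun j => g (3 * i + j)

/-- The vertex set of the 4-uniform loose path of length `n` listed by `g`. -/
def pathVerts {V : Type*} (g : ℕ → V) (n : ℕ) : Set V :=
  g '' Set.Iio (3 * n + 1)

/-- `g` lists a 4-uniform loose path with `n` edges, all of color `b`
(`true` = red, `false` = blue) in the coloring `col`. -/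
def IsLoosePath4 {V : Type*} [DecidableEq V] (col : Finset V → Bool) (b : Bool)
    (g : ℕ → V) (n : ℕ) : Prop :=
  Set.InjOn g (Set.Iio (3 * n + 1)) ∧ ∀ i < n, col (pathEdge g i) = b

/-- The red loose path `P = e_1 … e_n` listed by `g` is maximal with respect to `W`:
there is no red loose path `P' = e_1 … e_{i-1} e'_i … e'_{i+r} e_{i+r} … e_n` with
`n+1` edges (here `1 ≤ r ≤ n`, `1 ≤ i ≤ n - r + 1`, indices of edges 1-based) such that
`V(P') = V(P) ∪ W'` for some `W' ⊆ W`, and moreover if `i = 1` then the first vertex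
of `P'` equals the first vertex of `P`, and if `i + r - 1 = n` then the last vertex
of `P'` equals the last vertex of `P`. -/
def MaximalWrt {V : Type*} [DecidableEq V] (col : Finset V → Bool)
    (g : ℕ → V) (n : ℕ) (W : Set V) : Prop :=
  ¬ ∃ (g' : ℕ → V) (r i : ℕ), 1 ≤ r ∧ r ≤ n ∧ 1 ≤ i ∧ i ≤ n - r + 1 ∧
      IsLoosePath4 col true g' (n + 1) ∧
      (∀ j, j + 1 < i → pathEdge g' j = pathEdge g j) ∧
      (∀ j, i + r - 1 ≤ j → j < n → pathEdge g' (j + 1) = pathEdge g j) ∧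
      pathVerts g n ⊆ pathVerts g' (n + 1) ∧
      pathVerts g' (n + 1) ⊆ pathVerts g n ∪ W ∧
      (i = 1 → g' 0 = g 0) ∧
      (i + r - 1 = n → g' (3 * (n + 1)) = g (3 * n))

theorem comb_core (U Q : Fin 5 → Fin 5 → Prop) (B : Fin 5 → Fin 5 → Fin 5 → Prop)
    (Us : ∀ x y, U x y → U y x)
    (B1 : ∀ x y z, B x y z → B y x z) (B2 : ∀ x y z, B x y z → B x z y)
    (C1 : ∀ α β γ δ ε, [α, β, γ, δ, ε].Nodup → U α β → U γ δ → False)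
    (C2 : ∀ α β γ δ ε, [α, β, γ, δ, ε].Nodup → U α β → B β γ δ → False)
    (C3 : ∀ α β γ δ ε, [α, β, γ, δ, ε].Nodup → B α β γ → B γ δ ε → False)
    (C5 : ∀ α β γ δ, [α, β, γ, δ, 3].Nodup → Q α β → Q γ δ → False)
    (H : ∀ α β γ δ ε, [α, β, γ, δ, ε].Nodup → U α β ∨ B β γ δ ∨ Q δ ε) : False := by
  by_cases hB : ∃ x y z s t, [x, y, z, s, t].Nodup ∧ B x y z
  · have key : ∀ x y z s t, [x, y, z, s, t].Nodup → B x y z → Q y z ∧ Q t z := by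
      intro x y z s t hn hb
      have n1 : [x, s, t, y, z].Nodup := by simp at hn ⊢; grind
      have n2 : [x, s, y, t, z].Nodup := by simp at hn ⊢; grind
      have n3 : [s, x, y, z, t].Nodup := by simp at hn ⊢; grind
      have n4 : [x, z, y, t, s].Nodup := by simp at hn ⊢; grind
      have hU : ¬ U x s := fun h => C2 _ _ _ _ _ n3 (Us _ _ h) hb
      have hB' : ¬ B s y t := fun h => C3 _ _ _ _ _ n4 (B2 _ _ _ hb) (B2 _ _ _ (B1 _ _ _ h))
      have hB'' : ¬ B s t y := fun h => hB' (B2 _ _ _ h)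
      have := H _ _ _ _ _ n1
      have := H _ _ _ _ _ n2
      tauto
    obtain ⟨x, y, z, s, t, hn, hb⟩ := hB
    have hb2 : B y z x := B2 _ _ _ (B1 _ _ _ hb)
    have hb3 : B z x y := B2 _ _ _ (B1 _ _ _ hb2)
    have k1 := key x y z s t hn hb
    have k1' := key x y z t s (by simp at hn ⊢; grind) hb
    have k2 := key y z x s t (by simp at hn ⊢; grind) hb2
    have k2' := key y z x t s (by simp at hn ⊢; grind) hb2
    have k3 := key z x y s t (by simp at hn ⊢; grind) hb3
    have k3' := key z x y t s (by simp at hn ⊢; grind) hb3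
    have h3 : x = 3 ∨ y = 3 ∨ z = 3 ∨ s = 3 ∨ t = 3 := by
      revert hn; clear * -; revert x y z s t; decide
    rcases h3 with rfl | rfl | rfl | rfl | rfl
    · exact C5 s y t z (by simp at hn ⊢; grind) k3'.2 k1.2
    · exact C5 s x t z (by simp at hn ⊢; grind) k2'.2 k1.2
    · exact C5 s x t y (by simp at hn ⊢; grind) k2'.2 k3.2
    · exact C5 x y t z (by simp at hn ⊢; grind) k3.1 k1.2
    · exact C5 x y s z (by simp at hn ⊢; grind) k3.1 k1'.2
  · have H' : ∀ α β γ δ ε, [α, β, γ, δ, ε].Nodup → U α β ∨ Q δ ε := by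
      intro α β γ δ ε hn
      have := H _ _ _ _ _ hn
      have : ¬ B β γ δ := fun h => hB ⟨β, γ, δ, α, ε, by simp at hn ⊢; grind, h⟩
      tauto
    -- if a pair is not in Q, then U holds on all pairs of its complement
    have K : ∀ x y z w, [x, y, z, w, 3].Nodup → U x y ∧ U x 3 ∧ U y 3 ∨ U z w ∧ U z 3 ∧ U w 3 := by
      intro x y z w hn
      by_cases hq : Q z w
      · have hq' : ¬ Q x y := fun h => C5 _ _ _ _ hn h hq
        have a1 := H' z w 3 x y (by simp at hn ⊢; grind)
        have a2 := H' z 3 w x y (by simp at hn ⊢; grind)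
        have a3 := H' w 3 z x y (by simp at hn ⊢; grind)
        tauto
      · have a1 := H' x y 3 z w (by simp at hn ⊢; grind)
        have a2 := H' x 3 y z w (by simp at hn ⊢; grind)
        have a3 := H' y 3 x z w (by simp at hn ⊢; grind)
        tauto
    have k1 := K 0 1 2 4 (by decide)
    have k2 := K 0 2 1 4 (by decide)
    have c1 := C1 0 1 2 3 4 (by decide)
    have c2 := C1 0 1 4 3 2 (by decide)
    have c3 := C1 2 4 0 3 1 (by decide)
    have c4 := C1 2 4 1 3 0 (by decide)
    tauto

theorem pe {N : ℕ} (f : ℕ → Fin N) (j : ℕ) :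
    pathEdge f j = {f (3 * j), f (3 * j + 1), f (3 * j + 2), f (3 * j + 3)} := by
  ext z
  simp only [pathEdge, Finset.mem_image, Finset.mem_range, Finset.mem_insert, Finset.mem_singleton]
  constructor
  · rintro ⟨a, ha, rfl⟩
    interval_cases a <;> simp
  · rintro (rfl | rfl | rfl | rfl)
    exacts [⟨0, by simp⟩, ⟨1, by simp⟩, ⟨2, by simp⟩, ⟨3, by simp⟩]

theorem sw1 {N : ℕ} (a b x d : Fin N) : ({a, b, x, d} : Finset (Fin N)) = {x, a, b, d} := by
  ext z; simp; tauto

theorem sw2 {N : ℕ} (a b x d : Fin N) : ({a, b, x, d} : Finset (Fin N)) = {a, d, x, b} := by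
  ext z; simp; tauto

theorem sw3 {N : ℕ} (a b x d : Fin N) : ({a, b, x, d} : Finset (Fin N)) = {a, b, d, x} := by
  ext z; simp; tauto

set_option maxHeartbeats 1500000 in
theorem no_ext {N : ℕ} (n i m s1 s2 s3 s4 s5 : ℕ) (hi : 1 ≤ i) (hin : i + 1 ≤ n)
    (col : Finset (Fin N) → Bool) (g : ℕ → Fin N)
    (hP : IsLoosePath4 col true g n)
    (W : Finset (Fin N)) (hWP : ∀ w ∈ W, w ∉ pathVerts g n)
    (hmax : MaximalWrt col g n ↑W)
    (hm : m ≤ 3 * (i - 1)) (hm2 : 3 * (i - 1) ≤ m + 2) 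
    (h1 : 1 ≤ s1 ∧ s1 ≤ 5) (h2 : 1 ≤ s2 ∧ s2 ≤ 5) (h3 : 1 ≤ s3 ∧ s3 ≤ 5)
    (h4 : 1 ≤ s4 ∧ s4 ≤ 5) (h5 : 1 ≤ s5 ∧ s5 ≤ 5) (hs : [s1, s2, s3, s4, s5].Nodup)
    (x1 x2 x3 : Fin N) (hx1 : x1 ∈ W) (hx2 : x2 ∈ W) (hx3 : x3 ∈ W)
    (h12 : x1 ≠ x2) (h13 : x1 ≠ x3) (h23 : x2 ≠ x3)
    (r1 : col {x1, g m, g (3 * (i - 1) + s1), g (3 * (i - 1) + s2)} = true)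
    (r2 : col {x2, g (3 * (i - 1) + s2), g (3 * (i - 1) + s3), g (3 * (i - 1) + s4)} = true)
    (r3 : col {x3, g (3 * (i - 1) + s4), g (3 * (i - 1) + s5), g (3 * (i - 1) + 6)} = true) :
    False := by
  obtain ⟨hinj, hred⟩ := hP
  obtain ⟨k, hk⟩ : ∃ k, k = 3 * (i - 1) := ⟨_, rfl⟩
  rw [← hk] at hm hm2 r1 r2 r3
  have hg : ∀ a b, a ≤ 3 * n → b ≤ 3 * n → g a = g b → a = b := fun a b ha hb h =>
    hinj (by simp; omega) (by simp; omega) h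
  have hgW : ∀ w ∈ W, ∀ a, a ≤ 3 * n → g a ≠ w := by
    intro w hw a ha h
    exact hWP w hw ⟨a, by simp; omega, h⟩
  obtain ⟨G, hG⟩ : ∃ G : ℕ → Fin N, ∀ j, G j = if j ≤ 3 * n then g j else
    if j = 3 * n + 1 then x1 else if j = 3 * n + 2 then x2 else x3 := ⟨_, fun j => rfl⟩
  have G1 : G (3 * n + 1) = x1 := by rw [hG]; simp
  have G2 : G (3 * n + 2) = x2 := by rw [hG]; simp
  have G3 : G (3 * n + 3) = x3 := by rw [hG]; simp
  have G0 : ∀ j, j ≤ 3 * n → G j = g j := by intro j hj; rw [hG, if_pos hj]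
  have Ginj : ∀ a b, a < 3 * n + 4 → b < 3 * n + 4 → G a = G b → a = b := by
    intro a b ha hb h
    have ca : a ≤ 3 * n ∨ a = 3 * n + 1 ∨ a = 3 * n + 2 ∨ a = 3 * n + 3 := by omega
    have cb : b ≤ 3 * n ∨ b = 3 * n + 1 ∨ b = 3 * n + 2 ∨ b = 3 * n + 3 := by omega
    rcases ca with ca | rfl | rfl | rfl <;> rcases cb with cb | rfl | rfl | rfl <;>
      (try simp only [G1, G2, G3] at h) <;> first | rfl | (exfalso; tauto) | skip
    · rw [G0 _ ca, G0 _ cb] at h; exact hg _ _ ca cb h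
    all_goals exfalso
    · rw [G0 _ ca] at h; exact hgW _ hx1 _ ca h
    · rw [G0 _ ca] at h; exact hgW _ hx2 _ ca h
    · rw [G0 _ ca] at h; exact hgW _ hx3 _ ca h
    · rw [G0 _ cb] at h; exact hgW _ hx1 _ cb h.symm
    · rw [G0 _ cb] at h; exact hgW _ hx2 _ cb h.symm
    · rw [G0 _ cb] at h; exact hgW _ hx3 _ cb h.symm
  obtain ⟨p, hp⟩ : ∃ p : ℕ → ℕ, ∀ j, p j =
      if j < k then (if j = m then k else j) else
      if j = k then m else
      if j = k + 1 then k + s1 else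
      if j = k + 2 then 3 * n + 1 else
      if j = k + 3 then k + s2 else
      if j = k + 4 then k + s3 else
      if j = k + 5 then 3 * n + 2 else
      if j = k + 6 then k + s4 else
      if j = k + 7 then k + s5 else
      if j = k + 8 then 3 * n + 3 else j - 3 := ⟨_, fun j => rfl⟩
  have pcase : ∀ j, (j < k ∧ j = m ∧ p j = k) ∨ (j < k ∧ j ≠ m ∧ p j = j) ∨ (j = k ∧ p j = m) ∨
      (j = k + 1 ∧ p j = k + s1) ∨ (j = k + 2 ∧ p j = 3 * n + 1) ∨ (j = k + 3 ∧ p j = k + s2) ∨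
      (j = k + 4 ∧ p j = k + s3) ∨ (j = k + 5 ∧ p j = 3 * n + 2) ∨ (j = k + 6 ∧ p j = k + s4) ∨
      (j = k + 7 ∧ p j = k + s5) ∨ (j = k + 8 ∧ p j = 3 * n + 3) ∨
      (k + 9 ≤ j ∧ p j = j - 3) := by
    intro j
    have := hp j
    clear hp hs
    split_ifs at this
    · left; exact ⟨by omega, by omega, this⟩
    · iterate 1 right
      left; exact ⟨by omega, by omega, this⟩
    · iterate 2 right
      left; exact ⟨by omega, this⟩
    · iterate 3 right
      left; exact ⟨by omega, this⟩
    · iterate 4 right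
      left; exact ⟨by omega, this⟩
    · iterate 5 right
      left; exact ⟨by omega, this⟩
    · iterate 6 right
      left; exact ⟨by omega, this⟩
    · iterate 7 right
      left; exact ⟨by omega, this⟩
    · iterate 8 right
      left; exact ⟨by omega, this⟩
    · iterate 9 right
      left; exact ⟨by omega, this⟩
    · iterate 10 right
      left; exact ⟨by omega, this⟩
    · iterate 11 right
      exact ⟨by omega, this⟩
  have plt : ∀ j, j < 3 * n + 4 → p j < 3 * n + 4 := by
    intro j hj
    have := pcase j
    omega
  have sne : (s1 = s2 ∨ s1 = s3 ∨ s1 = s4 ∨ s1 = s5 ∨ s2 = s3 ∨ s2 = s4 ∨ s2 = s5 ∨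
      s3 = s4 ∨ s3 = s5 ∨ s4 = s5) → False := by
    clear * - hs; simp at hs; tauto
  have pinj : ∀ a b, a < 3 * n + 4 → b < 3 * n + 4 → p a = p b → a = b := by
    have key : ∀ a b, a < 3 * n + 4 → b < 3 * n + 4 → p a = p b → a < b → False := by
      intro a b ha hb h hab
      have da := pcase a
      have db := pcase b
      rw [h] at da
      generalize p b = t at *
      clear * - da db sne hm hm2 hk hi hin h1 h2 h3 h4 h5 ha hb hab
      rcases da with c | c | c | c | c | c | c | c | c | c | c | c <;>
      rcases db with d | d | d | d | d | d | d | d | d | d | d | d <;>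
      first
      | (clear sne; omega)
      | (refine sne ?_; clear sne; first
          | exact Or.inl (by omega)
          | exact Or.inr (Or.inl (by omega))
          | exact Or.inr (Or.inr (Or.inl (by omega)))
          | (iterate 3 right); exact Or.inl (by omega)
          | (iterate 4 right); exact Or.inl (by omega)
          | (iterate 5 right); exact Or.inl (by omega)
          | (iterate 6 right); exact Or.inl (by omega)
          | (iterate 7 right); exact Or.inl (by omega)
          | (iterate 8 right); exact Or.inl (by omega)
          | (iterate 9 right); omega)
    intro a b ha hb h
    rcases lt_trichotomy a b with hab | hab | hab
    · exact (key a b ha hb h hab).elim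
    · exact hab
    · exact (key b a hb ha h.symm hab).elim
  clear sne
  have psurj : ∀ b, b < 3 * n + 4 → ∃ a, a < 3 * n + 4 ∧ p a = b := by
    have := Finset.surj_on_of_inj_on_of_card_le (s := Finset.range (3 * n + 4))
      (t := Finset.range (3 * n + 4)) (fun a _ => p a)
      (fun a ha => by simpa using plt a (by simpa using ha))
      (fun a b ha hb h => pinj a b (by simpa using ha) (by simpa using hb) h) le_rfl
    intro b hb
    obtain ⟨a, ha, h⟩ := this b (by simpa using hb)
    exact ⟨a, by simpa using ha, h.symm⟩
  have v0 : G (p k) = g m := by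
    rw [show p k = m by have := pcase k; omega]; exact G0 _ (by omega)
  have v1 : G (p (k + 1)) = g (k + s1) := by
    rw [show p (k + 1) = k + s1 by have := pcase (k + 1); omega]; exact G0 _ (by omega)
  have v2 : G (p (k + 2)) = x1 := by
    rw [show p (k + 2) = 3 * n + 1 by have := pcase (k + 2); omega, G1]
  have v3 : G (p (k + 3)) = g (k + s2) := by
    rw [show p (k + 3) = k + s2 by have := pcase (k + 3); omega]; exact G0 _ (by omega)
  have v4 : G (p (k + 4)) = g (k + s3) := by
    rw [show p (k + 4) = k + s3 by have := pcase (k + 4); omega]; exact G0 _ (by omega)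
  have v5 : G (p (k + 5)) = x2 := by
    rw [show p (k + 5) = 3 * n + 2 by have := pcase (k + 5); omega, G2]
  have v6 : G (p (k + 6)) = g (k + s4) := by
    rw [show p (k + 6) = k + s4 by have := pcase (k + 6); omega]; exact G0 _ (by omega)
  have v7 : G (p (k + 7)) = g (k + s5) := by
    rw [show p (k + 7) = k + s5 by have := pcase (k + 7); omega]; exact G0 _ (by omega)
  have v8 : G (p (k + 8)) = x3 := by
    rw [show p (k + 8) = 3 * n + 3 by have := pcase (k + 8); omega, G3]
  have vhi : ∀ j, k + 9 ≤ j → j < 3 * n + 4 → G (p j) = g (j - 3) := by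
    intro j hj hj'
    rw [show p j = j - 3 by have := pcase j; omega]; exact G0 _ (by omega)
  have vlo : ∀ j, j ≤ k → j ≠ m → j ≠ k → G (p j) = g j := by
    intro j hj hj' hj''
    rw [show p j = j by have := pcase j; omega]; exact G0 _ (by omega)
  have vm : G (p m) = g k := by
    rw [show p m = k by have := pcase m; omega]; exact G0 _ (by omega)
  have elo : ∀ j, j + 1 < i → pathEdge (fun j => G (p j)) j = pathEdge g j := by
    intro j hj
    rw [pe, pe]
    by_cases hl : 3 * j + 3 = k
    · have cm : m = k ∨ m = 3 * j + 1 ∨ m = 3 * j + 2 := by omega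
      rw [← hl] at v0 vlo vm cm
      have w0 := vlo (3 * j) (by omega) (by omega) (by omega)
      rcases cm with c | c | c
      · have w1 := vlo (3 * j + 1) (by omega) (by omega) (by omega)
        have w2 := vlo (3 * j + 2) (by omega) (by omega) (by omega)
        rw [c] at v0
        simp only [w0, w1, w2, v0]
      · have w2 := vlo (3 * j + 2) (by omega) (by omega) (by omega)
        rw [c] at v0 vm
        simp only [w0, w2, v0, vm]
        exact sw2 _ _ _ _
      · have w1 := vlo (3 * j + 1) (by omega) (by omega) (by omega)
        rw [c] at v0 vm
        simp only [w0, w1, v0, vm]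
        exact sw3 _ _ _ _
    · have w0 := vlo (3 * j) (by omega) (by omega) (by omega)
      have w1 := vlo (3 * j + 1) (by omega) (by omega) (by omega)
      have w2 := vlo (3 * j + 2) (by omega) (by omega) (by omega)
      have w3 := vlo (3 * j + 3) (by omega) (by omega) (by omega)
      simp only [w0, w1, w2, w3]
  have ehi : ∀ j, i + 1 ≤ j → j < n → pathEdge (fun j => G (p j)) (j + 1) = pathEdge g j := by
    intro j hj hj'
    rw [pe, pe]
    have w0 := vhi (3 * (j + 1)) (by omega) (by omega)
    have w1 := vhi (3 * (j + 1) + 1) (by omega) (by omega)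
    have w2 := vhi (3 * (j + 1) + 2) (by omega) (by omega)
    have w3 := vhi (3 * (j + 1) + 3) (by omega) (by omega)
    simp only [w0, w1, w2, w3]
    rfl
  have v9 : G (p (k + 9)) = g (k + 6) := vhi (k + 9) le_rfl (by omega)
  refine hmax ⟨fun j => G (p j), 2, i, by omega, by omega, hi, by omega, ⟨?_, ?_⟩, elo, ?_, ?_, ?_, ?_, ?_⟩
  · intro a ha b hb h
    simp at ha hb
    exact pinj a b (by omega) (by omega)
      (Ginj _ _ (plt _ (by omega)) (plt _ (by omega)) h)
  · intro j hj
    have : j + 1 < i ∨ j + 1 = i ∨ j = i ∨ j = i + 1 ∨ i + 2 ≤ j := by omega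
    rcases this with h | h | h | h | h
    · rw [elo j h]; exact hred j (by omega)
    · rw [pe, show 3 * j = k by omega]
      simp only [v0, v1, v2, v3]
      rw [sw1]; exact r1
    · rw [pe, show 3 * j = k + 3 by omega]
      simp only [add_assoc, Nat.reduceAdd, v3, v4, v5, v6]
      rw [sw1]; exact r2
    · rw [pe, show 3 * j = k + 6 by omega]
      simp only [add_assoc, Nat.reduceAdd, v6, v7, v8, v9]
      rw [sw1]; exact r3
    · obtain ⟨j, rfl⟩ : ∃ l, j = l + 1 := ⟨j - 1, by omega⟩
      rw [ehi j (by omega) (by omega)]; exact hred j (by omega)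
  · intro j hj hj'
    exact ehi j (by omega) hj'
  · rintro _ ⟨a, ha, rfl⟩
    simp at ha
    obtain ⟨b, hb, h⟩ := psurj a (by omega)
    exact ⟨b, by simp; omega, by simp only [h]; exact G0 _ (by omega)⟩
  · rintro _ ⟨a, ha, rfl⟩
    simp at ha
    have := plt a (by omega)
    have ca : p a ≤ 3 * n ∨ p a = 3 * n + 1 ∨ p a = 3 * n + 2 ∨ p a = 3 * n + 3 := by omega
    rcases ca with h | h | h | h
    · left; exact ⟨p a, by simp; omega, (G0 _ h).symm⟩
    · right; simp only [h, G1]; exact hx1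
    · right; simp only [h, G2]; exact hx2
    · right; simp only [h, G3]; exact hx3
  · intro h1
    have k0 : k = 0 := by omega
    have m0 : m = 0 := by omega
    rw [k0, m0] at v0
    exact v0
  · intro h
    have e : 3 * (n + 1) = k + 9 := by omega
    simp only [e, v9]
    congr 1; omega

theorem sdr3 {V : Type*} [DecidableEq V] (A B C : Finset V) (hA : ¬ A.card ≤ 2) (hB : ¬ B.card ≤ 2)
    (hC : ¬ C.card ≤ 2) : ∃ x ∈ A, ∃ y ∈ B, ∃ z ∈ C, x ≠ y ∧ x ≠ z ∧ y ≠ z := by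
  obtain ⟨x, hx⟩ : A.Nonempty := by rw [← Finset.card_pos]; omega
  obtain ⟨y, hy, hy'⟩ := Finset.exists_mem_notMem_of_card_lt_card (s := {x}) (t := B) (by simp; omega)
  obtain ⟨z, hz, hz'⟩ := Finset.exists_mem_notMem_of_card_lt_card (s := {x, y}) (t := C)
    (lt_of_le_of_lt Finset.card_le_two (by omega))
  simp at hy' hz'
  exact ⟨x, hx, y, hy, z, hz, fun h => hy' h.symm, fun h => hz'.1 h.symm, fun h => hz'.2 h.symm⟩

/-- Few red completions. -/
def Few {N : ℕ} (col : Finset (Fin N) → Bool) (W : Finset (Fin N)) (x y z : Fin N) : Prop :=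
  (W.filter fun w => col {w, x, y, z} = true).card ≤ 2

theorem Few.s1 {N : ℕ} {col : Finset (Fin N) → Bool} {W : Finset (Fin N)} {x y z : Fin N}
    (h : Few col W x y z) : Few col W y x z := by
  have e : ∀ w : Fin N, ({w, x, y, z} : Finset (Fin N)) = {w, y, x, z} := by
    intro w; ext t; simp; tauto
  simpa only [Few, e] using h

theorem Few.s2 {N : ℕ} {col : Finset (Fin N) → Bool} {W : Finset (Fin N)} {x y z : Fin N}
    (h : Few col W x y z) : Few col W x z y := by
  have e : ∀ w : Fin N, ({w, x, y, z} : Finset (Fin N)) = {w, x, z, y} := by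
    intro w; ext t; simp; tauto
  simpa only [Few, e] using h

theorem Few.blue {N : ℕ} {col : Finset (Fin N) → Bool} {W : Finset (Fin N)} {x y z : Fin N}
    (h : Few col W x y z) : W.card - 2 ≤ (W.filter fun w => col {w, x, y, z} = false).card := by
  have := Finset.card_filter_add_card_filter_not (s := W) (fun w => col {w, x, y, z} = true)
  simp only [Bool.not_eq_true] at this
  unfold Few at h
  omega

theorem finish {N : ℕ} (col : Finset (Fin N) → Bool) (W E E' : Finset (Fin N)) (hW : 4 ≤ W.card)
    (S : Finset (Fin N)) (f v a0 a1 a2 a3 a4 : Fin N) (hn : [a0, a1, a2, a3, a4].Nodup)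
    (hv : v ∈ E.erase f) (hv' : v ∉ E') 
    (hS : ∀ a ∈ [a0, a1, a2, a3, a4], a ∈ S ∪ E.erase v ∧ a ≠ v)
    (F1 : Few col W a0 a1 a2) (F2 : Few col W a2 a3 a4) :
    ∃ (x y : Fin N) (a : Fin 5 → Fin N) (v : Fin N),
      x ∈ W ∧ y ∈ W ∧ x ≠ y ∧ Function.Injective a ∧
      v ∈ E.erase f ∧
      (∀ j, a j ∈ S ∪ E.erase v) ∧
      col {x, a 0, a 1, a 2} = false ∧ col {a 2, a 3, a 4, y} = false ∧
      (∃ w ∈ E, w ∉ E' ∧ ∀ j, a j ≠ w) ∧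
      ∃ W₁ W₂ : Finset (Fin N), W₁ ⊆ W ∧ W₂ ⊆ W ∧
        W.card - 2 ≤ W₁.card ∧ W.card - 3 ≤ W₂.card ∧
        ∀ x' ∈ W₁, ∀ y' ∈ W₂, x' ≠ y' →
          col {x', a 0, a 1, a 2} = false ∧ col {a 2, a 3, a 4, y'} = false := by
  have b1 := F1.blue
  have b2 := F2.blue
  have e : ∀ w : Fin N, ({a2, a3, a4, w} : Finset (Fin N)) = {w, a2, a3, a4} := by
    intro w; ext t; simp; tauto
  obtain ⟨x, hx⟩ : (W.filter fun w => col {w, a0, a1, a2} = false).Nonempty := by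
    rw [← Finset.card_pos]; omega
  obtain ⟨y, hy, hy'⟩ := Finset.exists_mem_notMem_of_card_lt_card (s := {x})
    (t := W.filter fun w => col {w, a2, a3, a4} = false) (by simp; omega)
  simp only [Finset.mem_filter] at hx hy
  have hS' : ∀ j, ![a0, a1, a2, a3, a4] j ∈ S ∪ E.erase v ∧ ![a0, a1, a2, a3, a4] j ≠ v := by
    intro j; apply hS; fin_cases j <;> simp
  refine ⟨x, y, ![a0, a1, a2, a3, a4], v, hx.1, hy.1, ?_, ?_, hv, fun j => (hS' j).1, hx.2, ?_,
    ⟨v, Finset.mem_of_mem_erase hv, hv', fun j => (hS' j).2⟩,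
    _, _, Finset.filter_subset _ _, Finset.filter_subset _ _, b1, le_trans (by omega) b2, ?_⟩
  · rintro rfl; simp at hy'
  · exact List.nodup_ofFn.1 (by simpa using hn)
  · exact (congrArg col (e y)).trans hy.2
  · intro x' hx' y' hy' _
    simp only [Finset.mem_filter] at hx' hy'
    exact ⟨hx'.2, (congrArg col (e y')).trans hy'.2⟩

/-- Lemma 2.4: if a red loose path P (listed by g) in a 2-colored complete 4-uniform
hypergraph on Fin N is maximal w.r.t. a set W disjoint from V(P) with |W| ≥ 4, then for
every two consecutive edges eᵢ, e_{i+1} of P (1-indexed; eᵢ = pathEdge g (i-1)) and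
every u ∈ Aᵢ (where A₁ = {f_{P,e₁}} and Aᵢ = e_{i-1} \ {f_{P,e_{i-1}}} for i > 1) there
are x, y ∈ W, some v ∈ A_{i+2}, and five distinct vertices
a₁,…,a₅ ∈ ((eᵢ \ {f_{P,eᵢ}}) ∪ {u}) ∪ (e_{i+1} \ {v}) such that {x,a₁,a₂,a₃} and
{a₃,a₄,a₅,y} are both blue and some vertex of e_{i+1} \ eᵢ avoids the aⱼ. Moreover
there are W₁, W₂ ⊆ W with |W₁| ≥ |W| - 2, |W₂| ≥ |W| - 3 such that the end vertices
may be replaced by any distinct x' ∈ W₁, y' ∈ W₂. -/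
theorem good_configuration_general (N n i : ℕ) (hi : 1 ≤ i) (hin : i + 1 ≤ n)
    (col : Finset (Fin N) → Bool) (g : ℕ → Fin N)
    (hP : IsLoosePath4 col true g n)
    (W : Finset (Fin N)) (hWP : ∀ w ∈ W, w ∉ pathVerts g n)
    (hW : 4 ≤ W.card) (hmax : MaximalWrt col g n ↑W)
    (u : Fin N)
    (hu : u ∈ (if i = 1 then ({g 0} : Finset (Fin N))
               else (pathEdge g (i - 2)).erase (g (3 * (i - 2))))) :
    ∃ (x y : Fin N) (a : Fin 5 → Fin N) (v : Fin N),
      x ∈ W ∧ y ∈ W ∧ x ≠ y ∧ Function.Injective a ∧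
      v ∈ (pathEdge g i).erase (g (3 * i)) ∧
      (∀ j, a j ∈ ((pathEdge g (i - 1)).erase (g (3 * (i - 1))) ∪ {u}) ∪
        (pathEdge g i).erase v) ∧
      col {x, a 0, a 1, a 2} = false ∧ col {a 2, a 3, a 4, y} = false ∧
      (∃ w ∈ pathEdge g i, w ∉ pathEdge g (i - 1) ∧ ∀ j, a j ≠ w) ∧
      ∃ W₁ W₂ : Finset (Fin N), W₁ ⊆ W ∧ W₂ ⊆ W ∧
        W.card - 2 ≤ W₁.card ∧ W.card - 3 ≤ W₂.card ∧
        ∀ x' ∈ W₁, ∀ y' ∈ W₂, x' ≠ y' →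
          col {x', a 0, a 1, a 2} = false ∧ col {a 2, a 3, a 4, y'} = false := by
  have hinj := hP.1
  have hg : ∀ a b, a ≤ 3 * n → b ≤ 3 * n → g a = g b → a = b := fun a b ha hb h =>
    hinj (by simp; omega) (by simp; omega) h
  obtain ⟨m, hm, hm2, rfl⟩ : ∃ m, m ≤ 3 * (i - 1) ∧ 3 * (i - 1) ≤ m + 2 ∧ u = g m := by
    by_cases h1 : i = 1
    · rw [if_pos h1] at hu
      exact ⟨0, by omega, by omega, by simpa using hu⟩
    · rw [if_neg h1, Finset.mem_erase, pe] at hu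
      obtain ⟨hne, hu⟩ := hu
      simp only [Finset.mem_insert, Finset.mem_singleton] at hu
      rcases hu with h | h | h | h
      · exact absurd h hne
      · exact ⟨_, by omega, by omega, h⟩
      · exact ⟨_, by omega, by omega, h⟩
      · exact ⟨_, by omega, by omega, h⟩
  clear hu
  have H : ∀ α β γ δ ε : Fin 5, [α, β, γ, δ, ε].Nodup →
      Few col W (g m) (g (3 * (i - 1) + (α + 1))) (g (3 * (i - 1) + (β + 1))) ∨
      Few col W (g (3 * (i - 1) + (β + 1))) (g (3 * (i - 1) + (γ + 1))) (g (3 * (i - 1) + (δ + 1))) ∨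
      Few col W (g (3 * (i - 1) + (δ + 1))) (g (3 * (i - 1) + (ε + 1))) (g (3 * (i - 1) + 6)) := by
    intro α β γ δ ε hn
    by_contra hc
    simp only [not_or] at hc
    obtain ⟨x, hx, y, hy, z, hz, hxy, hxz, hyz⟩ := sdr3 _ _ _ hc.1 hc.2.1 hc.2.2
    simp only [Finset.mem_filter] at hx hy hz
    exact no_ext n i m (α + 1) (β + 1) (γ + 1) (δ + 1) (ε + 1) hi hin col g hP W hWP hmax hm hm2
      (by omega) (by omega) (by omega) (by omega) (by omega)
      (by simp [Fin.ext_iff] at hn ⊢; exact hn)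
      x y z hx.1 hy.1 hz.1 hxy hxz hyz hx.2 hy.2 hz.2
  have e6 : 3 * (i - 1) + 6 = 3 * i + 3 := by omega
  obtain ⟨L, hL⟩ : ∃ L : Fin 5 → Fin N, ∀ j, L j = g (3 * (i - 1) + (j + 1)) := ⟨_, fun j => rfl⟩
  simp only [← hL, e6] at H
  have Linj : ∀ a b, L a = L b → a = b := by
    intro a b h
    rw [hL, hL] at h
    have := hg _ _ (by omega) (by omega) h
    omega
  have Lm : ∀ a, g m ≠ L a := by
    intro a h
    rw [hL] at h
    have := hg _ _ (by omega) (by omega) h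
    omega
  have Lq : ∀ a, L a ≠ g (3 * i + 3) := by
    intro a h
    rw [hL] at h
    have := hg _ _ (by omega) (by omega) h
    omega
  have mq : g m ≠ g (3 * i + 3) := by
    intro h
    have := hg _ _ (by omega) (by omega) h
    omega
  have hE : ∀ j, i - 1 ≤ j → j ≤ i → ∀ z, z ∈ pathEdge g j ↔
      z = g (3 * j) ∨ z = g (3 * j + 1) ∨ z = g (3 * j + 2) ∨ z = g (3 * j + 3) := by
    intro j _ _ z; rw [pe]; simp
  have memL : ∀ j v, L j ≠ v → L j ∈ ((pathEdge g (i - 1)).erase (g (3 * (i - 1))) ∪ {g m}) ∪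
        (pathEdge g i).erase v := by
    intro j v hv
    simp only [Finset.mem_union, Finset.mem_erase, hE (i - 1) le_rfl (by omega),
      hE i (by omega) le_rfl]
    by_cases hj : j.val ≤ 2
    · left; left
      refine ⟨fun h => ?_, ?_⟩
      · rw [hL] at h
        have := hg _ _ (by omega) (by omega) h
        omega
      · rw [hL]
        have : j.val = 0 ∨ j.val = 1 ∨ j.val = 2 := by omega
        rcases this with h | h | h <;> simp [h]
    · right
      refine ⟨hv, ?_⟩
      rw [hL]
      have : j.val = 3 ∨ j.val = 4 := by omega
      rcases this with h | h <;> rw [h]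
      · right; left; congr 1; omega
      · right; right; left; congr 1; omega
  have memm : ∀ v, g m ∈ ((pathEdge g (i - 1)).erase (g (3 * (i - 1))) ∪ {g m}) ∪
        (pathEdge g i).erase v := by
    intro v; simp
  have memq : g (3 * i + 3) ∈ ((pathEdge g (i - 1)).erase (g (3 * (i - 1))) ∪ {g m}) ∪
        (pathEdge g i).erase (L 3) := by
    apply Finset.mem_union_right
    rw [Finset.mem_erase, hE i (by omega) le_rfl]
    exact ⟨(Lq 3).symm, by simp⟩
  have vq : g (3 * i + 3) ∈ (pathEdge g i).erase (g (3 * i)) := by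
    rw [Finset.mem_erase, hE i (by omega) le_rfl]
    refine ⟨fun h => ?_, by simp⟩
    have := hg _ _ (by omega) (by omega) h
    omega
  have L3 : L 3 = g (3 * i + 1) := by
    rw [hL]; congr 1; simp; omega
  have v3 : L 3 ∈ (pathEdge g i).erase (g (3 * i)) := by
    rw [Finset.mem_erase, hE i (by omega) le_rfl, L3]
    refine ⟨fun h => ?_, by simp⟩
    have := hg _ _ (by omega) (by omega) h
    omega
  have vq' : g (3 * i + 3) ∉ pathEdge g (i - 1) := by
    rw [hE (i - 1) le_rfl (by omega)]
    rintro (h | h | h | h) <;> have := hg _ _ (by omega) (by omega) h <;> omega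
  have v3' : L 3 ∉ pathEdge g (i - 1) := by
    rw [hE (i - 1) le_rfl (by omega), L3]
    rintro (h | h | h | h) <;> have := hg _ _ (by omega) (by omega) h <;> omega
  have Li : ∀ a b, a ≠ b → L a ≠ L b := fun a b h h' => h (Linj a b h')
  by_contra hcon
  refine comb_core (fun x y => Few col W (g m) (L x) (L y))
    (fun x y => Few col W (L x) (L y) (g (3 * i + 3)))
    (fun x y z => Few col W (L x) (L y) (L z))
    (fun x y h => h.s2) (fun x y z h => h.s1) (fun x y z h => h.s2) ?_ ?_ ?_ ?_ H
  · -- u α β, u γ δ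
    intro α β γ δ ε hn h1 h2
    refine hcon (finish col W _ _ hW _ _ _ (L α) (L β) (g m) (L γ) (L δ) ?_ vq vq' ?_
      h1.s1.s2 h2)
    · simp at hn ⊢; grind
    · intro a ha
      simp at ha
      rcases ha with rfl | rfl | rfl | rfl | rfl
      exacts [⟨memL _ _ (Lq _), Lq _⟩, ⟨memL _ _ (Lq _), Lq _⟩, ⟨memm _, mq⟩,
        ⟨memL _ _ (Lq _), Lq _⟩, ⟨memL _ _ (Lq _), Lq _⟩]
  · intro α β γ δ ε hn h1 h2
    refine hcon (finish col W _ _ hW _ _ _ (g m) (L α) (L β) (L γ) (L δ) ?_ vq vq' ?_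
      h1 h2)
    · simp at hn ⊢; grind
    · intro a ha
      simp at ha
      rcases ha with rfl | rfl | rfl | rfl | rfl
      exacts [⟨memm _, mq⟩, ⟨memL _ _ (Lq _), Lq _⟩, ⟨memL _ _ (Lq _), Lq _⟩,
        ⟨memL _ _ (Lq _), Lq _⟩, ⟨memL _ _ (Lq _), Lq _⟩]
  · intro α β γ δ ε hn h1 h2
    refine hcon (finish col W _ _ hW _ _ _ (L α) (L β) (L γ) (L δ) (L ε) ?_ vq vq' ?_
      h1 h2)
    · simp at hn ⊢; grind
    · intro a ha
      simp at ha
      rcases ha with rfl | rfl | rfl | rfl | rfl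
      exacts [⟨memL _ _ (Lq _), Lq _⟩, ⟨memL _ _ (Lq _), Lq _⟩, ⟨memL _ _ (Lq _), Lq _⟩,
        ⟨memL _ _ (Lq _), Lq _⟩, ⟨memL _ _ (Lq _), Lq _⟩]
  · intro α β γ δ hn h1 h2
    have n3 : α ≠ 3 ∧ β ≠ 3 ∧ γ ≠ 3 ∧ δ ≠ 3 := by simp at hn; tauto
    refine hcon (finish col W _ _ hW _ _ _ (L α) (L β) (g (3 * i + 3)) (L γ) (L δ) ?_ v3 v3' ?_
      h1 h2.s2.s1)
    · simp at hn ⊢; grind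
    · intro a ha
      simp at ha
      rcases ha with rfl | rfl | rfl | rfl | rfl
      exacts [⟨memL _ _ (Li _ _ n3.1), Li _ _ n3.1⟩, ⟨memL _ _ (Li _ _ n3.2.1), Li _ _ n3.2.1⟩,
        ⟨memq, (Lq 3).symm⟩, ⟨memL _ _ (Li _ _ n3.2.2.1), Li _ _ n3.2.2.1⟩,
        ⟨memL _ _ (Li _ _ n3.2.2.2), Li _ _ n3.2.2.2⟩]
end
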